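/- Let h(u,v) = \sum_{i=0}^{12} \binom{12}{i} \alpha_i u^i v^{12-i} with (\alpha_0, \dots, \alpha_{12}) = (192, 32, -32, 0, -16, -8, 24/7, 8, -20, -6, -58, -68, 423). Define g = (1/132^2)(h_{uu} h_{vv} - h_{uv}^2) and f = (1/240)(h_u g_v - h_v g_u), where subscripts denote partial derivatives with respect to u and v; then f is a binary form of degree 30 with integer coefficients. There are no integers u, v, y with (u, v) \neq (0, 0) and y^2 = f(u, v). -/

import Mathlib

open MvPolynomial

/-- The coefficient vector `(α₀, …, α₁₂)`. -/
noncomputable def alphaC23 : Fin 13 → ℚ := ![192, 32, -32, 0, -16, -8, 24/7, 8, -20, -6, -58, -68, 423]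

/-- The binary form `h(u,v) = ∑ i, (12 choose i) αᵢ uⁱ v^(12-i)`,
as a polynomial in the two variables `X 0 = u` and `X 1 = v`. -/
noncomputable def hC23 : MvPolynomial (Fin 2) ℚ :=
  ∑ i : Fin 13, C ((Nat.choose 12 i : ℚ) * alphaC23 i) * X 0 ^ (i : ℕ) * X 1 ^ (12 - (i : ℕ))

/-- `g = (1/132²)·(h_uu h_vv - h_uv²)`. -/
noncomputable def gC23 : MvPolynomial (Fin 2) ℚ :=
  C ((1 : ℚ) / 132 ^ 2) *
    (pderiv 0 (pderiv 0 hC23) * pderiv 1 (pderiv 1 hC23) -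
      pderiv 1 (pderiv 0 hC23) * pderiv 1 (pderiv 0 hC23))

/-- `f = (1/240)·(h_u g_v - h_v g_u)`. -/
noncomputable def fC23 : MvPolynomial (Fin 2) ℚ :=
  C ((1 : ℚ) / 240) *
    (pderiv 0 hC23 * pderiv 1 gC23 - pderiv 1 hC23 * pderiv 0 gC23)

set_option linter.unusedSimpArgs false

lemma hC23_eq : hC23 = 192 * X 1 ^ 12
    + 384 * X 0 * X 1 ^ 11
    - 2112 * X 0 ^ 2 * X 1 ^ 10
    - 7920 * X 0 ^ 4 * X 1 ^ 8
    - 6336 * X 0 ^ 5 * X 1 ^ 7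
    + 3168 * X 0 ^ 6 * X 1 ^ 6
    + 6336 * X 0 ^ 7 * X 1 ^ 5
    - 9900 * X 0 ^ 8 * X 1 ^ 4
    - 1320 * X 0 ^ 9 * X 1 ^ 3
    - 3828 * X 0 ^ 10 * X 1 ^ 2
    - 816 * X 0 ^ 11 * X 1
    + 423 * X 0 ^ 12 := by
  have e6 : (Nat.choose 12 6 : ℚ) * (24 / 7) = 3168 := by norm_num [Nat.choose]
  simp only [hC23, alphaC23, Fin.sum_univ_succ]
  simp [Nat.choose, -map_mul, -C_mul]
  norm_num [Nat.choose]
  simp only [map_ofNat]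
  ring

lemma pd01 : pderiv (0 : Fin 2) (X 1 : MvPolynomial (Fin 2) ℚ) = 0 :=
  pderiv_X_of_ne (by decide)

lemma pd10 : pderiv (1 : Fin 2) (X 0 : MvPolynomial (Fin 2) ℚ) = 0 :=
  pderiv_X_of_ne (by decide)

lemma pdn (i : Fin 2) (n : ℕ) [n.AtLeastTwo] :
    pderiv i (OfNat.ofNat n : MvPolynomial (Fin 2) ℚ) = 0 := by
  have : (OfNat.ofNat n : MvPolynomial (Fin 2) ℚ) = C (OfNat.ofNat n) := (map_ofNat C n).symm
  rw [this, pderiv_C]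

lemma hu_eq : pderiv 0 hC23 = 384 * X 1 ^ 11
    - 4224 * X 0 * X 1 ^ 10
    - 31680 * X 0 ^ 3 * X 1 ^ 8
    - 31680 * X 0 ^ 4 * X 1 ^ 7
    + 19008 * X 0 ^ 5 * X 1 ^ 6
    + 44352 * X 0 ^ 6 * X 1 ^ 5
    - 79200 * X 0 ^ 7 * X 1 ^ 4
    - 11880 * X 0 ^ 8 * X 1 ^ 3
    - 38280 * X 0 ^ 9 * X 1 ^ 2
    - 8976 * X 0 ^ 10 * X 1
    + 5076 * X 0 ^ 11 := by
  rw [hC23_eq]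
  simp only [map_add, map_sub, map_neg, Derivation.leibniz, Derivation.leibniz_pow, pderiv_X_self,
    pd01, pd10, pdn 0 192, pdn 0 384, pdn 0 423, pdn 0 816, pdn 0 1320, pdn 0 2112, pdn 0 3168, pdn 0 3828, pdn 0 6336, pdn 0 7920, pdn 0 9900, smul_eq_mul, nsmul_eq_mul, mul_zero, zero_add, mul_one, add_zero, smul_zero]
  push_cast
  ring

lemma hv_eq : pderiv 1 hC23 = 2304 * X 1 ^ 11
    + 4224 * X 0 * X 1 ^ 10
    - 21120 * X 0 ^ 2 * X 1 ^ 9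
    - 63360 * X 0 ^ 4 * X 1 ^ 7
    - 44352 * X 0 ^ 5 * X 1 ^ 6
    + 19008 * X 0 ^ 6 * X 1 ^ 5
    + 31680 * X 0 ^ 7 * X 1 ^ 4
    - 39600 * X 0 ^ 8 * X 1 ^ 3
    - 3960 * X 0 ^ 9 * X 1 ^ 2
    - 7656 * X 0 ^ 10 * X 1
    - 816 * X 0 ^ 11 := by
  rw [hC23_eq]
  simp only [map_add, map_sub, map_neg, Derivation.leibniz, Derivation.leibniz_pow, pderiv_X_self,
    pd01, pd10, pdn 1 192, pdn 1 384, pdn 1 423, pdn 1 816, pdn 1 1320, pdn 1 2112, pdn 1 3168, pdn 1 3828, pdn 1 6336, pdn 1 7920, pdn 1 9900, smul_eq_mul, nsmul_eq_mul, mul_zero, zero_add, mul_one, add_zero, smul_zero]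
  push_cast
  ring

lemma huu_eq : pderiv 0 (pderiv 0 hC23) = -4224 * X 1 ^ 10
    - 95040 * X 0 ^ 2 * X 1 ^ 8
    - 126720 * X 0 ^ 3 * X 1 ^ 7
    + 95040 * X 0 ^ 4 * X 1 ^ 6
    + 266112 * X 0 ^ 5 * X 1 ^ 5
    - 554400 * X 0 ^ 6 * X 1 ^ 4
    - 95040 * X 0 ^ 7 * X 1 ^ 3
    - 344520 * X 0 ^ 8 * X 1 ^ 2
    - 89760 * X 0 ^ 9 * X 1
    + 55836 * X 0 ^ 10 := by
  rw [hu_eq]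
  simp only [map_add, map_sub, map_neg, Derivation.leibniz, Derivation.leibniz_pow, pderiv_X_self,
    pd01, pd10, pdn 0 384, pdn 0 4224, pdn 0 5076, pdn 0 8976, pdn 0 11880, pdn 0 19008, pdn 0 31680, pdn 0 38280, pdn 0 44352, pdn 0 79200, smul_eq_mul, nsmul_eq_mul, mul_zero, zero_add, mul_one, add_zero, smul_zero]
  push_cast
  ring

lemma hvv_eq : pderiv 1 (pderiv 1 hC23) = 25344 * X 1 ^ 10
    + 42240 * X 0 * X 1 ^ 9
    - 190080 * X 0 ^ 2 * X 1 ^ 8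
    - 443520 * X 0 ^ 4 * X 1 ^ 6
    - 266112 * X 0 ^ 5 * X 1 ^ 5
    + 95040 * X 0 ^ 6 * X 1 ^ 4
    + 126720 * X 0 ^ 7 * X 1 ^ 3
    - 118800 * X 0 ^ 8 * X 1 ^ 2
    - 7920 * X 0 ^ 9 * X 1
    - 7656 * X 0 ^ 10 := by
  rw [hv_eq]
  simp only [map_add, map_sub, map_neg, Derivation.leibniz, Derivation.leibniz_pow, pderiv_X_self,
    pd01, pd10, pdn 1 816, pdn 1 2304, pdn 1 3960, pdn 1 4224, pdn 1 7656, pdn 1 19008, pdn 1 21120, pdn 1 31680, pdn 1 39600, pdn 1 44352, pdn 1 63360, smul_eq_mul, nsmul_eq_mul, mul_zero, zero_add, mul_one, add_zero, smul_zero]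
  push_cast
  ring

lemma huv_eq : pderiv 1 (pderiv 0 hC23) = 4224 * X 1 ^ 10
    - 42240 * X 0 * X 1 ^ 9
    - 253440 * X 0 ^ 3 * X 1 ^ 7
    - 221760 * X 0 ^ 4 * X 1 ^ 6
    + 114048 * X 0 ^ 5 * X 1 ^ 5
    + 221760 * X 0 ^ 6 * X 1 ^ 4
    - 316800 * X 0 ^ 7 * X 1 ^ 3
    - 35640 * X 0 ^ 8 * X 1 ^ 2
    - 76560 * X 0 ^ 9 * X 1
    - 8976 * X 0 ^ 10 := by
  rw [hu_eq]
  simp only [map_add, map_sub, map_neg, Derivation.leibniz, Derivation.leibniz_pow, pderiv_X_self,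
    pd01, pd10, pdn 1 384, pdn 1 4224, pdn 1 5076, pdn 1 8976, pdn 1 11880, pdn 1 19008, pdn 1 31680, pdn 1 38280, pdn 1 44352, pdn 1 79200, smul_eq_mul, nsmul_eq_mul, mul_zero, zero_add, mul_one, add_zero, smul_zero]
  push_cast
  ring

lemma C_unit_mul {c : ℚ} (d : ℕ) (hc : c * d = 1) {a b : MvPolynomial (Fin 2) ℚ}
    (h : a = (d : MvPolynomial (Fin 2) ℚ) * b) : C c * a = b := by
  have hd : (d : MvPolynomial (Fin 2) ℚ) = C (d : ℚ) := (map_natCast C d).symm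
  rw [h, hd, ← mul_assoc, ← C_mul, hc, C_1, one_mul]

lemma gC23_eq : gC23 = -7168 * X 1 ^ 20
    + 10240 * X 0 * X 1 ^ 19
    - 194560 * X 0 ^ 2 * X 1 ^ 18
    - 291840 * X 0 ^ 3 * X 1 ^ 17
    - 145920 * X 0 ^ 4 * X 1 ^ 16
    + 933888 * X 0 ^ 5 * X 1 ^ 15
    - 2042880 * X 0 ^ 6 * X 1 ^ 14
    - 4961280 * X 0 ^ 7 * X 1 ^ 13
    + 3319680 * X 0 ^ 8 * X 1 ^ 12
    - 316160 * X 0 ^ 9 * X 1 ^ 11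
    + 9231872 * X 0 ^ 10 * X 1 ^ 10
    + 3003520 * X 0 ^ 11 * X 1 ^ 9
    + 6165120 * X 0 ^ 12 * X 1 ^ 8
    + 7514880 * X 0 ^ 13 * X 1 ^ 7
    - 3082560 * X 0 ^ 14 * X 1 ^ 6
    - 2294592 * X 0 ^ 15 * X 1 ^ 5
    - 340860 * X 0 ^ 16 * X 1 ^ 4
    + 576840 * X 0 ^ 17 * X 1 ^ 3
    - 561640 * X 0 ^ 18 * X 1 ^ 2
    - 64820 * X 0 ^ 19 * X 1
    - 29158 * X 0 ^ 20 := by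
  unfold gC23
  rw [huu_eq, hvv_eq, huv_eq]
  apply C_unit_mul (132 ^ 2) (by norm_num)
  push_cast
  ring

lemma gu_eq : pderiv 0 gC23 = 10240 * X 1 ^ 19
    - 389120 * X 0 * X 1 ^ 18
    - 875520 * X 0 ^ 2 * X 1 ^ 17
    - 583680 * X 0 ^ 3 * X 1 ^ 16
    + 4669440 * X 0 ^ 4 * X 1 ^ 15
    - 12257280 * X 0 ^ 5 * X 1 ^ 14
    - 34728960 * X 0 ^ 6 * X 1 ^ 13
    + 26557440 * X 0 ^ 7 * X 1 ^ 12
    - 2845440 * X 0 ^ 8 * X 1 ^ 11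
    + 92318720 * X 0 ^ 9 * X 1 ^ 10
    + 33038720 * X 0 ^ 10 * X 1 ^ 9
    + 73981440 * X 0 ^ 11 * X 1 ^ 8
    + 97693440 * X 0 ^ 12 * X 1 ^ 7
    - 43155840 * X 0 ^ 13 * X 1 ^ 6
    - 34418880 * X 0 ^ 14 * X 1 ^ 5
    - 5453760 * X 0 ^ 15 * X 1 ^ 4
    + 9806280 * X 0 ^ 16 * X 1 ^ 3
    - 10109520 * X 0 ^ 17 * X 1 ^ 2
    - 1231580 * X 0 ^ 18 * X 1
    - 583160 * X 0 ^ 19 := by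
  rw [gC23_eq]
  simp only [map_add, map_sub, map_neg, Derivation.leibniz, Derivation.leibniz_pow, pderiv_X_self,
    pd01, pd10, pdn 0 7168, pdn 0 10240, pdn 0 29158, pdn 0 64820, pdn 0 145920, pdn 0 194560, pdn 0 291840, pdn 0 316160, pdn 0 340860, pdn 0 561640, pdn 0 576840, pdn 0 933888, pdn 0 2042880, pdn 0 2294592, pdn 0 3003520, pdn 0 3082560, pdn 0 3319680, pdn 0 4961280, pdn 0 6165120, pdn 0 7514880, pdn 0 9231872, smul_eq_mul, nsmul_eq_mul, mul_zero, zero_add, mul_one, add_zero, smul_zero]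
  push_cast
  ring

lemma gv_eq : pderiv 1 gC23 = -143360 * X 1 ^ 19
    + 194560 * X 0 * X 1 ^ 18
    - 3502080 * X 0 ^ 2 * X 1 ^ 17
    - 4961280 * X 0 ^ 3 * X 1 ^ 16
    - 2334720 * X 0 ^ 4 * X 1 ^ 15
    + 14008320 * X 0 ^ 5 * X 1 ^ 14
    - 28600320 * X 0 ^ 6 * X 1 ^ 13
    - 64496640 * X 0 ^ 7 * X 1 ^ 12
    + 39836160 * X 0 ^ 8 * X 1 ^ 11
    - 3477760 * X 0 ^ 9 * X 1 ^ 10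
    + 92318720 * X 0 ^ 10 * X 1 ^ 9
    + 27031680 * X 0 ^ 11 * X 1 ^ 8
    + 49320960 * X 0 ^ 12 * X 1 ^ 7
    + 52604160 * X 0 ^ 13 * X 1 ^ 6
    - 18495360 * X 0 ^ 14 * X 1 ^ 5
    - 11472960 * X 0 ^ 15 * X 1 ^ 4
    - 1363440 * X 0 ^ 16 * X 1 ^ 3
    + 1730520 * X 0 ^ 17 * X 1 ^ 2
    - 1123280 * X 0 ^ 18 * X 1
    - 64820 * X 0 ^ 19 := by
  rw [gC23_eq]
  simp only [map_add, map_sub, map_neg, Derivation.leibniz, Derivation.leibniz_pow, pderiv_X_self,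
    pd01, pd10, pdn 1 7168, pdn 1 10240, pdn 1 29158, pdn 1 64820, pdn 1 145920, pdn 1 194560, pdn 1 291840, pdn 1 316160, pdn 1 340860, pdn 1 561640, pdn 1 576840, pdn 1 933888, pdn 1 2042880, pdn 1 2294592, pdn 1 3003520, pdn 1 3082560, pdn 1 3319680, pdn 1 4961280, pdn 1 6165120, pdn 1 7514880, pdn 1 9231872, smul_eq_mul, nsmul_eq_mul, mul_zero, zero_add, mul_one, add_zero, smul_zero]
  push_cast
  ring

/-- The form `f`, over an arbitrary commutative ring. -/
def fP {R : Type*} [CommRing R] (x y : R) : R :=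
  -327680 * y ^ 30
    + 6389760 * x * y ^ 29
    + 7127040 * x ^ 2 * y ^ 28
    + 59392000 * x ^ 3 * y ^ 27
    - 32071680 * x ^ 4 * y ^ 26
    + 372031488 * x ^ 5 * y ^ 25
    + 1469952000 * x ^ 6 * y ^ 24
    + 160358400 * x ^ 7 * y ^ 23
    - 3688243200 * x ^ 8 * y ^ 22
    + 512256000 * x ^ 9 * y ^ 21
    + 891325440 * x ^ 10 * y ^ 20
    + 11218406400 * x ^ 11 * y ^ 19
    - 9246220800 * x ^ 12 * y ^ 18
    + 17519155200 * x ^ 13 * y ^ 17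
    + 37228204800 * x ^ 14 * y ^ 16
    + 9927521280 * x ^ 15 * y ^ 15
    + 37228204800 * x ^ 16 * y ^ 14
    - 18614102400 * x ^ 17 * y ^ 13
    - 25122955200 * x ^ 18 * y ^ 12
    - 23848718400 * x ^ 19 * y ^ 11
    - 3399138720 * x ^ 20 * y ^ 10
    - 4703150400 * x ^ 21 * y ^ 9
    - 10193094000 * x ^ 22 * y ^ 8
    - 104608800 * x ^ 23 * y ^ 7
    + 4525531200 * x ^ 24 * y ^ 6
    - 1060088040 * x ^ 25 * y ^ 5
    - 389448540 * x ^ 26 * y ^ 4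
    - 316881260 * x ^ 27 * y ^ 3
    + 5668050 * x ^ 28 * y ^ 2
    - 44123280 * x ^ 29 * y
    - 3353687 * x ^ 30

lemma fC23_eq : fC23 = fP (X 0) (X 1) := by
  unfold fC23 fP
  rw [hu_eq, hv_eq, gu_eq, gv_eq]
  apply C_unit_mul 240 (by norm_num)
  push_cast
  ring

lemma map_fP {R S : Type*} [CommRing R] [CommRing S] (φ : R →+* S) (x y : R) :
    φ (fP x y) = fP (φ x) (φ y) := by
  simp only [fP, map_add, map_sub, map_neg, map_mul, map_pow, map_ofNat]

lemma fC23_map : fC23 = map (Int.castRingHom ℚ) (fP (X 0) (X 1)) := by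
  rw [fC23_eq, map_fP, map_X, map_X]

lemma fC23_int (m : Fin 2 →₀ ℕ) : ∃ z : ℤ, coeff m fC23 = (z : ℚ) := by
  rw [fC23_map, coeff_map]
  exact ⟨_, rfl⟩

lemma fC23_eval (u v : ℤ) : eval ![(u : ℚ), (v : ℚ)] fC23 = ((fP u v : ℤ) : ℚ) := by
  rw [fC23_eq, map_fP]
  have := map_fP (Int.castRingHom ℚ) u v
  simp only [eq_intCast] at this
  rw [this]
  simp

lemma hC23_hom : hC23.IsHomogeneous 12 := by
  unfold hC23
  apply IsHomogeneous.sum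
  intro i _
  have h := (((isHomogeneous_X_pow (R := ℚ) (0 : Fin 2) (i : ℕ)).mul
    (isHomogeneous_X_pow (R := ℚ) (1 : Fin 2) (12 - (i : ℕ))))).C_mul
      ((Nat.choose 12 i : ℚ) * alphaC23 i)
  rw [← mul_assoc] at h
  have e : (i : ℕ) + (12 - (i : ℕ)) = 12 := by omega
  rwa [e] at h

lemma gC23_hom : gC23.IsHomogeneous 20 :=
  ((hC23_hom.pderiv.pderiv.mul hC23_hom.pderiv.pderiv).sub
    (hC23_hom.pderiv.pderiv.mul hC23_hom.pderiv.pderiv)).C_mul _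

lemma fC23_hom : fC23.IsHomogeneous 30 :=
  ((hC23_hom.pderiv.mul gC23_hom.pderiv).sub (hC23_hom.pderiv.mul gC23_hom.pderiv)).C_mul _

/-- The defining polynomial of the quintic field. -/
noncomputable def mp : Polynomial ℚ :=
  Polynomial.X ^ 5 - 30 * Polynomial.X - 60

/-- The defining polynomial, over the integers. -/
noncomputable def mpZ : Polynomial ℤ :=
  Polynomial.X ^ 5 - 30 * Polynomial.X - 60

lemma mpZ_natDegree : mpZ.natDegree = 5 := by
  unfold mpZ; compute_degree!

lemma mpZ_monic : mpZ.Monic := by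
  unfold mpZ; monicity!

lemma mpZ_coeff (n : ℕ) (hn : n < 5) : mpZ.coeff n = if n = 0 then -60 else if n = 1 then -30 else 0 := by
  have h30 : (30 : Polynomial ℤ) = Polynomial.C 30 := rfl
  have h60 : (60 : Polynomial ℤ) = Polynomial.C 60 := rfl
  unfold mpZ
  rw [h30, h60]
  simp only [Polynomial.coeff_sub, Polynomial.coeff_X_pow, Polynomial.coeff_C_mul, Polynomial.coeff_X,
    Polynomial.coeff_C]
  interval_cases n <;> simp

lemma mpZ_eis (p : ℤ) (hp : Prime p) (h30 : p ∣ 30) (h60 : ¬ p ^ 2 ∣ 60) :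
    mpZ.IsEisensteinAt (Ideal.span {p}) := by
  refine ⟨?_, ?_, ?_⟩
  · rw [mpZ_monic.leadingCoeff, Ideal.mem_span_singleton]
    exact fun h => hp.not_isUnit (isUnit_of_dvd_one h)
  · intro n hn
    rw [mpZ_natDegree] at hn
    rw [mpZ_coeff n hn, Ideal.mem_span_singleton]
    split_ifs
    · exact (Dvd.dvd.mul_left h30 (-2))
    · exact (dvd_neg.mpr h30)
    · exact dvd_zero _
  · rw [mpZ_coeff 0 (by norm_num), Ideal.span_singleton_pow, Ideal.mem_span_singleton]
    simpa using h60

lemma mpZ_eis3 : mpZ.IsEisensteinAt (Ideal.span {3}) :=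
  mpZ_eis 3 Int.prime_three (by norm_num) (by norm_num)

lemma prime_five_int : Prime (5 : ℤ) := by
  exact Nat.prime_iff_prime_int.mp (by norm_num)

lemma mpZ_eis5 : mpZ.IsEisensteinAt (Ideal.span {5}) :=
  mpZ_eis 5 prime_five_int (by norm_num) (by norm_num)

lemma mpZ_irr : Irreducible mpZ :=
  mpZ_eis3.irreducible ((Ideal.span_singleton_prime (by norm_num)).mpr Int.prime_three)
    mpZ_monic.isPrimitive (by rw [mpZ_natDegree]; norm_num)

lemma mp_eq_map : mp = mpZ.map (Int.castRingHom ℚ) := by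
  simp [mp, mpZ]

lemma mp_monic : mp.Monic := mp_eq_map ▸ mpZ_monic.map _

lemma mp_natDegree : mp.natDegree = 5 := by
  rw [mp_eq_map, mpZ_monic.natDegree_map, mpZ_natDegree]

instance mp_irr : Fact (Irreducible mp) := ⟨by
  rw [mp_eq_map]
  exact (mpZ_monic.irreducible_iff_irreducible_map_fraction_map (K := ℚ)).mp mpZ_irr⟩

/-- The quintic field. -/
def KK : Type := AdjoinRoot mp

noncomputable instance : Field KK := inferInstanceAs (Field (AdjoinRoot mp))

instance : CharZero KK :=
  have : CharZero (AdjoinRoot mp) :=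
    charZero_of_injective_algebraMap (algebraMap ℚ (AdjoinRoot mp)).injective
  this

/-- The generator. -/
noncomputable def be : KK := AdjoinRoot.root mp

lemma be_pow : be ^ 5 = 30 * be + 60 := by
  have h : AdjoinRoot.mk mp (Polynomial.X ^ 5 - 30 * Polynomial.X - 60) = 0 := AdjoinRoot.mk_self
  simp only [map_sub, map_mul, map_pow, map_ofNat, AdjoinRoot.mk_X] at h
  have hq : be ^ 5 - 30 * be - 60 = 0 := h
  linear_combination hq

/-- The power basis. -/
noncomputable def pb : PowerBasis ℚ KK := AdjoinRoot.powerBasis mp_irr.out.ne_zero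

instance : NumberField KK where
  to_charZero := inferInstance
  to_finiteDimensional := pb.finite

lemma pb_gen : pb.gen = be := AdjoinRoot.powerBasis_gen _

lemma pb_dim : pb.dim = 5 := by
  rw [← mp_natDegree]
  exact AdjoinRoot.powerBasis_dim _

lemma finrank_KK : Module.finrank ℚ KK = 5 := by
  rw [pb.finrank, pb_dim]

lemma be_int : IsIntegral ℤ be :=
  ⟨mpZ, mpZ_monic, by
    simp only [mpZ, Polynomial.eval₂_sub, Polynomial.eval₂_pow, Polynomial.eval₂_X,
      Polynomial.eval₂_mul, Polynomial.eval₂_ofNat]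
    linear_combination be_pow⟩

lemma be_minpolyQ : minpoly ℚ be = mp := by
  refine (minpoly.eq_of_irreducible_of_monic mp_irr.out ?_ mp_monic).symm
  simp only [mp, map_sub, map_mul, map_pow, Polynomial.aeval_X, map_ofNat]
  linear_combination be_pow

lemma be_minpoly : minpoly ℤ be = mpZ := by
  have h2 := minpoly.isIntegrallyClosed_eq_field_fractions' ℚ be_int
  rw [be_minpolyQ] at h2
  exact (Polynomial.map_injective _ (RingHom.injective_int _) (mp_eq_map.symm.trans h2)).symm

/-- Integral basis element. -/
noncomputable def bk1 : KK := (48/23) + (14/23) * be ^ 1 + (-1/23) * be ^ 2 + (5/23) * be ^ 3 + (-2/23) * be ^ 4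

/-- Integral basis element. -/
noncomputable def bk2 : KK := be

/-- Integral basis element. -/
noncomputable def bk3 : KK := (36/23) + (-1/23) * be ^ 1 + (5/23) * be ^ 2 + (-2/23) * be ^ 3 + (-3/46) * be ^ 4

/-- Integral basis element. -/
noncomputable def bk4 : KK := (84/23) + (13/23) * be ^ 1 + (-19/23) * be ^ 2 + (3/23) * be ^ 3 + (-7/46) * be ^ 4

lemma bk11 : bk1 * bk1 = (2) * bk2 + (-2) * bk3 := by
  simp only [bk1, bk2, bk3, bk4]
  linear_combination ((-66/529) + (29/529) * be ^ 1 + (-20/529) * be ^ 2 + (4/529) * be ^ 3) * be_pow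

lemma bk12 : bk1 * bk2 = (-1) * bk3 + (-1) * bk4 := by
  simp only [bk1, bk2, bk3, bk4]
  linear_combination ((-2/23)) * be_pow

lemma bk13 : bk1 * bk3 = (1) * bk1 + (-2) * bk2 + (-1) * bk3 + (1) * bk4 := by
  simp only [bk1, bk2, bk3, bk4]
  linear_combination ((8/529) + (-37/1058) * be ^ 1 + (-7/1058) * be ^ 2 + (3/529) * be ^ 3) * be_pow

lemma bk14 : bk1 * bk4 = (-12) + (-1) * bk1 + (-1) * bk3 + (1) * bk4 := by
  simp only [bk1, bk2, bk3, bk4]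
  linear_combination ((-173/529) + (113/1058) * be ^ 1 + (-47/1058) * be ^ 2 + (7/529) * be ^ 3) * be_pow

lemma bk22 : bk2 * bk2 = (1) * bk1 + (1) * bk3 + (-1) * bk4 := by
  simp only [bk1, bk2, bk3, bk4]
  linear_combination (0) * be_pow

lemma bk23 : bk2 * bk3 = (-6) + (1) * bk1 + (-1) * bk2 := by
  simp only [bk1, bk2, bk3, bk4]
  linear_combination ((-3/46)) * be_pow

lemma bk24 : bk2 * bk4 = (-6) + (-3) * bk1 + (1) * bk2 + (2) * bk3 := by
  simp only [bk1, bk2, bk3, bk4]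
  linear_combination ((-7/46)) * be_pow

lemma bk33 : bk3 * bk3 = (2) * bk1 + (-3) * bk2 + (-1) * bk4 := by
  simp only [bk1, bk2, bk3, bk4]
  linear_combination ((-17/529) + (-11/529) * be ^ 1 + (6/529) * be ^ 2 + (9/2116) * be ^ 3) * be_pow

lemma bk34 : bk3 * bk4 = (4) * bk1 + (1) * bk2 + (1) * bk3 := by
  simp only [bk1, bk2, bk3, bk4]
  linear_combination ((37/529) + (5/529) * be ^ 1 + (5/1058) * be ^ 2 + (21/2116) * be ^ 3) * be_pow

lemma bk44 : bk4 * bk4 = (9) * bk2 + (-4) * bk3 + (-1) * bk4 := by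
  simp only [bk1, bk2, bk3, bk4]
  linear_combination ((-205/529) + (142/529) * be ^ 1 + (-21/529) * be ^ 2 + (49/2116) * be ^ 3) * be_pow

lemma bk2_int : IsIntegral ℤ bk2 := be_int

lemma bk1_int : IsIntegral ℤ bk1 := by
  refine ⟨Polynomial.X ^ 5 + (Polynomial.C (0) * Polynomial.X ^ 2 +
    Polynomial.C (-60) * Polynomial.X + Polynomial.C (-96)), ?_, ?_⟩
  · monicity!
  · simp only [Polynomial.eval₂_add, Polynomial.eval₂_pow, Polynomial.eval₂_X, Polynomial.eval₂_mul, Polynomial.eval₂_C]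
    simp only [eq_intCast]
    push_cast
    unfold bk1
    linear_combination ((19483784/6436343) + (-522490/279841) * be ^ 1 + (2558490/6436343) * be ^ 2 + (-2629480/6436343) * be ^ 3 + (-886990/6436343) * be ^ 4 + (874589/6436343) * be ^ 5 + (-779885/6436343) * be ^ 6 + (446360/6436343) * be ^ 7 + (-115840/6436343) * be ^ 8 + (6135/6436343) * be ^ 9 + (24645/6436343) * be ^ 10 + (-17650/6436343) * be ^ 11 + (6920/6436343) * be ^ 12 + (-2080/6436343) * be ^ 13 + (400/6436343) * be ^ 14 + (-32/6436343) * be ^ 15) * be_pow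

lemma bk3_int : IsIntegral ℤ bk3 := by
  refine ⟨Polynomial.X ^ 5 + (Polynomial.C (-30) * Polynomial.X ^ 2 +
    Polynomial.C (-15) * Polynomial.X + Polynomial.C (138)), ?_, ?_⟩
  · monicity!
  · simp only [Polynomial.eval₂_add, Polynomial.eval₂_pow, Polynomial.eval₂_X, Polynomial.eval₂_mul, Polynomial.eval₂_C]
    simp only [eq_intCast]
    push_cast
    unfold bk3
    linear_combination ((-10817147/12872686) + (203155/559682) * be ^ 1 + (1340375/12872686) * be ^ 2 + (-4215845/25745372) * be ^ 3 + (-309405/25745372) * be ^ 4 + (-20555/25745372) * be ^ 5 + (41325/12872686) * be ^ 6 + (142415/51490744) * be ^ 7 + (-148385/51490744) * be ^ 8 + (-47455/51490744) * be ^ 9 + (5969/51490744) * be ^ 10 + (14955/102981488) * be ^ 11 + (7515/102981488) * be ^ 12 + (-135/102981488) * be ^ 13 + (-405/51490744) * be ^ 14 + (-243/205962976) * be ^ 15) * be_pow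

lemma bk4_int : IsIntegral ℤ bk4 := by
  refine ⟨Polynomial.X ^ 5 + (Polynomial.C (90) * Polynomial.X ^ 2 +
    Polynomial.C (-675) * Polynomial.X + Polynomial.C (1662)), ?_, ?_⟩
  · monicity!
  · simp only [Polynomial.eval₂_add, Polynomial.eval₂_pow, Polynomial.eval₂_X, Polynomial.eval₂_mul, Polynomial.eval₂_C]
    simp only [eq_intCast]
    push_cast
    unfold bk4
    linear_combination ((-224628949/12872686) + (285985/559682) * be ^ 1 + (55845970/6436343) * be ^ 2 + (60431935/25745372) * be ^ 3 + (-134279415/25745372) * be ^ 4 + (86888429/25745372) * be ^ 5 + (-58981405/25745372) * be ^ 6 + (30475855/51490744) * be ^ 7 + (623325/51490744) * be ^ 8 + (-4741725/51490744) * be ^ 9 + (1017761/12872686) * be ^ 10 + (-3283385/102981488) * be ^ 11 + (991025/102981488) * be ^ 12 + (-289835/102981488) * be ^ 13 + (36015/102981488) * be ^ 14 + (-16807/205962976) * be ^ 15) * be_pow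

/-- Coordinate vectors with respect to the integral basis. -/
@[ext] structure V where
  x0 : ℤ
  x1 : ℤ
  x2 : ℤ
  x3 : ℤ
  x4 : ℤ
deriving DecidableEq

/-- Multiplication in coordinates. -/
def V.mul (x y : V) : V :=
  ⟨x.x0 * y.x0 - 12 * (x.x1 * y.x4) - 6 * (x.x2 * y.x3) - 6 * (x.x2 * y.x4) - 6 * (x.x3 * y.x2) - 12 * (x.x4 * y.x1) - 6 * (x.x4 * y.x2),
    x.x0 * y.x1 + x.x1 * y.x0 + x.x1 * y.x3 - x.x1 * y.x4 + x.x2 * y.x2 + x.x2 * y.x3 - 3 * (x.x2 * y.x4) + x.x3 * y.x1 + x.x3 * y.x2 + 2 * (x.x3 * y.x3) + 4 * (x.x3 * y.x4) - x.x4 * y.x1 - 3 * (x.x4 * y.x2) + 4 * (x.x4 * y.x3),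
    x.x0 * y.x2 + 2 * (x.x1 * y.x1) - 2 * (x.x1 * y.x3) + x.x2 * y.x0 - x.x2 * y.x3 + x.x2 * y.x4 - 2 * (x.x3 * y.x1) - x.x3 * y.x2 - 3 * (x.x3 * y.x3) + x.x3 * y.x4 + x.x4 * y.x2 + x.x4 * y.x3 + 9 * (x.x4 * y.x4),
    x.x0 * y.x3 - 2 * (x.x1 * y.x1) - x.x1 * y.x2 - x.x1 * y.x3 - x.x1 * y.x4 - x.x2 * y.x1 + x.x2 * y.x2 + 2 * (x.x2 * y.x4) + x.x3 * y.x0 - x.x3 * y.x1 + x.x3 * y.x4 - x.x4 * y.x1 + 2 * (x.x4 * y.x2) + x.x4 * y.x3 - 4 * (x.x4 * y.x4),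
    x.x0 * y.x4 - x.x1 * y.x2 + x.x1 * y.x3 + x.x1 * y.x4 - x.x2 * y.x1 - x.x2 * y.x2 + x.x3 * y.x1 - x.x3 * y.x3 + x.x4 * y.x0 + x.x4 * y.x1 - x.x4 * y.x4⟩

/-- Addition in coordinates. -/
def V.add (x y : V) : V := ⟨x.x0 + y.x0, x.x1 + y.x1, x.x2 + y.x2, x.x3 + y.x3, x.x4 + y.x4⟩

/-- Scalar multiplication in coordinates. -/
def V.smul (n : ℤ) (x : V) : V := ⟨n * x.x0, n * x.x1, n * x.x2, n * x.x3, n * x.x4⟩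

/-- Integers as coordinate vectors. -/
def V.int (n : ℤ) : V := ⟨n, 0, 0, 0, 0⟩

open NumberField

noncomputable def bo1 : 𝓞 KK := ⟨bk1, bk1_int⟩
noncomputable def bo2 : 𝓞 KK := ⟨bk2, bk2_int⟩
noncomputable def bo3 : 𝓞 KK := ⟨bk3, bk3_int⟩
noncomputable def bo4 : 𝓞 KK := ⟨bk4, bk4_int⟩

/-- The algebraic integer with given coordinates. -/
noncomputable def ev (x : V) : 𝓞 KK :=
  x.x0 + x.x1 * bo1 + x.x2 * bo2 + x.x3 * bo3 + x.x4 * bo4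

/-- The element of the field with given coordinates. -/
noncomputable def evK (x : V) : KK :=
  x.x0 + x.x1 * bk1 + x.x2 * bk2 + x.x3 * bk3 + x.x4 * bk4

lemma coe_ev (x : V) : ((ev x : 𝓞 KK) : KK) = evK x := by
  simp only [ev, evK, map_add, map_mul, map_intCast]
  rfl

lemma evK_mul (x y : V) : evK (x.mul y) = evK x * evK y := by
  simp only [evK, V.mul]
  push_cast
  linear_combination -((x.x1 * y.x1 : KK) * bk11 + (x.x1 * y.x2 + x.x2 * y.x1 : KK) * bk12 + (x.x1 * y.x3 + x.x3 * y.x1 : KK) * bk13 + (x.x1 * y.x4 + x.x4 * y.x1 : KK) * bk14 + (x.x2 * y.x2 : KK) * bk22 + (x.x2 * y.x3 + x.x3 * y.x2 : KK) * bk23 + (x.x2 * y.x4 + x.x4 * y.x2 : KK) * bk24 + (x.x3 * y.x3 : KK) * bk33 + (x.x3 * y.x4 + x.x4 * y.x3 : KK) * bk34 + (x.x4 * y.x4 : KK) * bk44)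

lemma ev_mul (x y : V) : ev (x.mul y) = ev x * ev y := by
  apply RingOfIntegers.ext
  exact (coe_ev _).trans ((evK_mul x y).trans (by rw [← coe_ev, ← coe_ev]; rfl))

lemma ev_add (x y : V) : ev (x.add y) = ev x + ev y := by
  simp only [ev, V.add]
  push_cast
  ring

lemma ev_smul (n : ℤ) (x : V) : ev (x.smul n) = n * ev x := by
  simp only [ev, V.smul]
  push_cast
  ring

lemma ev_int (n : ℤ) : ev (V.int n) = n := by
  simp [ev, V.int]

lemma ev_ofNat (n : ℕ) [n.AtLeastTwo] : ev (V.int (OfNat.ofNat n)) = OfNat.ofNat n := by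
  rw [ev_int]; simp


/-- The integral basis, as a family. -/
noncomputable def bv : Fin 5 → KK := ![1, bk1, bk2, bk3, bk4]

lemma bv_li : LinearIndependent ℚ bv := by
  have h : LinearIndependent ℚ fun i : Fin 5 => be ^ (i : ℕ) := by
    have := linearIndependent_pow (K := ℚ) be
    rw [be_minpolyQ, mp_natDegree] at this
    exact this
  rw [Fintype.linearIndependent_iff] at h ⊢
  intro q hq
  have h0 := h ![q 0 + q 1 * (48/23) + q 3 * (36/23) + q 4 * (84/23),
    q 1 * (14/23) + q 2 - q 3 / 23 + q 4 * (13/23),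
    - q 1 / 23 + q 3 * (5/23) - q 4 * (19/23),
    q 1 * (5/23) - q 3 * (2/23) + q 4 * (3/23),
    - q 1 * (2/23) - q 3 * (3/46) - q 4 * (7/46)] (by
      rw [← hq]
      simp only [Fin.sum_univ_five, bv, bk1, bk2, bk3, bk4, Algebra.smul_def]
      simp
      ring)
  have e0 := h0 0
  have e1 := h0 1
  have e2 := h0 2
  have e3 := h0 3
  have e4 := h0 4
  simp at e0 e1 e2 e3 e4
  have z1 : q 1 = 0 := by linarith
  have z3 : q 3 = 0 := by linarith
  have z4 : q 4 = 0 := by linarith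
  have z2 : q 2 = 0 := by linarith
  have z0 : q 0 = 0 := by linarith
  intro i
  fin_cases i <;> assumption

/-- The integral basis, as a rational basis. -/
noncomputable def bas : Module.Basis (Fin 5) ℚ KK :=
  basisOfLinearIndependentOfCardEqFinrank bv_li (by rw [finrank_KK]; rfl)

lemma bas_eq : ⇑bas = bv := coe_basisOfLinearIndependentOfCardEqFinrank _ _

/-- Coordinates as a function. -/
def V.co (x : V) : Fin 5 → ℤ := ![x.x0, x.x1, x.x2, x.x3, x.x4]

lemma evK_sum (x : V) : evK x = ∑ i, (x.co i : ℚ) • bas i := by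
  rw [bas_eq]
  simp [Fin.sum_univ_five, bv, evK, V.co, Algebra.smul_def]

lemma repr_evK (x : V) (i : Fin 5) : bas.repr (evK x) i = x.co i := by
  rw [evK_sum, bas.repr_sum_self]

/-- Basis vectors. -/
def uu : Fin 5 → V := ![⟨1,0,0,0,0⟩, ⟨0,1,0,0,0⟩, ⟨0,0,1,0,0⟩, ⟨0,0,0,1,0⟩, ⟨0,0,0,0,1⟩]

lemma evK_uu (i : Fin 5) : evK (uu i) = bas i := by
  rw [bas_eq]
  fin_cases i <;> simp [uu, evK, bv]

lemma trace_evK (x : V) : Algebra.trace ℚ KK (evK x) = 5 * x.x0 := by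
  rw [Algebra.trace_eq_matrix_trace bas, Matrix.trace]
  have : ∀ i, Matrix.diag (Algebra.leftMulMatrix bas (evK x)) i = ((x.mul (uu i)).co i : ℚ) := by
    intro i
    rw [Matrix.diag_apply, Algebra.leftMulMatrix_eq_repr_mul, ← evK_uu, ← evK_mul, repr_evK]
  simp only [this, Fin.sum_univ_five]
  simp [V.co, V.mul, uu]
  ring


lemma trace_int_of_isIntegral {z : KK} (hz : IsIntegral ℤ z) :
    ∃ n : ℤ, Algebra.trace ℚ KK z = n := by
  have h : IsIntegral ℤ (Algebra.trace ℚ KK z) := Algebra.isIntegral_trace hz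
  obtain ⟨n, hn⟩ := IsIntegrallyClosed.isIntegral_iff.mp h
  exact ⟨n, by rw [← hn]; rfl⟩

lemma evK_int (x : V) : IsIntegral ℤ (evK x) := by
  rw [← coe_ev]; exact RingOfIntegers.isIntegral_coe _

lemma evK_smul (n : ℤ) (x : V) : evK (x.smul n) = n * evK x := by
  simp only [evK, V.smul]
  push_cast
  ring

lemma evK_add (x y : V) : evK (x.add y) = evK x + evK y := by
  simp only [evK, V.add]
  push_cast
  ring

lemma evK_injective : Function.Injective evK := by
  intro x y h
  have hq : ∀ i, x.co i = y.co i := by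
    intro i
    have := repr_evK x i
    rw [h, repr_evK] at this
    exact_mod_cast this.symm
  ext
  · exact hq 0
  · exact hq 1
  · exact hq 2
  · exact hq 3
  · exact hq 4

/-- Sixty kills the quotient of the maximal order by our order. -/
lemma sixty {z : KK} (hz : IsIntegral ℤ z) : ∃ w : V, 60 * z = evK w := by
  have hrep := (bas.sum_repr z).symm
  set q := bas.repr z with hq
  have key : ∀ y : V, ∃ n : ℤ, 5 * (∑ i, q i * ((uu i).mul y).x0) = n := by
    intro y
    obtain ⟨n, hn⟩ := trace_int_of_isIntegral (hz.mul (evK_int y))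
    refine ⟨n, ?_⟩
    rw [← hn, hrep, Finset.sum_mul, map_sum, Finset.mul_sum]
    apply Finset.sum_congr rfl
    intro i _
    rw [smul_mul_assoc, map_smul, ← evK_uu, ← evK_mul, trace_evK, smul_eq_mul]
    ring
  obtain ⟨n0, h0⟩ := key (uu 0)
  obtain ⟨n1, h1⟩ := key (uu 1)
  obtain ⟨n2, h2⟩ := key (uu 2)
  obtain ⟨n3, h3⟩ := key (uu 3)
  obtain ⟨n4, h4⟩ := key (uu 4)
  simp [Fin.sum_univ_five, uu, V.mul] at h0 h1 h2 h3 h4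
  refine ⟨⟨12 * n0, -n4 + n3, -2 * n3, -2 * n2 + n1, -n1⟩, ?_⟩
  have e0 : q 0 = n0 / 5 := by linarith
  have e4 : q 4 = -n1 / 60 := by linarith
  have e2 : q 2 = -n3 / 30 := by linarith
  have e3 : q 3 = -n2 / 30 + n1 / 60 := by linarith
  have e1 : q 1 = -n4 / 60 + n3 / 60 := by linarith
  rw [hrep, bas_eq]
  simp only [Fin.sum_univ_five, e0, e1, e2, e3, e4, Algebra.smul_def, evK, bv]
  simp
  ring

/-- `ℤ[β]` lies in our order. -/
lemma adjoin_sub {z : KK} (hz : z ∈ Algebra.adjoin ℤ ({be} : Set KK)) : ∃ w : V, z = evK w := by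
  induction hz using Algebra.adjoin_induction with
  | mem x hx =>
    rw [Set.mem_singleton_iff] at hx
    exact ⟨⟨0, 0, 1, 0, 0⟩, by simp [evK, hx, bk2]⟩
  | algebraMap r => exact ⟨⟨r, 0, 0, 0, 0⟩, by simp [evK]⟩
  | add x y _ _ hx hy =>
    obtain ⟨a, rfl⟩ := hx
    obtain ⟨b, rfl⟩ := hy
    exact ⟨a.add b, (evK_add a b).symm⟩
  | mul x y _ _ hx hy =>
    obtain ⟨a, rfl⟩ := hx
    obtain ⟨b, rfl⟩ := hy
    exact ⟨a.mul b, (evK_mul a b).symm⟩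

lemma sub_adjoin (w : V) : 46 * evK w ∈ Algebra.adjoin ℤ ({be} : Set KK) := by
  have hb : be ∈ Algebra.adjoin ℤ ({be} : Set KK) := Algebra.self_mem_adjoin_singleton ℤ be
  have hn : ∀ n : ℤ, (n : KK) ∈ Algebra.adjoin ℤ ({be} : Set KK) := fun n => intCast_mem _ n
  have e : 46 * evK w = ((46 * w.x0 + 96 * w.x1 + 72 * w.x3 + 168 * w.x4 : ℤ) : KK)
    + ((28 * w.x1 + 46 * w.x2 - 2 * w.x3 + 26 * w.x4 : ℤ) : KK) * be
    + ((-2 * w.x1 + 10 * w.x3 - 38 * w.x4 : ℤ) : KK) * be ^ 2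
    + ((10 * w.x1 - 4 * w.x3 + 6 * w.x4 : ℤ) : KK) * be ^ 3
    + ((-4 * w.x1 - 3 * w.x3 - 7 * w.x4 : ℤ) : KK) * be ^ 4 := by
    simp only [evK, bk1, bk2, bk3, bk4]
    push_cast
    ring
  rw [e]
  exact add_mem (add_mem (add_mem (add_mem (hn _) (mul_mem (hn _) hb))
    (mul_mem (hn _) (pow_mem hb 2))) (mul_mem (hn _) (pow_mem hb 3)))
    (mul_mem (hn _) (pow_mem hb 4))

lemma eis_step (p : ℤ) (hp : Prime p) (hei : mpZ.IsEisensteinAt (Ideal.span {p})) {z : KK}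
    (hz : IsIntegral ℤ z) (h : (p : KK) * z ∈ Algebra.adjoin ℤ ({be} : Set KK)) :
    z ∈ Algebra.adjoin ℤ ({be} : Set KK) := by
  have h1 := mem_adjoin_of_smul_prime_smul_of_minpoly_isEisensteinAt (K := ℚ) (B := pb) hp
    (by rw [pb_gen]; exact be_int) hz (by rw [pb_gen, zsmul_eq_mul]; exact h)
    (by rw [pb_gen, be_minpoly]; exact hei)
  rwa [pb_gen] at h1

lemma four {z : KK} (hz : IsIntegral ℤ z) : ∃ w : V, 4 * z = evK w := by
  obtain ⟨w, hw⟩ := sixty hz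
  have h1 : ((3 : ℤ) : KK) * (((5 : ℤ) : KK) * (184 * z)) ∈ Algebra.adjoin ℤ ({be} : Set KK) := by
    have := sub_adjoin w
    rw [← hw] at this
    convert this using 1
    push_cast
    ring
  have i184 : IsIntegral ℤ (184 * z) := by
    have : IsIntegral ℤ (((184 : ℤ) : KK) * z) := (isIntegral_algebraMap (R := ℤ) (x := 184)).mul hz
    simpa using this
  have h2 := eis_step 5 prime_five_int mpZ_eis5 i184
    (eis_step 3 Int.prime_three mpZ_eis3 ((isIntegral_algebraMap (R := ℤ) (x := 5)).mul i184) h1)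
  obtain ⟨w', hw'⟩ := adjoin_sub h2
  refine ⟨(w'.smul 1).add (w.smul (-3)), ?_⟩
  rw [evK_add, evK_smul, evK_smul, ← hw, ← hw']
  push_cast
  ring


/-- Eighth power. -/
def V.p8 (x : V) : V :=
  let a := x.mul x
  let b := a.mul a
  b.mul b

lemma evK_p8 (x : V) : evK x.p8 = evK x ^ 8 := by
  simp only [V.p8, evK_mul]
  ring

lemma sat_check : ∀ a b c d e : Fin 2,
    (∀ i : Fin 5, (5 * ((V.p8 ⟨a.val, b.val, c.val, d.val, e.val⟩).mul (uu i)).x0) % 256 = 0) →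
      a = 0 ∧ b = 0 ∧ c = 0 ∧ d = 0 ∧ e = 0 := by
  decide +kernel

lemma split2 (n : ℤ) : ∃ (a : Fin 2) (m : ℤ), n = a.val + 2 * m := by
  rcases Int.emod_two_eq_zero_or_one n with h | h
  · exact ⟨0, n / 2, by simp; omega⟩
  · exact ⟨1, n / 2, by simp; omega⟩

lemma sat2 {z : KK} (hz : IsIntegral ℤ z) {w : V} (h : 2 * z = evK w) :
    ∃ w' : V, z = evK w' := by
  obtain ⟨x0, x1, x2, x3, x4⟩ := w
  obtain ⟨a, m0, rfl⟩ := split2 x0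
  obtain ⟨b, m1, rfl⟩ := split2 x1
  obtain ⟨c, m2, rfl⟩ := split2 x2
  obtain ⟨d, m3, rfl⟩ := split2 x3
  obtain ⟨e, m4, rfl⟩ := split2 x4
  have hw : 2 * (z - evK ⟨m0, m1, m2, m3, m4⟩) = evK ⟨a.val, b.val, c.val, d.val, e.val⟩ := by
    rw [mul_sub, h]
    simp only [evK]
    push_cast
    ring
  have hy : IsIntegral ℤ (z - evK ⟨m0, m1, m2, m3, m4⟩) := hz.sub (evK_int _)
  set y := z - evK ⟨m0, m1, m2, m3, m4⟩ with hyd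
  have key : ∀ i : Fin 5,
      (5 * ((V.p8 ⟨a.val, b.val, c.val, d.val, e.val⟩).mul (uu i)).x0) % 256 = 0 := by
    intro i
    obtain ⟨n, hn⟩ := trace_int_of_isIntegral ((hy.pow 8).mul (evK_int (uu i)))
    have h1 := trace_evK ((V.p8 ⟨a.val, b.val, c.val, d.val, e.val⟩).mul (uu i))
    rw [evK_mul, evK_p8, ← hw, mul_pow] at h1
    have e1 : ((2 : KK) ^ 8 * y ^ 8 * evK (uu i)) = (256 : ℚ) • (y ^ 8 * evK (uu i)) := by
      rw [Algebra.smul_def]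
      norm_num
      ring
    rw [e1, map_smul, hn, smul_eq_mul] at h1
    have h2 : (256 * n : ℤ) = 5 * ((V.p8 ⟨a.val, b.val, c.val, d.val, e.val⟩).mul (uu i)).x0 := by
      exact_mod_cast h1
    omega
  obtain ⟨rfl, rfl, rfl, rfl, rfl⟩ := sat_check _ _ _ _ _ key
  have h0 : y = 0 := by
    have : (2 : KK) * y = 0 := by rw [hw]; simp [evK]
    simpa using this
  exact ⟨⟨m0, m1, m2, m3, m4⟩, by rw [hyd] at h0; exact sub_eq_zero.mp h0⟩

lemma ev_surj : Function.Surjective ev := by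
  intro x
  have hx : IsIntegral ℤ (x : KK) := RingOfIntegers.isIntegral_coe x
  obtain ⟨w, hw⟩ := four hx
  have hx2 : IsIntegral ℤ (2 * (x : KK)) := by
    have := (evK_int ⟨2,0,0,0,0⟩).mul hx
    simpa [evK] using this
  obtain ⟨w', hw'⟩ := sat2 hx2 (w := w) (by rw [← hw]; ring)
  obtain ⟨w'', h⟩ := sat2 hx hw'
  refine ⟨w'', ?_⟩
  apply RingOfIntegers.ext
  rw [coe_ev, h]

lemma ev_inj : Function.Injective ev := by
  intro x y h
  apply evK_injective
  rw [← coe_ev, ← coe_ev, h]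


/-- Coordinates to algebraic integers, linearly. -/
noncomputable def evL : (Fin 5 → ℤ) →ₗ[ℤ] 𝓞 KK where
  toFun c := ev ⟨c 0, c 1, c 2, c 3, c 4⟩
  map_add' x y := by
    simp only [ev, Pi.add_apply]
    push_cast
    ring
  map_smul' n x := by
    simp only [ev, Pi.smul_apply, smul_eq_mul, zsmul_eq_mul, eq_intCast, Int.cast_id]
    push_cast
    ring

lemma evL_bij : Function.Bijective evL := by
  constructor
  · intro x y h
    have h := ev_inj h
    simp only [V.mk.injEq] at h
    obtain ⟨h0, h1, h2, h3, h4⟩ := h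
    ext i
    fin_cases i <;> assumption
  · intro z
    obtain ⟨w, rfl⟩ := ev_surj z
    exact ⟨w.co, rfl⟩

/-- An integral basis. -/
noncomputable def ib : Module.Basis (Fin 5) ℤ (𝓞 KK) :=
  Module.Basis.ofEquivFun (LinearEquiv.ofBijective evL evL_bij).symm

lemma ib_apply (i : Fin 5) : ib i = ev (uu i) := by
  rw [ib, Module.Basis.coe_ofEquivFun]
  simp only [LinearEquiv.symm_symm, LinearEquiv.ofBijective_apply, evL]
  fin_cases i <;> simp [uu]

lemma trace_ev (x : V) : Algebra.trace ℤ (𝓞 KK) (ev x) = 5 * x.x0 := by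
  have h := Algebra.coe_trace_int (K := KK) (ev x)
  rw [coe_ev, trace_evK] at h
  exact_mod_cast h

lemma discr_KK : NumberField.discr KK = 16200000 := by
  rw [← NumberField.discr_eq_discr KK ib, Algebra.discr_def]
  have : Algebra.traceMatrix ℤ ib = !![5,0,0,0,0;0,0,0,0,-60;0,0,0,-30,-30;0,0,-30,0,0;0,-60,-30,0,0] := by
    ext i j
    rw [Algebra.traceMatrix_apply, Algebra.traceForm_apply, ib_apply, ib_apply, ← ev_mul, trace_ev]
    fin_cases i <;> fin_cases j <;> simp [uu, V.mul]
  rw [this]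
  decide +kernel

lemma be_ne_zero : be ≠ 0 := by
  intro h
  have := be_pow
  rw [h] at this
  norm_num at this

lemma trace_be_sq : Algebra.trace ℚ KK (be ^ 2) = 0 := by
  have h : be ^ 2 = evK ((V.mk 0 0 1 0 0).mul ⟨0, 0, 1, 0, 0⟩) := by
    rw [evK_mul]; simp [evK, bk2]; ring
  rw [h, trace_evK]
  simp [V.mul]

lemma r2_ne_zero : InfinitePlace.nrComplexPlaces KK ≠ 0 := by
  intro h
  have hall : ∀ φ : KK →+* ℂ, ComplexEmbedding.IsReal φ := by
    intro φ
    by_contra hφ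
    have : InfinitePlace.IsComplex (InfinitePlace.mk φ) := by
      rw [InfinitePlace.isComplex_mk_iff]; exact hφ
    classical
    have hq : Fintype.card {w : InfinitePlace KK // w.IsComplex} = 0 := by
      rw [← h, InfinitePlace.nrComplexPlaces]
    rw [Fintype.card_eq_zero_iff] at hq
    exact hq.false ⟨_, this⟩
  have ht := trace_eq_sum_embeddings (K := ℚ) (L := KK) ℂ (x := be ^ 2)
  rw [trace_be_sq, map_zero] at ht
  have hre : ∀ σ : KK →ₐ[ℚ] ℂ, ∃ r : ℝ, σ be = r ∧ r ≠ 0 := by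
    intro σ
    have hr := hall σ.toRingHom
    refine ⟨hr.embedding be, ?_, ?_⟩
    · rw [ComplexEmbedding.IsReal.coe_embedding_apply]; rfl
    · intro h0
      exact be_ne_zero ((map_eq_zero hr.embedding).mp h0)
  choose r hr hr0 using hre
  have hsum : (0 : ℝ) = ∑ σ : KK →ₐ[ℚ] ℂ, (r σ) ^ 2 := by
    have : ((0 : ℝ) : ℂ) = ((∑ σ : KK →ₐ[ℚ] ℂ, (r σ) ^ 2 : ℝ) : ℂ) := by
      push_cast
      rw [ht]
      apply Finset.sum_congr rfl
      intro σ _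
      rw [map_pow, hr]
    exact_mod_cast this
  have hne : Nonempty (KK →ₐ[ℚ] ℂ) := ⟨IsAlgClosed.lift⟩
  have hpos : (0 : ℝ) < ∑ σ : KK →ₐ[ℚ] ℂ, (r σ) ^ 2 :=
    Finset.sum_pos (fun σ _ => by have := hr0 σ; positivity) Finset.univ_nonempty
  linarith

lemma r2_eq : InfinitePlace.nrComplexPlaces KK = 2 := by
  have h1 := NumberField.sign_discr (K := KK)
  have h2 := InfinitePlace.card_add_two_mul_card_eq_rank (K := KK)
  rw [finrank_KK] at h2
  have h3 := r2_ne_zero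
  rw [discr_KK] at h1
  have h4 : InfinitePlace.nrComplexPlaces KK ≠ 1 := by
    intro h
    rw [h] at h1
    revert h1
    decide
  omega

lemma r1_eq : InfinitePlace.nrRealPlaces KK = 1 := by
  have h2 := InfinitePlace.card_add_two_mul_card_eq_rank (K := KK)
  rw [finrank_KK, r2_eq] at h2
  omega

lemma rank_eq : Units.rank KK = 2 := by
  rw [Units.rank, InfinitePlace.card_eq_nrRealPlaces_add_nrComplexPlaces, r1_eq, r2_eq]

lemma mink : (4 / Real.pi) ^ InfinitePlace.nrComplexPlaces KK *
    ((Module.finrank ℚ KK).factorial / (Module.finrank ℚ KK : ℝ) ^ (Module.finrank ℚ KK) *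
      √|(NumberField.discr KK : ℝ)|) < 251 := by
  rw [r2_eq, finrank_KK, discr_KK]
  have h1 : √|((16200000 : ℤ) : ℝ)| < 4025 := by
    rw [Real.sqrt_lt' (by norm_num)]
    norm_num
  have h2 : (4 / Real.pi) ^ 2 < 1.6214 := by
    have hp : (3.1415 : ℝ) < Real.pi := Real.pi_gt_d4
    rw [div_pow, div_lt_iff₀ (by positivity)]
    nlinarith
  have h3 : (0:ℝ) ≤ √|((16200000 : ℤ) : ℝ)| := Real.sqrt_nonneg _
  norm_num [Nat.factorial] at h1 h3 h2 ⊢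
  nlinarith


/-- Value of coordinates at residues. -/
def V.val (s x : V) : ℤ := x.x0 + x.x1 * s.x1 + x.x2 * s.x2 + x.x3 * s.x3 + x.x4 * s.x4

/-- Divisibility of all coordinates. -/
def V.dvd (p : ℤ) (x : V) : Prop :=
  x.x0 % p = 0 ∧ x.x1 % p = 0 ∧ x.x2 % p = 0 ∧ x.x3 % p = 0 ∧ x.x4 % p = 0

instance (p : ℤ) (x : V) : Decidable (x.dvd p) := by unfold V.dvd; infer_instance

lemma V.dvd_iff {p : ℤ} {x : V} (h : x.dvd p) : ∃ y : V, x = y.smul p := by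
  obtain ⟨h0, h1, h2, h3, h4⟩ := h
  obtain ⟨a0, e0⟩ := Int.dvd_of_emod_eq_zero h0
  obtain ⟨a1, e1⟩ := Int.dvd_of_emod_eq_zero h1
  obtain ⟨a2, e2⟩ := Int.dvd_of_emod_eq_zero h2
  obtain ⟨a3, e3⟩ := Int.dvd_of_emod_eq_zero h3
  obtain ⟨a4, e4⟩ := Int.dvd_of_emod_eq_zero h4
  exact ⟨⟨a0, a1, a2, a3, a4⟩, by ext <;> simp [V.smul, *]⟩

/-- Certificate that `g` generates the prime ideal of degree one with residues `s`. -/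
def okE (p : ℤ) (s g g' : V) : Prop :=
  g.mul g' = V.int p ∧ V.val s g % p = 0 ∧ (g'.mul ⟨-s.x1, 1, 0, 0, 0⟩).dvd p ∧
    (g'.mul ⟨-s.x2, 0, 1, 0, 0⟩).dvd p ∧ (g'.mul ⟨-s.x3, 0, 0, 1, 0⟩).dvd p ∧
    (g'.mul ⟨-s.x4, 0, 0, 0, 1⟩).dvd p

instance (p : ℤ) (s g g' : V) : Decidable (okE p s g g') := by unfold okE; infer_instance

/-- The condition that the ideal has the given residues. -/
def resd (P : Ideal (𝓞 KK)) (s : V) : Prop :=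
  bo1 - s.x1 ∈ P ∧ bo2 - s.x2 ∈ P ∧ bo3 - s.x3 ∈ P ∧ bo4 - s.x4 ∈ P

lemma val_mem {P : Ideal (𝓞 KK)} {s : V} (h : resd P s) (x : V) :
    ev x - (V.val s x : ℤ) ∈ P := by
  obtain ⟨h1, h2, h3, h4⟩ := h
  have : ev x - (V.val s x : ℤ) = x.x1 * (bo1 - s.x1) + x.x2 * (bo2 - s.x2)
      + x.x3 * (bo3 - s.x3) + x.x4 * (bo4 - s.x4) := by
    simp only [ev, V.val]
    push_cast
    ring
  rw [this]
  exact P.add_mem (P.add_mem (P.add_mem (P.mul_mem_left _ h1) (P.mul_mem_left _ h2))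
    (P.mul_mem_left _ h3)) (P.mul_mem_left _ h4)

lemma dvd_of_cert {p : ℤ} (hp : p ≠ 0) {g g' d : V} (h : g.mul g' = V.int p)
    (hd : (g'.mul d).dvd p) : ev g ∣ ev d := by
  obtain ⟨e, he⟩ := V.dvd_iff hd
  refine ⟨ev e, ?_⟩
  have h1 : ev g * ev g' = p := by rw [← ev_mul, h, ev_int]
  have h2 : ev g' * ev d = p * ev e := by rw [← ev_mul, he, ev_smul]
  have hp' : (p : 𝓞 KK) ≠ 0 := by exact_mod_cast hp
  apply mul_left_cancel₀ hp'
  calc (p : 𝓞 KK) * ev d = ev g * (ev g' * ev d) := by rw [← mul_assoc, h1]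
    _ = _ := by rw [h2]; ring

lemma okE_res {p : ℤ} (hp : p ≠ 0) {s g g' : V} (h : okE p s g g') {P : Ideal (𝓞 KK)}
    (hg : ev g ∈ P) : resd P s := by
  obtain ⟨h0, -, h1, h2, h3, h4⟩ := h
  refine ⟨?_, ?_, ?_, ?_⟩
  · have := P.mem_of_dvd (dvd_of_cert hp h0 h1) hg
    simp [ev] at this
    convert this using 1
    ring
  · have := P.mem_of_dvd (dvd_of_cert hp h0 h2) hg
    simp [ev] at this
    convert this using 1
    ring
  · have := P.mem_of_dvd (dvd_of_cert hp h0 h3) hg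
    simp [ev] at this
    convert this using 1
    ring
  · have := P.mem_of_dvd (dvd_of_cert hp h0 h4) hg
    simp [ev] at this
    convert this using 1
    ring

lemma int_mem {P : Ideal (𝓞 KK)} (hP : P ≠ ⊤) {p : ℕ} (hp : p.Prime) (hpP : (p : 𝓞 KK) ∈ P)
    {n : ℤ} (hn : (n : 𝓞 KK) ∈ P) : (p : ℤ) ∣ n := by
  by_contra hd
  have hc : IsCoprime (p : ℤ) n := (Nat.prime_iff_prime_int.mp hp).coprime_iff_not_dvd.mpr hd
  obtain ⟨a, b, hab⟩ := hc
  apply hP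
  rw [Ideal.eq_top_iff_one]
  have : (1 : 𝓞 KK) = a * (p : 𝓞 KK) + b * n := by
    have := congrArg (Int.cast (R := 𝓞 KK)) hab
    push_cast at this
    exact this.symm
  rw [this]
  exact P.add_mem (P.mul_mem_left _ hpP) (P.mul_mem_left _ hn)

lemma okE_gen {p : ℕ} (hp : p.Prime) {s g g' : V} (h : okE p s g g') {P : Ideal (𝓞 KK)}
    (hP : P ≠ ⊤) (hpP : (p : 𝓞 KK) ∈ P) (hr : resd P s) : P = Ideal.span {ev g} := by
  have hp0 : (p : ℤ) ≠ 0 := by exact_mod_cast hp.ne_zero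
  apply le_antisymm
  · intro x hx
    obtain ⟨w, rfl⟩ := ev_surj x
    have h1 : ev g ∈ Ideal.span {ev g} := Ideal.mem_span_singleton_self _
    have h2 := val_mem (okE_res hp0 h h1) w
    have h3 : ((V.val s w : ℤ) : 𝓞 KK) ∈ P := by
      have := P.sub_mem hx (val_mem hr w)
      simpa using this
    obtain ⟨m, hm⟩ := int_mem hP hp hpP h3
    have h4 : ev g * ev g' = (p : ℤ) := by rw [← ev_mul, h.1, ev_int]
    rw [hm] at h2
    have h5 : (((p : ℤ) * m : ℤ) : 𝓞 KK) ∈ Ideal.span {ev g} := by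
      rw [Ideal.mem_span_singleton]
      exact ⟨ev g' * m, by push_cast; rw [← mul_assoc, h4]; push_cast; ring⟩
    simpa using Ideal.add_mem _ h2 h5
  · rw [Ideal.span_singleton_le_iff_mem]
    have h1 := val_mem hr g
    obtain ⟨m, hm⟩ := Int.dvd_of_emod_eq_zero h.2.1
    rw [hm] at h1
    have h2 : (((p : ℤ) * m : ℤ) : 𝓞 KK) ∈ P := by
      push_cast
      exact P.mul_mem_right _ hpP
    simpa using P.add_mem h1 h2

/-- Generators of the prime ideals of degree one. -/
def tabE : List (ℤ × V × V × V) :=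
  [(2, ⟨1, 0, 0, 0, 0⟩, ⟨2, 2, 1, -1, 0⟩, ⟨-11, 5, -7, -1, -2⟩),
   (2, ⟨1, 0, 0, 1, 1⟩, ⟨1, -1, 0, -1, 0⟩, ⟨-58, -20, -20, 11, 15⟩),
   (3, ⟨1, 0, 0, 0, 0⟩, ⟨-135, 53, -35, 26, -24⟩, ⟨1215, -32, -457, 454, -170⟩),
   (5, ⟨1, 1, 0, 2, 3⟩, ⟨-35, 1, 13, -13, 5⟩, ⟨-79, 32, -37, 3, -13⟩),
   (11, ⟨1, 3, 2, 3, 2⟩, ⟨35, -20, 38, 15, 7⟩, ⟨1, 78, -6, -23, 41⟩),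
   (11, ⟨1, 7, 5, 8, 1⟩, ⟨5, -2, -1, 2, -2⟩, ⟨-29, 17, -31, -12, -6⟩),
   (23, ⟨1, 2, 7, 5, 4⟩, ⟨1, 0, -2, -2, 0⟩, ⟨-25, -4, -6, 2, 8⟩),
   (23, ⟨1, 15, 9, 0, 3⟩, ⟨5, -1, 5, -2, -4⟩, ⟨247, -102, 115, -10, 42⟩),
   (23, ⟨1, 18, 9, 8, 14⟩, ⟨1, 1, -2, 1, 1⟩, ⟨-49, 13, 4, 23, -7⟩),
   (29, ⟨1, 13, 19, 7, 7⟩, ⟨-17, -15, 8, -2, -6⟩, ⟨-109, 29, -42, 12, -10⟩),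
   (29, ⟨1, 15, 23, 12, 20⟩, ⟨5, -2, 2, -1, 1⟩, ⟨97, 32, 38, -21, -27⟩),
   (31, ⟨1, 1, 3, 18, 10⟩, ⟨-47, 19, -19, 4, -8⟩, ⟨-245, -184, 115, -40, -70⟩),
   (31, ⟨1, 20, 30, 16, 4⟩, ⟨1, 0, 1, 0, 0⟩, ⟨-5, -5, 3, -4, -2⟩),
   (37, ⟨1, 36, 9, 27, 19⟩, ⟨1, 1, 0, 0, 0⟩, ⟨-11, 5, -6, 2, -4⟩),
   (43, ⟨1, 4, 33, 25, 15⟩, ⟨1, 14, 9, 5, -9⟩, ⟨1723, 239, -679, 565, -87⟩),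
   (47, ⟨1, 26, 10, 1, 21⟩, ⟨1, 1, 0, -1, 1⟩, ⟨-169, -63, -58, 33, 45⟩),
   (53, ⟨1, 13, 10, 5, 24⟩, ⟨5, 3, -2, 1, 1⟩, ⟨25, 9, -12, -19, -5⟩),
   (53, ⟨1, 46, 5, 7, 28⟩, ⟨661, -358, 635, 221, 129⟩, ⟨-1255, 2395, 201, -1115, 1463⟩),
   (53, ⟨1, 50, 17, 39, 12⟩, ⟨5, 6, -6, -7, -3⟩, ⟨-743, -148, 298, -231, 13⟩),
   (61, ⟨1, 6, 17, 60, 21⟩, ⟨1, -3, 0, 2, -2⟩, ⟨637, 225, 218, -124, -166⟩),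
   (61, ⟨1, 34, 37, 8, 15⟩, ⟨11, -3, -4, 5, -3⟩, ⟨-121, 35, -42, 17, -13⟩),
   (71, ⟨1, 24, 68, 64, 8⟩, ⟨-17, -7, 25, 26, 2⟩, ⟨2933, 860, -1205, 836, 98⟩),
   (71, ⟨1, 26, 30, 47, 25⟩, ⟨-107, 47, -88, -24, -16⟩, ⟨3611, -3095, -1034, 2182, -2132⟩),
   (73, ⟨1, 24, 49, 53, 12⟩, ⟨115, 1, 109, 32, -14⟩, ⟨295, -11250, 1105, 3230, -6138⟩),
   (89, ⟨1, 26, 1, 19, 44⟩, ⟨1, 0, -1, 0, 0⟩, ⟨5, -3, -1, 10, 4⟩),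
   (101, ⟨1, 53, 32, 92, 30⟩, ⟨5, 1, 2, -1, -1⟩, ⟨-23, -1, 16, -21, 9⟩),
   (101, ⟨1, 73, 80, 92, 27⟩, ⟨7, 3, -20, -18, 0⟩, ⟨-613, -181, -162, 76, 152⟩),
   (127, ⟨1, 61, 12, 120, 37⟩, ⟨-89, 24, 34, -41, 23⟩, ⟨5329, -2310, 2894, 101, 925⟩),
   (127, ⟨1, 112, 113, 64, 107⟩, ⟨1, 1, -1, 0, 0⟩, ⟨19, 6, 9, 10, -8⟩),
   (127, ⟨1, 122, 60, 111, 62⟩, ⟨7, -2, 0, -3, 1⟩, ⟨-47, -12, 44, -29, -9⟩),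
   (131, ⟨1, 53, 65, 36, 56⟩, ⟨-17, 3, 7, 12, -2⟩, ⟨305, -28, -127, 128, -48⟩),
   (131, ⟨1, 76, 27, 21, 23⟩, ⟨5, 1, -3, 0, 0⟩, ⟨1243, 426, 431, -232, -318⟩),
   (137, ⟨1, 59, 74, 46, 109⟩, ⟨163, -59, -18, -76, 32⟩, ⟨-4885, -12063, 3156, 1558, -5928⟩),
   (139, ⟨1, 70, 127, 40, 105⟩, ⟨-19, -6, -6, 3, 5⟩, ⟨143, -68, 66, -15, 23⟩),
   (149, ⟨1, 32, 125, 60, 112⟩, ⟨-1, 3, -7, -5, -1⟩, ⟨-173, -194, 91, -11, -85⟩),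
   (149, ⟨1, 116, 137, 114, 86⟩, ⟨37, 27, -17, 6, 10⟩, ⟨-451, -208, -73, 152, 138⟩),
   (157, ⟨1, 34, 6, 56, 54⟩, ⟨7, -1, -3, -2, 0⟩, ⟨4255, 1468, 1473, -808, -1092⟩),
   (157, ⟨1, 72, 32, 109, 99⟩, ⟨-397, 168, -364, -116, -52⟩, ⟨-16081, 55496, 92, -21292, 32116⟩),
   (157, ⟨1, 91, 96, 116, 97⟩, ⟨7, 1, 1, 0, -2⟩, ⟨-161, 46, 25, 86, -22⟩),
   (163, ⟨1, 71, 12, 18, 108⟩, ⟨1, 1, -3, -2, 0⟩, ⟨199, 56, 55, -22, -50⟩),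
   (167, ⟨1, 156, 119, 142, 165⟩, ⟨1, -2, 0, 1, -1⟩, ⟨-1, -12, -32, -21, 13⟩),
   (173, ⟨1, 88, 95, 29, 88⟩, ⟨47, 14, 11, -5, -11⟩, ⟨-797, 127, 421, 633, -95⟩),
   (179, ⟨1, 42, 55, 68, 128⟩, ⟨1, 1, 0, 2, 0⟩, ⟨-469, -161, -174, 92, 120⟩),
   (179, ⟨1, 162, 40, 164, 158⟩, ⟨-53, 100, 9, -47, 61⟩, ⟨-3199, 1533, -2359, -529, -579⟩),
   (181, ⟨1, 166, 116, 94, 17⟩, ⟨-419, 258, -512, -223, -89⟩, ⟨-53567, -13472, 21760, -15887, -577⟩),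
   (191, ⟨1, 129, 67, 55, 88⟩, ⟨55, 55, -27, 5, 23⟩, ⟨209, -336, 981, 661, 93⟩),
   (197, ⟨1, 160, 150, 155, 76⟩, ⟨5, 2, 2, -1, -1⟩, ⟨25, -16, -22, -29, -5⟩),
   (211, ⟨1, 23, 4, 56, 63⟩, ⟨7, -1, 4, 0, 0⟩, ⟨-299, -19, 118, -110, 28⟩),
   (223, ⟨1, 38, 66, 13, 155⟩, ⟨23, 14, -11, 5, 5⟩, ⟨-823, 187, 185, 463, -107⟩),
   (227, ⟨1, 32, 163, 105, 127⟩, ⟨5, 2, 1, -1, -1⟩, ⟨31, -19, 25, 35, -7⟩),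
   (229, ⟨1, 173, 106, 141, 70⟩, ⟨7, -3, 5, 1, 1⟩, ⟨-5, 104, 3, -41, 53⟩),
   (233, ⟨1, 157, 78, 219, 117⟩, ⟨-23, 47, -17, -9, 37⟩, ⟨-21199, 6558, -1311, 7301, -3159⟩),
   (239, ⟨1, 167, 122, 159, 21⟩, ⟨-211, -154, 99, -36, -58⟩, ⟨-2057, 3471, -11095, -7574, -870⟩),
   (241, ⟨1, 13, 119, 155, 226⟩, ⟨49, 1, -28, -41, 1⟩, ⟨-4343, 3263, 1294, -2497, 2315⟩),
   (241, ⟨1, 99, 237, 36, 119⟩, ⟨13, 5, 8, 0, -4⟩, ⟨-683, 125, 242, -286, 152⟩)]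

/-- Small primes. -/
def primesL : List ℕ := [2, 3, 5, 7, 11, 13, 17, 19, 23, 29, 31, 37, 41, 43, 47, 53, 59, 61, 67, 71, 73, 79, 83, 89, 97, 101, 103, 107, 109, 113, 127, 131, 137, 139, 149, 151, 157, 163, 167, 173, 179, 181, 191, 193, 197, 199, 211, 223, 227, 229, 233, 239, 241]

lemma primesL_complete : ∀ p < 251, 2 ≤ p → p ∉ primesL → ∃ d < p, 2 ≤ d ∧ p % d = 0 := by
  decide +kernel

lemma mem_primesL {p : ℕ} (hp : p.Prime) (h : p < 251) : p ∈ primesL := by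
  by_contra hn
  obtain ⟨d, hd, hd2, hd3⟩ := primesL_complete p h hp.two_le hn
  rcases (Nat.dvd_prime hp).mp (Nat.dvd_of_mod_eq_zero hd3) with h | h <;> omega

/-- Compatibility of residues with the powers of the generator. -/
def compat (p r : ℤ) (s : V) : Prop :=
  s.x2 = r ∧ (46 * s.x1 - (96 + 28 * r - 2 * r ^ 2 + 10 * r ^ 3 - 4 * r ^ 4)) % p = 0 ∧
  (46 * s.x3 - (72 - 2 * r + 10 * r ^ 2 - 4 * r ^ 3 - 3 * r ^ 4)) % p = 0 ∧
  (46 * s.x4 - (168 + 26 * r - 38 * r ^ 2 + 6 * r ^ 3 - 7 * r ^ 4)) % p = 0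

instance (p r : ℤ) (s : V) : Decidable (compat p r s) := by unfold compat; infer_instance

lemma tab_check : ∀ p ∈ primesL, p ≠ 2 → p ≠ 23 → ∀ r < p,
    ((r : ℤ) ^ 5 - 30 * r - 60) % p = 0 →
    ∃ e ∈ tabE, e.1 = p ∧ compat p r e.2.1 ∧ okE p e.2.1 e.2.2.1 e.2.2.2 := by
  decide +kernel

/-- Multiplicativity of residues. -/
def mult23 (s : V) : Prop :=
    (s.val ((uu 1).mul (uu 1)) - s.x1 * s.x1) % 23 = 0 ∧
    (s.val ((uu 3).mul (uu 3)) - s.x3 * s.x3) % 23 = 0 ∧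
    (s.val ((uu 1).mul (uu 2)) - s.x1 * s.x2) % 23 = 0 ∧
    (s.val ((uu 3).mul (uu 2)) - s.x3 * s.x2) % 23 = 0

instance (s : V) : Decidable (mult23 s) := by unfold mult23; infer_instance

/-- Residues occur in the table. -/
def intab (s : V) : Prop :=
    ∃ e ∈ tabE, e.1 = 23 ∧ (e.2.1.x1 - s.x1) % 23 = 0 ∧ (e.2.1.x2 - s.x2) % 23 = 0 ∧
      (e.2.1.x3 - s.x3) % 23 = 0 ∧ (e.2.1.x4 - s.x4) % 23 = 0 ∧
      okE 23 e.2.1 e.2.2.1 e.2.2.2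

instance (s : V) : Decidable (intab s) := by unfold intab; infer_instance

lemma tab_check23 : ∀ s2 : ℕ, s2 < 23 → ((s2 : ℤ) ^ 5 - 30 * s2 - 60) % 23 = 0 →
    ∀ s1 : ℕ, s1 < 23 → ∀ s3 : ℕ, s3 < 23 →
    mult23 ⟨1, s1, s2, s3, s1 + s3 - s2 ^ 2⟩ → intab ⟨1, s1, s2, s3, s1 + s3 - s2 ^ 2⟩ := by
  decide +kernel


lemma be_pow_O : bo2 ^ 5 = 30 * bo2 + 60 := by
  apply RingOfIntegers.ext
  have h := be_pow
  have e : ((bo2 : 𝓞 KK) : KK) = be := by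
    change bk2 = be
    simp [bk2]
  simp only [map_pow, map_add, map_mul, map_ofNat, e]
  exact h

lemma ev_b2 : ev ⟨0, 0, 1, 0, 0⟩ = bo2 := by simp [ev]

lemma b2_pow2 : bo2 ^ 2 = ev ((V.mk 0 0 1 0 0).mul ⟨0, 0, 1, 0, 0⟩) := by
  rw [ev_mul, ev_b2]; ring
lemma b2_pow3 : bo2 ^ 3 = ev (((V.mk 0 0 1 0 0).mul ⟨0, 0, 1, 0, 0⟩).mul ⟨0, 0, 1, 0, 0⟩) := by
  rw [ev_mul, ev_mul, ev_b2]; ring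
lemma b2_pow4 : bo2 ^ 4 =
    ev ((((V.mk 0 0 1 0 0).mul ⟨0, 0, 1, 0, 0⟩).mul ⟨0, 0, 1, 0, 0⟩).mul ⟨0, 0, 1, 0, 0⟩) := by
  rw [ev_mul, ev_mul, ev_mul, ev_b2]; ring

lemma bo1_46 : 46 * bo1 = 96 + 28 * bo2 - 2 * bo2 ^ 2 + 10 * bo2 ^ 3 - 4 * bo2 ^ 4 := by
  rw [b2_pow2, b2_pow3, b2_pow4]
  simp only [ev, V.mul]
  push_cast
  ring
lemma bo3_46 : 46 * bo3 = 72 - 2 * bo2 + 10 * bo2 ^ 2 - 4 * bo2 ^ 3 - 3 * bo2 ^ 4 := by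
  rw [b2_pow2, b2_pow3, b2_pow4]
  simp only [ev, V.mul]
  push_cast
  ring
lemma bo4_46 : 46 * bo4 = 168 + 26 * bo2 - 38 * bo2 ^ 2 + 6 * bo2 ^ 3 - 7 * bo2 ^ 4 := by
  rw [b2_pow2, b2_pow3, b2_pow4]
  simp only [ev, V.mul]
  push_cast
  ring

lemma deg1_res {P : Ideal (𝓞 KK)} {p : ℕ} (hp : p.Prime) (hN : Ideal.absNorm P = p) (x : 𝓞 KK) :
    ∃ n : ℕ, n < p ∧ x - n ∈ P := by
  have : Fact p.Prime := ⟨hp⟩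
  have hc : Nat.card (𝓞 KK ⧸ P) = p := by rw [← hN, Ideal.absNorm_apply]; rfl
  have h1 : (1 : 𝓞 KK ⧸ P) ≠ 0 := by
    intro h
    rw [← map_one (Ideal.Quotient.mk P), Ideal.Quotient.eq_zero_iff_mem, ← Ideal.eq_top_iff_one] at h
    rw [h, Ideal.absNorm_top] at hN
    exact hp.one_lt.ne hN
  obtain ⟨k, hk⟩ := mem_zmultiples_of_prime_card hc h1 (g' := Ideal.Quotient.mk P x)
  have hpP : (p : 𝓞 KK) ∈ P := by rw [← hN]; exact Ideal.absNorm_mem P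
  have hpz : (p : ℤ) ≠ 0 := by exact_mod_cast hp.ne_zero
  refine ⟨(k % p).toNat, ?_, ?_⟩
  · have := Int.emod_lt_of_pos k (b := p) (by exact_mod_cast hp.pos)
    have := Int.emod_nonneg k hpz
    omega
  · have h2 : x - (k : 𝓞 KK) ∈ P := by
      rw [← Ideal.Quotient.eq_zero_iff_mem, map_sub, ← hk]
      simp
    have h3 : (((k % p).toNat : ℕ) : 𝓞 KK) = k - p * ((k / p : ℤ) : 𝓞 KK) := by
      have e : (((k % p).toNat : ℕ) : ℤ) = k - p * (k / p) := by
        rw [Int.toNat_of_nonneg (Int.emod_nonneg k hpz), Int.emod_def]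
      have := congrArg (Int.cast (R := 𝓞 KK)) e
      push_cast at this
      exact_mod_cast this
    rw [h3]
    have : x - (k - p * ((k / p : ℤ) : 𝓞 KK)) = (x - k) + p * ((k / p : ℤ) : 𝓞 KK) := by ring
    rw [this]
    exact P.add_mem h2 (P.mul_mem_right _ hpP)

lemma resd_congr {P : Ideal (𝓞 KK)} {p : ℕ} (hpP : (p : 𝓞 KK) ∈ P) {x : 𝓞 KK} {a b : ℤ}
    (h : x - a ∈ P) (hab : (p : ℤ) ∣ b - a) : x - b ∈ P := by
  obtain ⟨m, hm⟩ := hab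
  have : x - b = (x - a) - p * m := by
    have := congrArg (Int.cast (R := 𝓞 KK)) hm
    push_cast at this
    linear_combination -this
  rw [this]
  exact P.sub_mem h (P.mul_mem_right _ hpP)

lemma aux46 {P : Ideal (𝓞 KK)} (hP : P ≠ ⊤) {p : ℕ} (hp : p.Prime) (hpP : (p : 𝓞 KK) ∈ P)
    (h2 : p ≠ 2) (h23 : p ≠ 23) {b : 𝓞 KK} {n r t : ℤ} {c0 c1 c2 c3 c4 : ℤ}
    (hb : 46 * b = c0 + c1 * bo2 + c2 * bo2 ^ 2 + c3 * bo2 ^ 3 + c4 * bo2 ^ 4)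
    (hn : b - n ∈ P) (hr : bo2 - r ∈ P)
    (ht : (46 * t - (c0 + c1 * r + c2 * r ^ 2 + c3 * r ^ 3 + c4 * r ^ 4)) % p = 0) :
    b - t ∈ P := by
  apply resd_congr hpP hn
  have h1 : ((46 * n - (c0 + c1 * r + c2 * r ^ 2 + c3 * r ^ 3 + c4 * r ^ 4) : ℤ) : 𝓞 KK) ∈ P := by
    rw [← Ideal.Quotient.eq_zero_iff_mem] at hn hr ⊢
    rw [map_sub, sub_eq_zero] at hn hr
    have := congrArg (Ideal.Quotient.mk P) hb
    simp only [map_mul, map_add, map_pow, hn, hr, map_ofNat, map_intCast] at this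
    simp only [map_intCast]
    push_cast
    rw [this]
    ring
  have h2' := int_mem hP hp hpP h1
  have h3 := dvd_sub (Int.dvd_of_emod_eq_zero ht) h2'
  have h4 : (p : ℤ) ∣ 46 * (t - n) := by
    have e : 46 * (t - n) = 46 * t - (c0 + c1 * r + c2 * r ^ 2 + c3 * r ^ 3 + c4 * r ^ 4)
      - (46 * n - (c0 + c1 * r + c2 * r ^ 2 + c3 * r ^ 3 + c4 * r ^ 4)) := by ring
    rw [e]
    exact h3
  have hpi := Nat.prime_iff_prime_int.mp hp
  rcases hpi.dvd_or_dvd h4 with h | h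
  · exfalso
    have h : p ∣ 2 * 23 := by exact_mod_cast h
    rcases hp.dvd_mul.mp h with h | h
    · exact h2 ((Nat.prime_dvd_prime_iff_eq hp (by norm_num)).mp h)
    · exact h23 ((Nat.prime_dvd_prime_iff_eq hp (by norm_num)).mp h)
  · exact h

lemma mult_aux {P : Ideal (𝓞 KK)} (hP : P ≠ ⊤) {p : ℕ} (hp : p.Prime) (hpP : (p : 𝓞 KK) ∈ P)
    {s : V} (hs : resd P s) {x y : V} {a b : ℤ} (ha : ev x - a ∈ P) (hb : ev y - b ∈ P) :
    (s.val (x.mul y) - a * b) % p = 0 := by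
  apply Int.emod_eq_zero_of_dvd
  apply int_mem hP hp hpP
  have h := val_mem hs (x.mul y)
  rw [ev_mul] at h
  rw [← Ideal.Quotient.eq_zero_iff_mem] at ha hb h ⊢
  rw [map_sub, sub_eq_zero] at ha hb h
  rw [map_mul, ha, hb] at h
  push_cast
  rw [map_sub, ← h]
  simp

lemma deg1_cases {P : Ideal (𝓞 KK)} {p : ℕ} (hp : p.Prime) (hN : Ideal.absNorm P = p)
    (hp251 : p < 251) (h2 : p ≠ 2) :
    ∃ e ∈ tabE, e.1 = p ∧ okE p e.2.1 e.2.2.1 e.2.2.2 ∧ resd P e.2.1 := by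
  have hpP : (p : 𝓞 KK) ∈ P := by rw [← hN]; exact Ideal.absNorm_mem P
  have hP : P ≠ ⊤ := by
    rintro rfl
    rw [Ideal.absNorm_top] at hN
    exact hp.one_lt.ne hN
  obtain ⟨r, hr, hr'⟩ := deg1_res hp hN bo2
  obtain ⟨n1, hn1, hn1'⟩ := deg1_res hp hN bo1
  obtain ⟨n3, hn3, hn3'⟩ := deg1_res hp hN bo3
  obtain ⟨n4, hn4, hn4'⟩ := deg1_res hp hN bo4
  have hroot : ((r : ℤ) ^ 5 - 30 * r - 60) % p = 0 := by
    apply Int.emod_eq_zero_of_dvd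
    apply int_mem hP hp hpP
    rw [← Ideal.Quotient.eq_zero_iff_mem] at hr' ⊢
    rw [map_sub, sub_eq_zero] at hr'
    have := congrArg (Ideal.Quotient.mk P) be_pow_O
    simp only [map_mul, map_add, map_pow, hr', map_ofNat, map_natCast] at this
    simp only [map_intCast]
    push_cast
    rw [this]
    ring
  by_cases h23 : p = 23
  · subst h23
    have hs : resd P ⟨1, n1, r, n3, n1 + n3 - r ^ 2⟩ := by
      refine ⟨by simpa using hn1', by simpa using hr', by simpa using hn3', ?_⟩
      have : bo2 ^ 2 = bo1 + bo3 - bo4 := by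
        rw [b2_pow2]; simp [ev, V.mul]; ring
      rw [← Ideal.Quotient.eq_zero_iff_mem] at hr' hn1' hn3' ⊢
      rw [map_sub, sub_eq_zero] at hr' hn1' hn3'
      have e : bo4 = bo1 + bo3 - bo2 ^ 2 := by rw [this]; ring
      rw [e]
      push_cast
      simp [hr', hn1', hn3']
    have m1 : ev (uu 1) - (n1 : ℤ) ∈ P := by simpa [ev, uu] using hn1'
    have m2 : ev (uu 2) - (r : ℤ) ∈ P := by simpa [ev, uu] using hr'
    have m3 : ev (uu 3) - (n3 : ℤ) ∈ P := by simpa [ev, uu] using hn3'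
    obtain ⟨e, he, he1, e1, e2, e3, e4, hok⟩ := tab_check23 r hr hroot n1 hn1 n3 hn3
      ⟨mult_aux hP hp hpP hs m1 m1, mult_aux hP hp hpP hs m3 m3, mult_aux hP hp hpP hs m1 m2,
        mult_aux hP hp hpP hs m3 m2⟩
    exact ⟨e, he, he1, hok, resd_congr hpP hs.1 (Int.dvd_of_emod_eq_zero e1),
      resd_congr hpP hs.2.1 (Int.dvd_of_emod_eq_zero e2),
      resd_congr hpP hs.2.2.1 (Int.dvd_of_emod_eq_zero e3),
      resd_congr hpP hs.2.2.2 (Int.dvd_of_emod_eq_zero e4)⟩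
  · obtain ⟨e, he, he1, hc, hok⟩ := tab_check p (mem_primesL hp hp251) h2 h23 r hr hroot
    obtain ⟨c2, c1, c3, c4⟩ := hc
    have hr0 : bo2 - (r : ℤ) ∈ P := by simpa using hr'
    refine ⟨e, he, he1, hok, ?_, ?_, ?_, ?_⟩
    · apply aux46 hP hp hpP h2 h23 (n := n1) (r := r) (c0 := 96) (c1 := 28) (c2 := -2) (c3 := 10)
        (c4 := -4) _ (by simpa using hn1') hr0 (by rw [← c1]; ring_nf)
      rw [bo1_46]; push_cast; ring
    · rw [c2]; exact hr0
    · apply aux46 hP hp hpP h2 h23 (n := n3) (r := r) (c0 := 72) (c1 := -2) (c2 := 10) (c3 := -4)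
        (c4 := -3) _ (by simpa using hn3') hr0 (by rw [← c3]; ring_nf)
      rw [bo3_46]; push_cast; ring
    · apply aux46 hP hp hpP h2 h23 (n := n4) (r := r) (c0 := 168) (c1 := 26) (c2 := -38) (c3 := 6)
        (c4 := -7) _ (by simpa using hn4') hr0 (by rw [← c4]; ring_nf)
      rw [bo4_46]; push_cast; ring


lemma ib_repr (x : V) (i : Fin 5) : ib.repr (ev x) i = x.co i := by
  have h : ev x = evL x.co := rfl
  have h2 : ib.equivFun (ev x) = x.co := by
    rw [ib, Module.Basis.equivFun_ofEquivFun, h, LinearEquiv.symm_apply_eq]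
    rfl
  rw [← Module.Basis.equivFun_apply, h2]

/-- Norm in coordinates. -/
def V.nm (x : V) : ℤ := Matrix.det (Matrix.of fun i j : Fin 5 => (x.mul (uu j)).co i)

lemma norm_ev (x : V) : Algebra.norm ℤ (ev x) = x.nm := by
  rw [Algebra.norm_eq_matrix_det ib, V.nm]
  congr 1
  ext i j
  rw [Algebra.leftMulMatrix_eq_repr_mul, ib_apply, ← ev_mul, ib_repr]
  rfl

lemma absNorm_ev (x : V) : Ideal.absNorm (Ideal.span {ev x}) = x.nm.natAbs := by
  rw [Ideal.absNorm_span_singleton, norm_ev]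

/-- Generator of the unramified prime above two. -/
def vqi : V := ⟨2, 2, 1, -1, 0⟩
/-- Generator of the ramified prime above two. -/
def vpi : V := ⟨1, -1, 0, -1, 0⟩
/-- Generator of the prime above three. -/
def vp3 : V := ⟨-135, 53, -35, 26, -24⟩
/-- Generator of the prime above five. -/
def vp5 : V := ⟨-35, 1, 13, -13, 5⟩

lemma ok_pi : okE (2 : ℕ) ⟨1, 0, 0, 1, 1⟩ vpi ⟨-58, -20, -20, 11, 15⟩ := by decide +kernel
lemma ok_qi : okE (2 : ℕ) ⟨1, 0, 0, 0, 0⟩ vqi ⟨-11, 5, -7, -1, -2⟩ := by decide +kernel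
lemma ok_p3 : okE (3 : ℕ) ⟨1, 0, 0, 0, 0⟩ vp3 ⟨1215, -32, -457, 454, -170⟩ := by decide +kernel
lemma ok_p5 : okE (5 : ℕ) ⟨1, 1, 0, 2, 3⟩ vp5 ⟨-79, 32, -37, 3, -13⟩ := by decide +kernel

lemma gen_of_mem {p : ℕ} (hp : p.Prime) {s g g' : V} (h : okE p s g g') {P : Ideal (𝓞 KK)}
    (hP : P ≠ ⊤) (hg : ev g ∈ P) : P = Ideal.span {ev g} := by
  have hp0 : (p : ℤ) ≠ 0 := by exact_mod_cast hp.ne_zero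
  apply okE_gen hp h hP _ (okE_res hp0 h hg)
  have h4 : ev g * ev g' = (p : ℤ) := by rw [← ev_mul, h.1, ev_int]
  have := P.mul_mem_right (ev g') hg
  rw [h4] at this
  exact_mod_cast this

lemma above2 {P : Ideal (𝓞 KK)} (hP : P.IsPrime) (h : (2 : 𝓞 KK) ∈ P) :
    P = Ideal.span {ev vpi} ∨ P = Ideal.span {ev vqi} := by
  have h1 : ev vqi * (ev vpi) ^ 4 ∈ P := by
    have e : vqi.mul ((vpi.mul vpi).mul (vpi.mul vpi)) = V.smul 2 ⟨121, -15, -40, 41, -19⟩ := by decide +kernel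
    have := congrArg ev e
    rw [ev_mul, ev_mul, ev_mul, ev_smul] at this
    have e2 : ev vqi * (ev vpi) ^ 4 = 2 * ev ⟨121, -15, -40, 41, -19⟩ := by
      rw [← Int.cast_ofNat, ← this]; ring
    rw [e2]
    exact P.mul_mem_right _ h
  rcases hP.mem_or_mem h1 with h2 | h2
  · exact Or.inr (gen_of_mem Nat.prime_two ok_qi hP.ne_top h2)
  · exact Or.inl (gen_of_mem Nat.prime_two ok_pi hP.ne_top (hP.mem_of_pow_mem _ h2))

lemma above3 {P : Ideal (𝓞 KK)} (hP : P.IsPrime) (h : (3 : 𝓞 KK) ∈ P) :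
    P = Ideal.span {ev vp3} := by
  have h1 : (ev vp3) ^ 5 ∈ P := by
    have e : vp3.mul ((vp3.mul vp3).mul (vp3.mul vp3)) = V.smul 3 ⟨-685593837449, 276306067745, -291005817325, 48386845890, -114911241170⟩ := by decide +kernel
    have := congrArg ev e
    rw [ev_mul, ev_mul, ev_mul, ev_smul] at this
    have e2 : (ev vp3) ^ 5 = 3 * ev ⟨-685593837449, 276306067745, -291005817325, 48386845890, -114911241170⟩ := by
      rw [← Int.cast_ofNat, ← this]; ring
    rw [e2]
    exact P.mul_mem_right _ h
  exact gen_of_mem Nat.prime_three ok_p3 hP.ne_top (hP.mem_of_pow_mem _ h1)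

lemma above5 {P : Ideal (𝓞 KK)} (hP : P.IsPrime) (h : (5 : 𝓞 KK) ∈ P) :
    P = Ideal.span {ev vp5} := by
  have h1 : (ev vp5) ^ 5 ∈ P := by
    have e : vp5.mul ((vp5.mul vp5).mul (vp5.mul vp5)) = V.smul 5 ⟨389028509, 305211135, -180450343, 57825305, 116644505⟩ := by decide +kernel
    have := congrArg ev e
    rw [ev_mul, ev_mul, ev_mul, ev_smul] at this
    have e2 : (ev vp5) ^ 5 = 5 * ev ⟨389028509, 305211135, -180450343, 57825305, 116644505⟩ := by
      rw [← Int.cast_ofNat, ← this]; ring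
    rw [e2]
    exact P.mul_mem_right _ h
  exact gen_of_mem Nat.prime_five ok_p5 hP.ne_top (hP.mem_of_pow_mem _ h1)

lemma cubic_out {P : Ideal (𝓞 KK)} {p : ℕ} (hp : p.Prime) (h251 : p < 251) (h2 : p ≠ 2) {g : V}
    (hN : Ideal.absNorm P = p ^ 2) (hg : g.nm.natAbs = p ^ 3)
    (hc : ∀ e ∈ tabE, e.1 = p → e.2.1.val g % p ≠ 0) (h : ev g ∈ P) : False := by
  have hd : P ∣ Ideal.span {ev g} := by
    rw [Ideal.dvd_iff_le, Ideal.span_singleton_le_iff_mem]; exact h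
  obtain ⟨Q, hQ⟩ := hd
  have hn := congrArg Ideal.absNorm hQ
  rw [absNorm_ev, hg, map_mul, hN] at hn
  have hp2 : 0 < p ^ 2 := pow_pos hp.pos 2
  have hQN : Ideal.absNorm Q = p := by
    apply Nat.eq_of_mul_eq_mul_left hp2
    rw [← hn]; ring
  have hgQ : ev g ∈ Q := by
    have hle : Ideal.span {ev g} ≤ Q := by
      rw [← Ideal.dvd_iff_le]
      exact ⟨P, by rw [hQ, mul_comm]⟩
    exact hle (Ideal.mem_span_singleton_self _)
  obtain ⟨e, he, he1, -, hr⟩ := deg1_cases hp hQN h251 h2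
  apply hc e he he1
  apply Int.emod_eq_zero_of_dvd
  have hQtop : Q ≠ ⊤ := by
    rintro rfl
    rw [Ideal.absNorm_top] at hQN
    exact hp.one_lt.ne hQN
  apply int_mem hQtop hp (by rw [← hQN]; exact Ideal.absNorm_mem Q)
  have := Q.sub_mem hgQ (val_mem hr g)
  simpa using this

lemma quad_in {P : Ideal (𝓞 KK)} {p : ℕ} (hp : p.Prime) {g : V}
    (hN : Ideal.absNorm P = p ^ 2) (hg : g.nm.natAbs = p ^ 2)
    (h : ev g ∈ P) : P = Ideal.span {ev g} := by
  have hd : P ∣ Ideal.span {ev g} := by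
    rw [Ideal.dvd_iff_le, Ideal.span_singleton_le_iff_mem]; exact h
  obtain ⟨Q, hQ⟩ := hd
  have hn := congrArg Ideal.absNorm hQ
  rw [absNorm_ev, hg, map_mul, hN] at hn
  have hp2 : 0 < p ^ 2 := pow_pos hp.pos 2
  have hQN : Ideal.absNorm Q = 1 := by
    apply Nat.eq_of_mul_eq_mul_left hp2
    rw [← hn]; ring
  rw [Ideal.absNorm_eq_one_iff] at hQN
  rw [hQ, hQN, Ideal.mul_top]

lemma nm_q7 : (V.nm ⟨7, -1, -3, -5, 1⟩).natAbs = 7 ^ 2 := by decide +kernel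
lemma nm_c7 : (V.nm ⟨49, 16, 17, -9, -13⟩).natAbs = 7 ^ 3 := by decide +kernel
lemma nm_q13 : (V.nm ⟨1, 2, 4, -3, -1⟩).natAbs = 13 ^ 2 := by decide +kernel
lemma nm_c13 : (V.nm ⟨-11, 0, 12, 13, -1⟩).natAbs = 13 ^ 3 := by decide +kernel
lemma nm_c11 : (V.nm ⟨-7, 1, 3, -3, 1⟩).natAbs = 11 ^ 3 := by decide +kernel

lemma above7 {P : Ideal (𝓞 KK)} (hP : P.IsPrime) (hN : Ideal.absNorm P = 7 ^ 2)
    (h : (7 : 𝓞 KK) ∈ P) : P.IsPrincipal := by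
  have e : V.mul ⟨7, -1, -3, -5, 1⟩ ⟨49, 16, 17, -9, -13⟩ = V.int 7 := by decide +kernel
  have e := congrArg ev e
  rw [ev_mul, ev_int] at e
  rw [← Int.cast_ofNat, ← e] at h
  rcases hP.mem_or_mem h with h | h
  · exact ⟨_, quad_in (by norm_num) hN nm_q7 h⟩
  · exact (cubic_out (by norm_num) (by norm_num) (by norm_num) hN nm_c7 (by decide +kernel) h).elim

lemma above13 {P : Ideal (𝓞 KK)} (hP : P.IsPrime) (hN : Ideal.absNorm P = 13 ^ 2)
    (h : (13 : 𝓞 KK) ∈ P) : P.IsPrincipal := by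
  have e : V.mul ⟨1, 2, 4, -3, -1⟩ ⟨-11, 0, 12, 13, -1⟩ = V.int 13 := by decide +kernel
  have e := congrArg ev e
  rw [ev_mul, ev_int] at e
  rw [← Int.cast_ofNat, ← e] at h
  rcases hP.mem_or_mem h with h | h
  · exact ⟨_, quad_in (by norm_num) hN nm_q13 h⟩
  · exact (cubic_out (by norm_num) (by norm_num) (by norm_num) hN nm_c13 (by decide +kernel) h).elim

lemma above11 {P : Ideal (𝓞 KK)} (hP : P.IsPrime) (hN : Ideal.absNorm P = 11 ^ 2)
    (h : (11 : 𝓞 KK) ∈ P) : P.IsPrincipal := by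
  have e : (V.mul ⟨5, -2, -1, 2, -2⟩ ⟨35, -20, 38, 15, 7⟩).mul ⟨-7, 1, 3, -3, 1⟩ = V.int 11 := by decide +kernel
  have e := congrArg ev e
  rw [ev_mul, ev_mul, ev_int] at e
  rw [← Int.cast_ofNat, ← e] at h
  rcases hP.mem_or_mem h with h | h
  · rcases hP.mem_or_mem h with h | h
    · have ok : okE (11 : ℕ) ⟨1, 7, 5, 8, 1⟩ ⟨5, -2, -1, 2, -2⟩ ⟨-29, 17, -31, -12, -6⟩ := by decide +kernel
      exact ⟨_, gen_of_mem (by norm_num) ok hP.ne_top h⟩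
    · have ok : okE (11 : ℕ) ⟨1, 3, 2, 3, 2⟩ ⟨35, -20, 38, 15, 7⟩ ⟨1, 78, -6, -23, 41⟩ := by decide +kernel
      exact ⟨_, gen_of_mem (by norm_num) ok hP.ne_top h⟩
  · exact (cubic_out (by norm_num) (by norm_num) (by norm_num) hN nm_c11 (by decide +kernel) h).elim

lemma small_dim {p f : ℕ} (h : p ^ f < 251) (h2 : 2 ≤ f) (hp : p.Prime) (n2 : p ≠ 2) (n3 : p ≠ 3)
    (n5 : p ≠ 5) : f = 2 ∧ (p = 7 ∨ p = 11 ∨ p = 13) := by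
  have hp7 : 7 ≤ p := by
    by_contra hlt
    have := hp.two_le
    have h4 : p ≠ 4 := by rintro rfl; revert hp; norm_num
    have h6 : p ≠ 6 := by rintro rfl; revert hp; norm_num
    omega
  have hf : f = 2 := by
    by_contra hne
    have h3 : 3 ≤ f := by omega
    have : 7 ^ 3 ≤ p ^ f :=
      (Nat.pow_le_pow_left hp7 3).trans (Nat.pow_le_pow_right (by omega) h3)
    omega
  subst hf
  refine ⟨rfl, ?_⟩
  have : p < 16 := by nlinarith
  interval_cases p <;> first | omega | (revert hp; norm_num)

instance pid_KK : IsPrincipalIdealRing (𝓞 KK) := by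
  apply RingOfIntegers.isPrincipalIdealRing_of_isPrincipal_of_pow_le_of_mem_primesOver_of_mem_Icc
  intro p hpI hp P hPo hle
  have hP : P.IsPrime := hPo.1
  have hlo : P.LiesOver (Ideal.span {(p : ℤ)}) := hPo.2
  have hle2 : p ^ P.inertiaDeg ℤ < 251 :=
    lt_of_le_of_lt hle ((Nat.floor_lt' (by norm_num)).mpr mink)
  have hmax : (Ideal.span {(p : ℤ)}).IsMaximal :=
    (Nat.prime_iff_prime_int.mp hp).isMaximal_span_singleton
  have hN : Ideal.absNorm P = p ^ P.inertiaDeg ℤ := by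
    have := Ideal.natAbs_pow_inertiaDeg (p : ℤ) P
    rw [← this, Int.natAbs_natCast]
  have hpP : (p : 𝓞 KK) ∈ P := by
    have h1 : (p : ℤ) ∈ Ideal.span {(p : ℤ)} := Ideal.mem_span_singleton_self _
    rw [Ideal.mem_of_liesOver P (Ideal.span {(p : ℤ)})] at h1
    simpa using h1
  have hf : 0 < P.inertiaDeg ℤ := by
    rcases Nat.eq_zero_or_pos (P.inertiaDeg ℤ) with h0 | h0
    · rw [h0, pow_zero, Ideal.absNorm_eq_one_iff] at hN
      exact absurd hN hP.ne_top
    · exact h0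
  by_cases n2 : p = 2
  · subst n2
    rcases above2 hP (by exact_mod_cast hpP) with h | h
    · exact ⟨_, h⟩
    · exact ⟨_, h⟩
  by_cases n3 : p = 3
  · subst n3
    exact ⟨_, above3 hP (by exact_mod_cast hpP)⟩
  by_cases n5 : p = 5
  · subst n5
    exact ⟨_, above5 hP (by exact_mod_cast hpP)⟩
  by_cases h1 : P.inertiaDeg ℤ = 1
  · rw [h1, pow_one] at hN hle2
    obtain ⟨e, -, -, hok, hr⟩ := deg1_cases hp hN hle2 n2
    exact ⟨_, okE_gen hp hok hP.ne_top hpP hr⟩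
  · obtain ⟨h2, h⟩ := small_dim hle2 (by omega) hp n2 n3 n5
    rw [h2] at hN
    rcases h with rfl | rfl | rfl
    · exact above7 hP hN (by exact_mod_cast hpP)
    · exact above11 hP hN (by exact_mod_cast hpP)
    · exact above13 hP hN (by exact_mod_cast hpP)


/-- First fundamental unit. -/
def ve1 : V := ⟨5, 1, -3, 3, -1⟩
/-- Second unit. -/
def ve2 : V := ⟨1951, -1260, 2775, 1330, 410⟩

/-- Representatives of units modulo squares. -/
def Fv (k : Bool × Bool × Bool) : V :=
  ((if k.1 then V.int (-1) else V.int 1).mul (if k.2.1 then ve1 else V.int 1)).mul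
    (if k.2.2 then ve2 else V.int 1)

/-- Their inverses. -/
def Fi (k : Bool × Bool × Bool) : V :=
  ((if k.1 then V.int (-1) else V.int 1).mul (if k.2.1 then ⟨-1651, -570, -573, 315, 425⟩ else V.int 1)).mul
    (if k.2.2 then ⟨-65549, -21565, 27175, -18030, -3460⟩ else V.int 1)

lemma Fv_Fi : ∀ k, (Fv k).mul (Fi k) = V.int 1 := by decide +kernel

lemma ev_one : ev (V.int 1) = 1 := by rw [ev_int]; simp

/-- Representatives as units. -/
noncomputable def Fu (k : Bool × Bool × Bool) : (𝓞 KK)ˣ :=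
  Units.mkOfMulEqOne (ev (Fv k)) (ev (Fi k)) (by rw [← ev_mul, Fv_Fi, ev_one])

lemma Fu_val (k : Bool × Bool × Bool) : ((Fu k : (𝓞 KK)ˣ) : 𝓞 KK) = ev (Fv k) := rfl

/-- Difference in coordinates. -/
def V.sub (x y : V) : V := ⟨x.x0 - y.x0, x.x1 - y.x1, x.x2 - y.x2, x.x3 - y.x3, x.x4 - y.x4⟩

lemma Fv_check : ∀ k l : Bool × Bool × Bool, k ≠ l → ∀ a b c d e : Fin 2,
    ¬ (((Fv k).mul (Fv l)).sub
      ((V.mk a.val b.val c.val d.val e.val).mul ⟨a.val, b.val, c.val, d.val, e.val⟩)).dvd 4 := by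
  decide +kernel

lemma sq_mod4 (w : V) : ∃ a b c d e : Fin 2, ∃ y : V, w.mul w =
    ((V.mk a.val b.val c.val d.val e.val).mul ⟨a.val, b.val, c.val, d.val, e.val⟩).add
      (y.smul 4) := by
  obtain ⟨x0, x1, x2, x3, x4⟩ := w
  obtain ⟨a, m0, rfl⟩ := split2 x0
  obtain ⟨b, m1, rfl⟩ := split2 x1
  obtain ⟨c, m2, rfl⟩ := split2 x2
  obtain ⟨d, m3, rfl⟩ := split2 x3
  obtain ⟨e, m4, rfl⟩ := split2 x4
  refine ⟨a, b, c, d, e, ((V.mk a.val b.val c.val d.val e.val).mul ⟨m0, m1, m2, m3, m4⟩).add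
    ((V.mk m0 m1 m2 m3 m4).mul ⟨m0, m1, m2, m3, m4⟩), ?_⟩
  apply ev_inj
  rw [ev_add, ev_smul, ev_add, ev_mul, ev_mul, ev_mul, ev_mul]
  have : ev ⟨a.val + 2 * m0, b.val + 2 * m1, c.val + 2 * m2, d.val + 2 * m3, e.val + 2 * m4⟩ =
    ev ⟨a.val, b.val, c.val, d.val, e.val⟩ + 2 * ev ⟨m0, m1, m2, m3, m4⟩ := by
    simp only [ev]; push_cast; ring
  rw [this]
  push_cast
  ring

lemma Fu_nonsq {k l : Bool × Bool × Bool} (h : k ≠ l) (w : (𝓞 KK)ˣ) : Fu k * Fu l ≠ w ^ 2 := by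
  intro hw
  have h1 := congrArg (Units.val) hw
  rw [Units.val_mul, Fu_val, Fu_val, Units.val_pow_eq_pow_val] at h1
  obtain ⟨z, hz⟩ := ev_surj (w : 𝓞 KK)
  rw [← hz, ← ev_mul, pow_two, ← ev_mul] at h1
  have h2 := ev_inj h1
  obtain ⟨a, b, c, d, e, y, hy⟩ := sq_mod4 z
  apply Fv_check k l h a b c d e
  rw [h2, hy]
  simp [V.sub, V.add, V.smul, V.dvd]

open Classical in
/-- Class of a unit modulo squares. -/
noncomputable def ucls (x : (𝓞 KK)ˣ) : Bool × (Fin (Units.rank KK) → ZMod 2) :=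
  (decide ((((Units.exist_unique_eq_mul_prod KK x).choose).1 : (𝓞 KK)ˣ) = 1),
    fun i => (((Units.exist_unique_eq_mul_prod KK x).choose).2 i : ZMod 2))

lemma ucls_sq {x y : (𝓞 KK)ˣ} (h : ucls x = ucls y) : ∃ w : (𝓞 KK)ˣ, x * y = w ^ 2 := by
  have hx := (Units.exist_unique_eq_mul_prod KK x).choose_spec.1
  have hy := (Units.exist_unique_eq_mul_prod KK y).choose_spec.1
  rw [ucls, ucls, Prod.mk.injEq] at h
  set X := (Units.exist_unique_eq_mul_prod KK x).choose
  set Y := (Units.exist_unique_eq_mul_prod KK y).choose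
  obtain ⟨h1, h2⟩ := h
  have hodd : Odd (Module.finrank ℚ KK) := by rw [finrank_KK]; decide
  have ht : (X.1 : (𝓞 KK)ˣ) * Y.1 = 1 := by
    have h1 : ((X.1 : (𝓞 KK)ˣ) = 1) ↔ ((Y.1 : (𝓞 KK)ˣ) = 1) := by simpa using h1
    rcases Units.torsion_eq_one_or_neg_one_of_odd_finrank hodd X.1 with hX | hX <;>
    rcases Units.torsion_eq_one_or_neg_one_of_odd_finrank hodd Y.1 with hY | hY
    · rw [hX, hY]; simp
    · rw [hX, hY] at h1; rw [hX, hY, h1.mp rfl]; simp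
    · rw [hX, hY] at h1; rw [hX, hY, h1.mpr rfl]; simp
    · rw [hX, hY]; simp
  have he : ∀ i, ∃ m : ℤ, X.2 i + Y.2 i = 2 * m := by
    intro i
    have := congrFun h2 i
    have h3 : ((X.2 i - Y.2 i : ℤ) : ZMod 2) = 0 := by push_cast; rw [this]; ring
    rw [ZMod.intCast_zmod_eq_zero_iff_dvd] at h3
    obtain ⟨m, hm⟩ := h3
    push_cast at hm
    exact ⟨m + Y.2 i, by omega⟩
  choose m hm using he
  refine ⟨∏ i, Units.fundSystem KK i ^ m i, ?_⟩
  rw [hx, hy, mul_mul_mul_comm, ht, one_mul, ← Finset.prod_mul_distrib, ← Finset.prod_pow]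
  apply Finset.prod_congr rfl
  intro i _
  rw [← zpow_add, hm, ← zpow_natCast, ← zpow_mul, mul_comm]
  rfl

lemma unit_class (x : (𝓞 KK)ˣ) : ∃ k, ∃ w : 𝓞 KK, (x : 𝓞 KK) = ev (Fv k) * w ^ 2 := by
  have hinj : Function.Injective (fun k => ucls (Fu k)) := by
    intro k l h
    by_contra hne
    obtain ⟨w, hw⟩ := ucls_sq h
    exact Fu_nonsq hne w hw
  have hbij : Function.Bijective (fun k => ucls (Fu k)) := by
    rw [Fintype.bijective_iff_injective_and_card]
    refine ⟨hinj, ?_⟩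
    simp [rank_eq, ZMod.card]
  obtain ⟨k, hk⟩ := hbij.2 (ucls x)
  obtain ⟨w, hw⟩ := ucls_sq hk
  refine ⟨k, ((w * (Fu k)⁻¹ : (𝓞 KK)ˣ) : 𝓞 KK), ?_⟩
  have : x = Fu k * (w * (Fu k)⁻¹) ^ 2 := by
    rw [mul_pow, ← hw, pow_two]
    have e : Fu k * (Fu k * x * ((Fu k)⁻¹ * (Fu k)⁻¹)) = (Fu k * (Fu k)⁻¹) * (Fu k * (Fu k)⁻¹) * x := by
      ac_rfl
    rw [e]
    simp
  rw [← Fu_val]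
  exact_mod_cast congrArg Units.val this


/-- Coefficients of the sextic factor. -/
def c6 : ℕ → V
  | 0 => ⟨-16, 0, 0, 8, 0⟩
  | 1 => ⟨144, 40, 64, -16, -32⟩
  | 2 => ⟨0, 40, 0, 0, -20⟩
  | 3 => ⟨40, 0, -40, -40, 0⟩
  | 4 => ⟨0, 40, -20, -10, -20⟩
  | 5 => ⟨-216, -50, -60, 48, 40⟩
  | 6 => ⟨-16, 0, -16, -6, 3⟩
  | _ => ⟨0, 0, 0, 0, 0⟩

/-- Coefficients of the complementary factor. -/
def c24 : ℕ → V
  | 0 => ⟨-45056, -28672, 28672, -12288, -8192⟩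
  | 1 => ⟨884736, 598016, -507904, 204800, 147456⟩
  | 2 => ⟨2408448, 569344, -991232, 495616, 49152⟩
  | 3 => ⟨15024128, 3502080, -6250496, 4984832, -200704⟩
  | 4 => ⟨-2783232, -13416448, 1415168, 3399680, -7845888⟩
  | 5 => ⟨28655616, -10539008, -14139392, 10866688, -10979328⟩
  | 6 => ⟨-22317056, 60688384, -6076416, -22174720, 31519744⟩
  | 7 => ⟨-17031168, 23202816, 2291712, 3876864, 10211328⟩
  | 8 => ⟨-159844608, -3644160, 70646016, -58336512, 21510144⟩
  | 9 => ⟨-78020608, -199089152, 19822592, 60318720, -124137472⟩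
  | 10 => ⟨392822784, 52407808, -127659008, 145633792, -19602432⟩
  | 11 => ⟨712790016, 217043456, -279092224, 233162240, 31888896⟩
  | 12 => ⟨676926208, -10358016, -255023872, 286084096, -115036928⟩
  | 13 => ⟨182135808, 315773440, -53758976, -41251328, 162713856⟩
  | 14 => ⟨28531968, -144064768, -27826432, 44938880, -102415488⟩
  | 15 => ⟨-672469504, -261490048, 272302848, -232773632, -42331648⟩
  | 16 => ⟨-285371856, 37099824, 99479184, -136526160, 58620384⟩
  | 17 => ⟨12419712, -811104, 26352192, -24675936, 17592768⟩
  | 18 => ⟨-336410048, -82850320, 145410016, -93039792, -753536⟩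
  | 19 => ⟨-146415168, 4278128, 38304032, -49757680, 13251888⟩
  | 20 => ⟨71853384, 37956808, -30511208, 18331552, 10524648⟩
  | 21 => ⟨-3633664, 21866736, 272896, -9047920, 13278776⟩
  | 22 => ⟨2928888, -1974616, 24008, 633716, -815628⟩
  | 23 => ⟨2385408, 2807500, -1459496, -244808, 1233456⟩
  | 24 => ⟨176113, 229567, -97737, -29395, 93292⟩
  | _ => ⟨0, 0, 0, 0, 0⟩

/-- The sextic factor. -/
noncomputable def F6 {S : Type*} [CommRing S] (s : 𝓞 KK →+* S) (x y : S) : S :=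
  s (ev (c6 0)) * (y ^ 6) + s (ev (c6 1)) * (x * y ^ 5)
     + s (ev (c6 2)) * (x ^ 2 * y ^ 4) + s (ev (c6 3)) * (x ^ 3 * y ^ 3)
     + s (ev (c6 4)) * (x ^ 4 * y ^ 2) + s (ev (c6 5)) * (x ^ 5 * y)
     + s (ev (c6 6)) * (x ^ 6)

/-- The complementary factor. -/
noncomputable def F24 {S : Type*} [CommRing S] (s : 𝓞 KK →+* S) (x y : S) : S :=
  s (ev (c24 0)) * (y ^ 24) + s (ev (c24 1)) * (x * y ^ 23)
     + s (ev (c24 2)) * (x ^ 2 * y ^ 22) + s (ev (c24 3)) * (x ^ 3 * y ^ 21)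
     + s (ev (c24 4)) * (x ^ 4 * y ^ 20) + s (ev (c24 5)) * (x ^ 5 * y ^ 19)
     + s (ev (c24 6)) * (x ^ 6 * y ^ 18) + s (ev (c24 7)) * (x ^ 7 * y ^ 17)
     + s (ev (c24 8)) * (x ^ 8 * y ^ 16) + s (ev (c24 9)) * (x ^ 9 * y ^ 15)
     + s (ev (c24 10)) * (x ^ 10 * y ^ 14) + s (ev (c24 11)) * (x ^ 11 * y ^ 13)
     + s (ev (c24 12)) * (x ^ 12 * y ^ 12) + s (ev (c24 13)) * (x ^ 13 * y ^ 11)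
     + s (ev (c24 14)) * (x ^ 14 * y ^ 10) + s (ev (c24 15)) * (x ^ 15 * y ^ 9)
     + s (ev (c24 16)) * (x ^ 16 * y ^ 8) + s (ev (c24 17)) * (x ^ 17 * y ^ 7)
     + s (ev (c24 18)) * (x ^ 18 * y ^ 6) + s (ev (c24 19)) * (x ^ 19 * y ^ 5)
     + s (ev (c24 20)) * (x ^ 20 * y ^ 4) + s (ev (c24 21)) * (x ^ 21 * y ^ 3)
     + s (ev (c24 22)) * (x ^ 22 * y ^ 2) + s (ev (c24 23)) * (x ^ 23 * y)
     + s (ev (c24 24)) * (x ^ 24)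

lemma cv0 {S : Type*} [CommRing S] (s : 𝓞 KK →+* S) :
    s (ev (c6 0)) * s (ev (c24 0)) = -655360 := by
  have h : (c6 0).mul (c24 0) = V.int (-655360) := by decide +kernel
  have h2 := congrArg s (congrArg ev h)
  simpa only [ev_add, ev_mul, ev_int, map_add, map_mul, map_intCast, Int.cast_neg, Int.cast_ofNat, map_neg, map_ofNat] using h2

lemma cv1 {S : Type*} [CommRing S] (s : 𝓞 KK →+* S) :
    s (ev (c6 0)) * s (ev (c24 1)) + s (ev (c6 1)) * s (ev (c24 0)) = 12779520 := by
  have h : ((c6 0).mul (c24 1)).add ((c6 1).mul (c24 0)) = V.int (12779520) := by decide +kernel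
  have h2 := congrArg s (congrArg ev h)
  simpa only [ev_add, ev_mul, ev_int, map_add, map_mul, map_intCast, Int.cast_neg, Int.cast_ofNat, map_neg, map_ofNat] using h2

lemma cv2 {S : Type*} [CommRing S] (s : 𝓞 KK →+* S) :
    s (ev (c6 0)) * s (ev (c24 2)) + s (ev (c6 1)) * s (ev (c24 1)) + s (ev (c6 2)) * s (ev (c24 0)) = 14254080 := by
  have h : (((c6 0).mul (c24 2)).add ((c6 1).mul (c24 1))).add ((c6 2).mul (c24 0)) = V.int (14254080) := by decide +kernel
  have h2 := congrArg s (congrArg ev h)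
  simpa only [ev_add, ev_mul, ev_int, map_add, map_mul, map_intCast, Int.cast_neg, Int.cast_ofNat, map_neg, map_ofNat] using h2

lemma cv3 {S : Type*} [CommRing S] (s : 𝓞 KK →+* S) :
    s (ev (c6 0)) * s (ev (c24 3)) + s (ev (c6 1)) * s (ev (c24 2)) + s (ev (c6 2)) * s (ev (c24 1)) + s (ev (c6 3)) * s (ev (c24 0)) = 118784000 := by
  have h : ((((c6 0).mul (c24 3)).add ((c6 1).mul (c24 2))).add ((c6 2).mul (c24 1))).add ((c6 3).mul (c24 0)) = V.int (118784000) := by decide +kernel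
  have h2 := congrArg s (congrArg ev h)
  simpa only [ev_add, ev_mul, ev_int, map_add, map_mul, map_intCast, Int.cast_neg, Int.cast_ofNat, map_neg, map_ofNat] using h2

lemma cv4 {S : Type*} [CommRing S] (s : 𝓞 KK →+* S) :
    s (ev (c6 0)) * s (ev (c24 4)) + s (ev (c6 1)) * s (ev (c24 3)) + s (ev (c6 2)) * s (ev (c24 2)) + s (ev (c6 3)) * s (ev (c24 1)) + s (ev (c6 4)) * s (ev (c24 0)) = -64143360 := by
  have h : (((((c6 0).mul (c24 4)).add ((c6 1).mul (c24 3))).add ((c6 2).mul (c24 2))).add ((c6 3).mul (c24 1))).add ((c6 4).mul (c24 0)) = V.int (-64143360) := by decide +kernel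
  have h2 := congrArg s (congrArg ev h)
  simpa only [ev_add, ev_mul, ev_int, map_add, map_mul, map_intCast, Int.cast_neg, Int.cast_ofNat, map_neg, map_ofNat] using h2

lemma cv5 {S : Type*} [CommRing S] (s : 𝓞 KK →+* S) :
    s (ev (c6 0)) * s (ev (c24 5)) + s (ev (c6 1)) * s (ev (c24 4)) + s (ev (c6 2)) * s (ev (c24 3)) + s (ev (c6 3)) * s (ev (c24 2)) + s (ev (c6 4)) * s (ev (c24 1)) + s (ev (c6 5)) * s (ev (c24 0)) = 744062976 := by
  have h : ((((((c6 0).mul (c24 5)).add ((c6 1).mul (c24 4))).add ((c6 2).mul (c24 3))).add ((c6 3).mul (c24 2))).add ((c6 4).mul (c24 1))).add ((c6 5).mul (c24 0)) = V.int (744062976) := by decide +kernel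
  have h2 := congrArg s (congrArg ev h)
  simpa only [ev_add, ev_mul, ev_int, map_add, map_mul, map_intCast, Int.cast_neg, Int.cast_ofNat, map_neg, map_ofNat] using h2

lemma cv6 {S : Type*} [CommRing S] (s : 𝓞 KK →+* S) :
    s (ev (c6 0)) * s (ev (c24 6)) + s (ev (c6 1)) * s (ev (c24 5)) + s (ev (c6 2)) * s (ev (c24 4)) + s (ev (c6 3)) * s (ev (c24 3)) + s (ev (c6 4)) * s (ev (c24 2)) + s (ev (c6 5)) * s (ev (c24 1)) + s (ev (c6 6)) * s (ev (c24 0)) = 2939904000 := by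
  have h : (((((((c6 0).mul (c24 6)).add ((c6 1).mul (c24 5))).add ((c6 2).mul (c24 4))).add ((c6 3).mul (c24 3))).add ((c6 4).mul (c24 2))).add ((c6 5).mul (c24 1))).add ((c6 6).mul (c24 0)) = V.int (2939904000) := by decide +kernel
  have h2 := congrArg s (congrArg ev h)
  simpa only [ev_add, ev_mul, ev_int, map_add, map_mul, map_intCast, Int.cast_neg, Int.cast_ofNat, map_neg, map_ofNat] using h2

lemma cv7 {S : Type*} [CommRing S] (s : 𝓞 KK →+* S) :
    s (ev (c6 0)) * s (ev (c24 7)) + s (ev (c6 1)) * s (ev (c24 6)) + s (ev (c6 2)) * s (ev (c24 5)) + s (ev (c6 3)) * s (ev (c24 4)) + s (ev (c6 4)) * s (ev (c24 3)) + s (ev (c6 5)) * s (ev (c24 2)) + s (ev (c6 6)) * s (ev (c24 1)) = 320716800 := by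
  have h : (((((((c6 0).mul (c24 7)).add ((c6 1).mul (c24 6))).add ((c6 2).mul (c24 5))).add ((c6 3).mul (c24 4))).add ((c6 4).mul (c24 3))).add ((c6 5).mul (c24 2))).add ((c6 6).mul (c24 1)) = V.int (320716800) := by decide +kernel
  have h2 := congrArg s (congrArg ev h)
  simpa only [ev_add, ev_mul, ev_int, map_add, map_mul, map_intCast, Int.cast_neg, Int.cast_ofNat, map_neg, map_ofNat] using h2

lemma cv8 {S : Type*} [CommRing S] (s : 𝓞 KK →+* S) :
    s (ev (c6 0)) * s (ev (c24 8)) + s (ev (c6 1)) * s (ev (c24 7)) + s (ev (c6 2)) * s (ev (c24 6)) + s (ev (c6 3)) * s (ev (c24 5)) + s (ev (c6 4)) * s (ev (c24 4)) + s (ev (c6 5)) * s (ev (c24 3)) + s (ev (c6 6)) * s (ev (c24 2)) = -7376486400 := by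
  have h : (((((((c6 0).mul (c24 8)).add ((c6 1).mul (c24 7))).add ((c6 2).mul (c24 6))).add ((c6 3).mul (c24 5))).add ((c6 4).mul (c24 4))).add ((c6 5).mul (c24 3))).add ((c6 6).mul (c24 2)) = V.int (-7376486400) := by decide +kernel
  have h2 := congrArg s (congrArg ev h)
  simpa only [ev_add, ev_mul, ev_int, map_add, map_mul, map_intCast, Int.cast_neg, Int.cast_ofNat, map_neg, map_ofNat] using h2

lemma cv9 {S : Type*} [CommRing S] (s : 𝓞 KK →+* S) :
    s (ev (c6 0)) * s (ev (c24 9)) + s (ev (c6 1)) * s (ev (c24 8)) + s (ev (c6 2)) * s (ev (c24 7)) + s (ev (c6 3)) * s (ev (c24 6)) + s (ev (c6 4)) * s (ev (c24 5)) + s (ev (c6 5)) * s (ev (c24 4)) + s (ev (c6 6)) * s (ev (c24 3)) = 1024512000 := by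
  have h : (((((((c6 0).mul (c24 9)).add ((c6 1).mul (c24 8))).add ((c6 2).mul (c24 7))).add ((c6 3).mul (c24 6))).add ((c6 4).mul (c24 5))).add ((c6 5).mul (c24 4))).add ((c6 6).mul (c24 3)) = V.int (1024512000) := by decide +kernel
  have h2 := congrArg s (congrArg ev h)
  simpa only [ev_add, ev_mul, ev_int, map_add, map_mul, map_intCast, Int.cast_neg, Int.cast_ofNat, map_neg, map_ofNat] using h2

lemma cv10 {S : Type*} [CommRing S] (s : 𝓞 KK →+* S) :
    s (ev (c6 0)) * s (ev (c24 10)) + s (ev (c6 1)) * s (ev (c24 9)) + s (ev (c6 2)) * s (ev (c24 8)) + s (ev (c6 3)) * s (ev (c24 7)) + s (ev (c6 4)) * s (ev (c24 6)) + s (ev (c6 5)) * s (ev (c24 5)) + s (ev (c6 6)) * s (ev (c24 4)) = 1782650880 := by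
  have h : (((((((c6 0).mul (c24 10)).add ((c6 1).mul (c24 9))).add ((c6 2).mul (c24 8))).add ((c6 3).mul (c24 7))).add ((c6 4).mul (c24 6))).add ((c6 5).mul (c24 5))).add ((c6 6).mul (c24 4)) = V.int (1782650880) := by decide +kernel
  have h2 := congrArg s (congrArg ev h)
  simpa only [ev_add, ev_mul, ev_int, map_add, map_mul, map_intCast, Int.cast_neg, Int.cast_ofNat, map_neg, map_ofNat] using h2

lemma cv11 {S : Type*} [CommRing S] (s : 𝓞 KK →+* S) :
    s (ev (c6 0)) * s (ev (c24 11)) + s (ev (c6 1)) * s (ev (c24 10)) + s (ev (c6 2)) * s (ev (c24 9)) + s (ev (c6 3)) * s (ev (c24 8)) + s (ev (c6 4)) * s (ev (c24 7)) + s (ev (c6 5)) * s (ev (c24 6)) + s (ev (c6 6)) * s (ev (c24 5)) = 22436812800 := by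
  have h : (((((((c6 0).mul (c24 11)).add ((c6 1).mul (c24 10))).add ((c6 2).mul (c24 9))).add ((c6 3).mul (c24 8))).add ((c6 4).mul (c24 7))).add ((c6 5).mul (c24 6))).add ((c6 6).mul (c24 5)) = V.int (22436812800) := by decide +kernel
  have h2 := congrArg s (congrArg ev h)
  simpa only [ev_add, ev_mul, ev_int, map_add, map_mul, map_intCast, Int.cast_neg, Int.cast_ofNat, map_neg, map_ofNat] using h2

lemma cv12 {S : Type*} [CommRing S] (s : 𝓞 KK →+* S) :
    s (ev (c6 0)) * s (ev (c24 12)) + s (ev (c6 1)) * s (ev (c24 11)) + s (ev (c6 2)) * s (ev (c24 10)) + s (ev (c6 3)) * s (ev (c24 9)) + s (ev (c6 4)) * s (ev (c24 8)) + s (ev (c6 5)) * s (ev (c24 7)) + s (ev (c6 6)) * s (ev (c24 6)) = -18492441600 := by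
  have h : (((((((c6 0).mul (c24 12)).add ((c6 1).mul (c24 11))).add ((c6 2).mul (c24 10))).add ((c6 3).mul (c24 9))).add ((c6 4).mul (c24 8))).add ((c6 5).mul (c24 7))).add ((c6 6).mul (c24 6)) = V.int (-18492441600) := by decide +kernel
  have h2 := congrArg s (congrArg ev h)
  simpa only [ev_add, ev_mul, ev_int, map_add, map_mul, map_intCast, Int.cast_neg, Int.cast_ofNat, map_neg, map_ofNat] using h2

lemma cv13 {S : Type*} [CommRing S] (s : 𝓞 KK →+* S) :
    s (ev (c6 0)) * s (ev (c24 13)) + s (ev (c6 1)) * s (ev (c24 12)) + s (ev (c6 2)) * s (ev (c24 11)) + s (ev (c6 3)) * s (ev (c24 10)) + s (ev (c6 4)) * s (ev (c24 9)) + s (ev (c6 5)) * s (ev (c24 8)) + s (ev (c6 6)) * s (ev (c24 7)) = 35038310400 := by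
  have h : (((((((c6 0).mul (c24 13)).add ((c6 1).mul (c24 12))).add ((c6 2).mul (c24 11))).add ((c6 3).mul (c24 10))).add ((c6 4).mul (c24 9))).add ((c6 5).mul (c24 8))).add ((c6 6).mul (c24 7)) = V.int (35038310400) := by decide +kernel
  have h2 := congrArg s (congrArg ev h)
  simpa only [ev_add, ev_mul, ev_int, map_add, map_mul, map_intCast, Int.cast_neg, Int.cast_ofNat, map_neg, map_ofNat] using h2

lemma cv14 {S : Type*} [CommRing S] (s : 𝓞 KK →+* S) :
    s (ev (c6 0)) * s (ev (c24 14)) + s (ev (c6 1)) * s (ev (c24 13)) + s (ev (c6 2)) * s (ev (c24 12)) + s (ev (c6 3)) * s (ev (c24 11)) + s (ev (c6 4)) * s (ev (c24 10)) + s (ev (c6 5)) * s (ev (c24 9)) + s (ev (c6 6)) * s (ev (c24 8)) = 74456409600 := by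
  have h : (((((((c6 0).mul (c24 14)).add ((c6 1).mul (c24 13))).add ((c6 2).mul (c24 12))).add ((c6 3).mul (c24 11))).add ((c6 4).mul (c24 10))).add ((c6 5).mul (c24 9))).add ((c6 6).mul (c24 8)) = V.int (74456409600) := by decide +kernel
  have h2 := congrArg s (congrArg ev h)
  simpa only [ev_add, ev_mul, ev_int, map_add, map_mul, map_intCast, Int.cast_neg, Int.cast_ofNat, map_neg, map_ofNat] using h2

lemma cv15 {S : Type*} [CommRing S] (s : 𝓞 KK →+* S) :
    s (ev (c6 0)) * s (ev (c24 15)) + s (ev (c6 1)) * s (ev (c24 14)) + s (ev (c6 2)) * s (ev (c24 13)) + s (ev (c6 3)) * s (ev (c24 12)) + s (ev (c6 4)) * s (ev (c24 11)) + s (ev (c6 5)) * s (ev (c24 10)) + s (ev (c6 6)) * s (ev (c24 9)) = 19855042560 := by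
  have h : (((((((c6 0).mul (c24 15)).add ((c6 1).mul (c24 14))).add ((c6 2).mul (c24 13))).add ((c6 3).mul (c24 12))).add ((c6 4).mul (c24 11))).add ((c6 5).mul (c24 10))).add ((c6 6).mul (c24 9)) = V.int (19855042560) := by decide +kernel
  have h2 := congrArg s (congrArg ev h)
  simpa only [ev_add, ev_mul, ev_int, map_add, map_mul, map_intCast, Int.cast_neg, Int.cast_ofNat, map_neg, map_ofNat] using h2

lemma cv16 {S : Type*} [CommRing S] (s : 𝓞 KK →+* S) :
    s (ev (c6 0)) * s (ev (c24 16)) + s (ev (c6 1)) * s (ev (c24 15)) + s (ev (c6 2)) * s (ev (c24 14)) + s (ev (c6 3)) * s (ev (c24 13)) + s (ev (c6 4)) * s (ev (c24 12)) + s (ev (c6 5)) * s (ev (c24 11)) + s (ev (c6 6)) * s (ev (c24 10)) = 74456409600 := by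
  have h : (((((((c6 0).mul (c24 16)).add ((c6 1).mul (c24 15))).add ((c6 2).mul (c24 14))).add ((c6 3).mul (c24 13))).add ((c6 4).mul (c24 12))).add ((c6 5).mul (c24 11))).add ((c6 6).mul (c24 10)) = V.int (74456409600) := by decide +kernel
  have h2 := congrArg s (congrArg ev h)
  simpa only [ev_add, ev_mul, ev_int, map_add, map_mul, map_intCast, Int.cast_neg, Int.cast_ofNat, map_neg, map_ofNat] using h2

lemma cv17 {S : Type*} [CommRing S] (s : 𝓞 KK →+* S) :
    s (ev (c6 0)) * s (ev (c24 17)) + s (ev (c6 1)) * s (ev (c24 16)) + s (ev (c6 2)) * s (ev (c24 15)) + s (ev (c6 3)) * s (ev (c24 14)) + s (ev (c6 4)) * s (ev (c24 13)) + s (ev (c6 5)) * s (ev (c24 12)) + s (ev (c6 6)) * s (ev (c24 11)) = -37228204800 := by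
  have h : (((((((c6 0).mul (c24 17)).add ((c6 1).mul (c24 16))).add ((c6 2).mul (c24 15))).add ((c6 3).mul (c24 14))).add ((c6 4).mul (c24 13))).add ((c6 5).mul (c24 12))).add ((c6 6).mul (c24 11)) = V.int (-37228204800) := by decide +kernel
  have h2 := congrArg s (congrArg ev h)
  simpa only [ev_add, ev_mul, ev_int, map_add, map_mul, map_intCast, Int.cast_neg, Int.cast_ofNat, map_neg, map_ofNat] using h2

lemma cv18 {S : Type*} [CommRing S] (s : 𝓞 KK →+* S) :
    s (ev (c6 0)) * s (ev (c24 18)) + s (ev (c6 1)) * s (ev (c24 17)) + s (ev (c6 2)) * s (ev (c24 16)) + s (ev (c6 3)) * s (ev (c24 15)) + s (ev (c6 4)) * s (ev (c24 14)) + s (ev (c6 5)) * s (ev (c24 13)) + s (ev (c6 6)) * s (ev (c24 12)) = -50245910400 := by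
  have h : (((((((c6 0).mul (c24 18)).add ((c6 1).mul (c24 17))).add ((c6 2).mul (c24 16))).add ((c6 3).mul (c24 15))).add ((c6 4).mul (c24 14))).add ((c6 5).mul (c24 13))).add ((c6 6).mul (c24 12)) = V.int (-50245910400) := by decide +kernel
  have h2 := congrArg s (congrArg ev h)
  simpa only [ev_add, ev_mul, ev_int, map_add, map_mul, map_intCast, Int.cast_neg, Int.cast_ofNat, map_neg, map_ofNat] using h2

lemma cv19 {S : Type*} [CommRing S] (s : 𝓞 KK →+* S) :
    s (ev (c6 0)) * s (ev (c24 19)) + s (ev (c6 1)) * s (ev (c24 18)) + s (ev (c6 2)) * s (ev (c24 17)) + s (ev (c6 3)) * s (ev (c24 16)) + s (ev (c6 4)) * s (ev (c24 15)) + s (ev (c6 5)) * s (ev (c24 14)) + s (ev (c6 6)) * s (ev (c24 13)) = -47697436800 := by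
  have h : (((((((c6 0).mul (c24 19)).add ((c6 1).mul (c24 18))).add ((c6 2).mul (c24 17))).add ((c6 3).mul (c24 16))).add ((c6 4).mul (c24 15))).add ((c6 5).mul (c24 14))).add ((c6 6).mul (c24 13)) = V.int (-47697436800) := by decide +kernel
  have h2 := congrArg s (congrArg ev h)
  simpa only [ev_add, ev_mul, ev_int, map_add, map_mul, map_intCast, Int.cast_neg, Int.cast_ofNat, map_neg, map_ofNat] using h2

lemma cv20 {S : Type*} [CommRing S] (s : 𝓞 KK →+* S) :
    s (ev (c6 0)) * s (ev (c24 20)) + s (ev (c6 1)) * s (ev (c24 19)) + s (ev (c6 2)) * s (ev (c24 18)) + s (ev (c6 3)) * s (ev (c24 17)) + s (ev (c6 4)) * s (ev (c24 16)) + s (ev (c6 5)) * s (ev (c24 15)) + s (ev (c6 6)) * s (ev (c24 14)) = -6798277440 := by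
  have h : (((((((c6 0).mul (c24 20)).add ((c6 1).mul (c24 19))).add ((c6 2).mul (c24 18))).add ((c6 3).mul (c24 17))).add ((c6 4).mul (c24 16))).add ((c6 5).mul (c24 15))).add ((c6 6).mul (c24 14)) = V.int (-6798277440) := by decide +kernel
  have h2 := congrArg s (congrArg ev h)
  simpa only [ev_add, ev_mul, ev_int, map_add, map_mul, map_intCast, Int.cast_neg, Int.cast_ofNat, map_neg, map_ofNat] using h2

lemma cv21 {S : Type*} [CommRing S] (s : 𝓞 KK →+* S) :
    s (ev (c6 0)) * s (ev (c24 21)) + s (ev (c6 1)) * s (ev (c24 20)) + s (ev (c6 2)) * s (ev (c24 19)) + s (ev (c6 3)) * s (ev (c24 18)) + s (ev (c6 4)) * s (ev (c24 17)) + s (ev (c6 5)) * s (ev (c24 16)) + s (ev (c6 6)) * s (ev (c24 15)) = -9406300800 := by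
  have h : (((((((c6 0).mul (c24 21)).add ((c6 1).mul (c24 20))).add ((c6 2).mul (c24 19))).add ((c6 3).mul (c24 18))).add ((c6 4).mul (c24 17))).add ((c6 5).mul (c24 16))).add ((c6 6).mul (c24 15)) = V.int (-9406300800) := by decide +kernel
  have h2 := congrArg s (congrArg ev h)
  simpa only [ev_add, ev_mul, ev_int, map_add, map_mul, map_intCast, Int.cast_neg, Int.cast_ofNat, map_neg, map_ofNat] using h2

lemma cv22 {S : Type*} [CommRing S] (s : 𝓞 KK →+* S) :
    s (ev (c6 0)) * s (ev (c24 22)) + s (ev (c6 1)) * s (ev (c24 21)) + s (ev (c6 2)) * s (ev (c24 20)) + s (ev (c6 3)) * s (ev (c24 19)) + s (ev (c6 4)) * s (ev (c24 18)) + s (ev (c6 5)) * s (ev (c24 17)) + s (ev (c6 6)) * s (ev (c24 16)) = -20386188000 := by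
  have h : (((((((c6 0).mul (c24 22)).add ((c6 1).mul (c24 21))).add ((c6 2).mul (c24 20))).add ((c6 3).mul (c24 19))).add ((c6 4).mul (c24 18))).add ((c6 5).mul (c24 17))).add ((c6 6).mul (c24 16)) = V.int (-20386188000) := by decide +kernel
  have h2 := congrArg s (congrArg ev h)
  simpa only [ev_add, ev_mul, ev_int, map_add, map_mul, map_intCast, Int.cast_neg, Int.cast_ofNat, map_neg, map_ofNat] using h2

lemma cv23 {S : Type*} [CommRing S] (s : 𝓞 KK →+* S) :
    s (ev (c6 0)) * s (ev (c24 23)) + s (ev (c6 1)) * s (ev (c24 22)) + s (ev (c6 2)) * s (ev (c24 21)) + s (ev (c6 3)) * s (ev (c24 20)) + s (ev (c6 4)) * s (ev (c24 19)) + s (ev (c6 5)) * s (ev (c24 18)) + s (ev (c6 6)) * s (ev (c24 17)) = -209217600 := by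
  have h : (((((((c6 0).mul (c24 23)).add ((c6 1).mul (c24 22))).add ((c6 2).mul (c24 21))).add ((c6 3).mul (c24 20))).add ((c6 4).mul (c24 19))).add ((c6 5).mul (c24 18))).add ((c6 6).mul (c24 17)) = V.int (-209217600) := by decide +kernel
  have h2 := congrArg s (congrArg ev h)
  simpa only [ev_add, ev_mul, ev_int, map_add, map_mul, map_intCast, Int.cast_neg, Int.cast_ofNat, map_neg, map_ofNat] using h2

lemma cv24 {S : Type*} [CommRing S] (s : 𝓞 KK →+* S) :
    s (ev (c6 0)) * s (ev (c24 24)) + s (ev (c6 1)) * s (ev (c24 23)) + s (ev (c6 2)) * s (ev (c24 22)) + s (ev (c6 3)) * s (ev (c24 21)) + s (ev (c6 4)) * s (ev (c24 20)) + s (ev (c6 5)) * s (ev (c24 19)) + s (ev (c6 6)) * s (ev (c24 18)) = 9051062400 := by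
  have h : (((((((c6 0).mul (c24 24)).add ((c6 1).mul (c24 23))).add ((c6 2).mul (c24 22))).add ((c6 3).mul (c24 21))).add ((c6 4).mul (c24 20))).add ((c6 5).mul (c24 19))).add ((c6 6).mul (c24 18)) = V.int (9051062400) := by decide +kernel
  have h2 := congrArg s (congrArg ev h)
  simpa only [ev_add, ev_mul, ev_int, map_add, map_mul, map_intCast, Int.cast_neg, Int.cast_ofNat, map_neg, map_ofNat] using h2

lemma cv25 {S : Type*} [CommRing S] (s : 𝓞 KK →+* S) :
    s (ev (c6 1)) * s (ev (c24 24)) + s (ev (c6 2)) * s (ev (c24 23)) + s (ev (c6 3)) * s (ev (c24 22)) + s (ev (c6 4)) * s (ev (c24 21)) + s (ev (c6 5)) * s (ev (c24 20)) + s (ev (c6 6)) * s (ev (c24 19)) = -2120176080 := by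
  have h : ((((((c6 1).mul (c24 24)).add ((c6 2).mul (c24 23))).add ((c6 3).mul (c24 22))).add ((c6 4).mul (c24 21))).add ((c6 5).mul (c24 20))).add ((c6 6).mul (c24 19)) = V.int (-2120176080) := by decide +kernel
  have h2 := congrArg s (congrArg ev h)
  simpa only [ev_add, ev_mul, ev_int, map_add, map_mul, map_intCast, Int.cast_neg, Int.cast_ofNat, map_neg, map_ofNat] using h2

lemma cv26 {S : Type*} [CommRing S] (s : 𝓞 KK →+* S) :
    s (ev (c6 2)) * s (ev (c24 24)) + s (ev (c6 3)) * s (ev (c24 23)) + s (ev (c6 4)) * s (ev (c24 22)) + s (ev (c6 5)) * s (ev (c24 21)) + s (ev (c6 6)) * s (ev (c24 20)) = -778897080 := by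
  have h : (((((c6 2).mul (c24 24)).add ((c6 3).mul (c24 23))).add ((c6 4).mul (c24 22))).add ((c6 5).mul (c24 21))).add ((c6 6).mul (c24 20)) = V.int (-778897080) := by decide +kernel
  have h2 := congrArg s (congrArg ev h)
  simpa only [ev_add, ev_mul, ev_int, map_add, map_mul, map_intCast, Int.cast_neg, Int.cast_ofNat, map_neg, map_ofNat] using h2

lemma cv27 {S : Type*} [CommRing S] (s : 𝓞 KK →+* S) :
    s (ev (c6 3)) * s (ev (c24 24)) + s (ev (c6 4)) * s (ev (c24 23)) + s (ev (c6 5)) * s (ev (c24 22)) + s (ev (c6 6)) * s (ev (c24 21)) = -633762520 := by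
  have h : ((((c6 3).mul (c24 24)).add ((c6 4).mul (c24 23))).add ((c6 5).mul (c24 22))).add ((c6 6).mul (c24 21)) = V.int (-633762520) := by decide +kernel
  have h2 := congrArg s (congrArg ev h)
  simpa only [ev_add, ev_mul, ev_int, map_add, map_mul, map_intCast, Int.cast_neg, Int.cast_ofNat, map_neg, map_ofNat] using h2

lemma cv28 {S : Type*} [CommRing S] (s : 𝓞 KK →+* S) :
    s (ev (c6 4)) * s (ev (c24 24)) + s (ev (c6 5)) * s (ev (c24 23)) + s (ev (c6 6)) * s (ev (c24 22)) = 11336100 := by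
  have h : (((c6 4).mul (c24 24)).add ((c6 5).mul (c24 23))).add ((c6 6).mul (c24 22)) = V.int (11336100) := by decide +kernel
  have h2 := congrArg s (congrArg ev h)
  simpa only [ev_add, ev_mul, ev_int, map_add, map_mul, map_intCast, Int.cast_neg, Int.cast_ofNat, map_neg, map_ofNat] using h2

lemma cv29 {S : Type*} [CommRing S] (s : 𝓞 KK →+* S) :
    s (ev (c6 5)) * s (ev (c24 24)) + s (ev (c6 6)) * s (ev (c24 23)) = -88246560 := by
  have h : ((c6 5).mul (c24 24)).add ((c6 6).mul (c24 23)) = V.int (-88246560) := by decide +kernel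
  have h2 := congrArg s (congrArg ev h)
  simpa only [ev_add, ev_mul, ev_int, map_add, map_mul, map_intCast, Int.cast_neg, Int.cast_ofNat, map_neg, map_ofNat] using h2

lemma cv30 {S : Type*} [CommRing S] (s : 𝓞 KK →+* S) :
    s (ev (c6 6)) * s (ev (c24 24)) = -6707374 := by
  have h : (c6 6).mul (c24 24) = V.int (-6707374) := by decide +kernel
  have h2 := congrArg s (congrArg ev h)
  simpa only [ev_add, ev_mul, ev_int, map_add, map_mul, map_intCast, Int.cast_neg, Int.cast_ofNat, map_neg, map_ofNat] using h2

set_option maxHeartbeats 4000000 in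
lemma F6_mul_F24 {S : Type*} [CommRing S] (s : 𝓞 KK →+* S) (x y : S) :
    F6 s x y * F24 s x y = 2 * fP x y := by
  have h0 := cv0 s
  have h1 := cv1 s
  have h2 := cv2 s
  have h3 := cv3 s
  have h4 := cv4 s
  have h5 := cv5 s
  have h6 := cv6 s
  have h7 := cv7 s
  have h8 := cv8 s
  have h9 := cv9 s
  have h10 := cv10 s
  have h11 := cv11 s
  have h12 := cv12 s
  have h13 := cv13 s
  have h14 := cv14 s
  have h15 := cv15 s
  have h16 := cv16 s
  have h17 := cv17 s
  have h18 := cv18 s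
  have h19 := cv19 s
  have h20 := cv20 s
  have h21 := cv21 s
  have h22 := cv22 s
  have h23 := cv23 s
  have h24 := cv24 s
  have h25 := cv25 s
  have h26 := cv26 s
  have h27 := cv27 s
  have h28 := cv28 s
  have h29 := cv29 s
  have h30 := cv30 s
  simp only [F6, F24, fP]
  generalize s (ev (c6 0)) = a0 at *
  generalize s (ev (c6 1)) = a1 at *
  generalize s (ev (c6 2)) = a2 at *
  generalize s (ev (c6 3)) = a3 at *
  generalize s (ev (c6 4)) = a4 at *
  generalize s (ev (c6 5)) = a5 at *
  generalize s (ev (c6 6)) = a6 at *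
  generalize s (ev (c24 0)) = b0 at *
  generalize s (ev (c24 1)) = b1 at *
  generalize s (ev (c24 2)) = b2 at *
  generalize s (ev (c24 3)) = b3 at *
  generalize s (ev (c24 4)) = b4 at *
  generalize s (ev (c24 5)) = b5 at *
  generalize s (ev (c24 6)) = b6 at *
  generalize s (ev (c24 7)) = b7 at *
  generalize s (ev (c24 8)) = b8 at *
  generalize s (ev (c24 9)) = b9 at *
  generalize s (ev (c24 10)) = b10 at *
  generalize s (ev (c24 11)) = b11 at *
  generalize s (ev (c24 12)) = b12 at *
  generalize s (ev (c24 13)) = b13 at *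
  generalize s (ev (c24 14)) = b14 at *
  generalize s (ev (c24 15)) = b15 at *
  generalize s (ev (c24 16)) = b16 at *
  generalize s (ev (c24 17)) = b17 at *
  generalize s (ev (c24 18)) = b18 at *
  generalize s (ev (c24 19)) = b19 at *
  generalize s (ev (c24 20)) = b20 at *
  generalize s (ev (c24 21)) = b21 at *
  generalize s (ev (c24 22)) = b22 at *
  generalize s (ev (c24 23)) = b23 at *
  generalize s (ev (c24 24)) = b24 at *
  linear_combination (y ^ 30) * h0 + (x * y ^ 29) * h1 + (x ^ 2 * y ^ 28) * h2 + (x ^ 3 * y ^ 27) * h3 + (x ^ 4 * y ^ 26) * h4 + (x ^ 5 * y ^ 25) * h5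
     + (x ^ 6 * y ^ 24) * h6 + (x ^ 7 * y ^ 23) * h7 + (x ^ 8 * y ^ 22) * h8 + (x ^ 9 * y ^ 21) * h9 + (x ^ 10 * y ^ 20) * h10 + (x ^ 11 * y ^ 19) * h11
     + (x ^ 12 * y ^ 18) * h12 + (x ^ 13 * y ^ 17) * h13 + (x ^ 14 * y ^ 16) * h14 + (x ^ 15 * y ^ 15) * h15 + (x ^ 16 * y ^ 14) * h16 + (x ^ 17 * y ^ 13) * h17
     + (x ^ 18 * y ^ 12) * h18 + (x ^ 19 * y ^ 11) * h19 + (x ^ 20 * y ^ 10) * h20 + (x ^ 21 * y ^ 9) * h21 + (x ^ 22 * y ^ 8) * h22 + (x ^ 23 * y ^ 7) * h23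
     + (x ^ 24 * y ^ 6) * h24 + (x ^ 25 * y ^ 5) * h25 + (x ^ 26 * y ^ 4) * h26 + (x ^ 27 * y ^ 3) * h27 + (x ^ 28 * y ^ 2) * h28 + (x ^ 29 * y) * h29
     + (x ^ 30) * h30


/-- The form h. -/
def hP {R : Type*} [CommRing R] (x y : R) : R :=
  192 * y ^ 12
    + 384 * x * y ^ 11
    - 2112 * x ^ 2 * y ^ 10
    - 7920 * x ^ 4 * y ^ 8
    - 6336 * x ^ 5 * y ^ 7
    + 3168 * x ^ 6 * y ^ 6
    + 6336 * x ^ 7 * y ^ 5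
    - 9900 * x ^ 8 * y ^ 4
    - 1320 * x ^ 9 * y ^ 3
    - 3828 * x ^ 10 * y ^ 2
    - 816 * x ^ 11 * y
    + 423 * x ^ 12

/-- The form g. -/
def gP {R : Type*} [CommRing R] (x y : R) : R :=
  -7168 * y ^ 20
    + 10240 * x * y ^ 19
    - 194560 * x ^ 2 * y ^ 18
    - 291840 * x ^ 3 * y ^ 17
    - 145920 * x ^ 4 * y ^ 16
    + 933888 * x ^ 5 * y ^ 15
    - 2042880 * x ^ 6 * y ^ 14
    - 4961280 * x ^ 7 * y ^ 13
    + 3319680 * x ^ 8 * y ^ 12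
    - 316160 * x ^ 9 * y ^ 11
    + 9231872 * x ^ 10 * y ^ 10
    + 3003520 * x ^ 11 * y ^ 9
    + 6165120 * x ^ 12 * y ^ 8
    + 7514880 * x ^ 13 * y ^ 7
    - 3082560 * x ^ 14 * y ^ 6
    - 2294592 * x ^ 15 * y ^ 5
    - 340860 * x ^ 16 * y ^ 4
    + 576840 * x ^ 17 * y ^ 3
    - 561640 * x ^ 18 * y ^ 2
    - 64820 * x ^ 19 * y
    - 29158 * x ^ 20

/-- Scaled derivative of h. -/
def hP1 {R : Type*} [CommRing R] (x y : R) : R :=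
  32 * y ^ 11
    - 352 * x * y ^ 10
    - 2640 * x ^ 3 * y ^ 8
    - 2640 * x ^ 4 * y ^ 7
    + 1584 * x ^ 5 * y ^ 6
    + 3696 * x ^ 6 * y ^ 5
    - 6600 * x ^ 7 * y ^ 4
    - 990 * x ^ 8 * y ^ 3
    - 3190 * x ^ 9 * y ^ 2
    - 748 * x ^ 10 * y
    + 423 * x ^ 11

/-- Scaled derivative of h. -/
def hP2 {R : Type*} [CommRing R] (x y : R) : R :=
  192 * y ^ 11
    + 352 * x * y ^ 10
    - 1760 * x ^ 2 * y ^ 9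
    - 5280 * x ^ 4 * y ^ 7
    - 3696 * x ^ 5 * y ^ 6
    + 1584 * x ^ 6 * y ^ 5
    + 2640 * x ^ 7 * y ^ 4
    - 3300 * x ^ 8 * y ^ 3
    - 330 * x ^ 9 * y ^ 2
    - 638 * x ^ 10 * y
    - 68 * x ^ 11

/-- Scaled second derivative of h. -/
def hP11 {R : Type*} [CommRing R] (x y : R) : R :=
  -32 * y ^ 10
    - 720 * x ^ 2 * y ^ 8
    - 960 * x ^ 3 * y ^ 7
    + 720 * x ^ 4 * y ^ 6
    + 2016 * x ^ 5 * y ^ 5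
    - 4200 * x ^ 6 * y ^ 4
    - 720 * x ^ 7 * y ^ 3
    - 2610 * x ^ 8 * y ^ 2
    - 680 * x ^ 9 * y
    + 423 * x ^ 10

/-- Scaled second derivative of h. -/
def hP22 {R : Type*} [CommRing R] (x y : R) : R :=
  192 * y ^ 10
    + 320 * x * y ^ 9
    - 1440 * x ^ 2 * y ^ 8
    - 3360 * x ^ 4 * y ^ 6
    - 2016 * x ^ 5 * y ^ 5
    + 720 * x ^ 6 * y ^ 4
    + 960 * x ^ 7 * y ^ 3
    - 900 * x ^ 8 * y ^ 2
    - 60 * x ^ 9 * y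
    - 58 * x ^ 10

/-- Derivative of g. -/
def gPu {R : Type*} [CommRing R] (x y : R) : R :=
  10240 * y ^ 19
    - 389120 * x * y ^ 18
    - 875520 * x ^ 2 * y ^ 17
    - 583680 * x ^ 3 * y ^ 16
    + 4669440 * x ^ 4 * y ^ 15
    - 12257280 * x ^ 5 * y ^ 14
    - 34728960 * x ^ 6 * y ^ 13
    + 26557440 * x ^ 7 * y ^ 12
    - 2845440 * x ^ 8 * y ^ 11
    + 92318720 * x ^ 9 * y ^ 10
    + 33038720 * x ^ 10 * y ^ 9
    + 73981440 * x ^ 11 * y ^ 8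
    + 97693440 * x ^ 12 * y ^ 7
    - 43155840 * x ^ 13 * y ^ 6
    - 34418880 * x ^ 14 * y ^ 5
    - 5453760 * x ^ 15 * y ^ 4
    + 9806280 * x ^ 16 * y ^ 3
    - 10109520 * x ^ 17 * y ^ 2
    - 1231580 * x ^ 18 * y
    - 583160 * x ^ 19

/-- Derivative of g. -/
def gPv {R : Type*} [CommRing R] (x y : R) : R :=
  -143360 * y ^ 19
    + 194560 * x * y ^ 18
    - 3502080 * x ^ 2 * y ^ 17
    - 4961280 * x ^ 3 * y ^ 16
    - 2334720 * x ^ 4 * y ^ 15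
    + 14008320 * x ^ 5 * y ^ 14
    - 28600320 * x ^ 6 * y ^ 13
    - 64496640 * x ^ 7 * y ^ 12
    + 39836160 * x ^ 8 * y ^ 11
    - 3477760 * x ^ 9 * y ^ 10
    + 92318720 * x ^ 10 * y ^ 9
    + 27031680 * x ^ 11 * y ^ 8
    + 49320960 * x ^ 12 * y ^ 7
    + 52604160 * x ^ 13 * y ^ 6
    - 18495360 * x ^ 14 * y ^ 5
    - 11472960 * x ^ 15 * y ^ 4
    - 1363440 * x ^ 16 * y ^ 3
    + 1730520 * x ^ 17 * y ^ 2
    - 1123280 * x ^ 18 * y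
    - 64820 * x ^ 19

/-- Derivative of f. -/
def fPu {R : Type*} [CommRing R] (x y : R) : R :=
  6389760 * y ^ 29
    + 14254080 * x * y ^ 28
    + 178176000 * x ^ 2 * y ^ 27
    - 128286720 * x ^ 3 * y ^ 26
    + 1860157440 * x ^ 4 * y ^ 25
    + 8819712000 * x ^ 5 * y ^ 24
    + 1122508800 * x ^ 6 * y ^ 23
    - 29505945600 * x ^ 7 * y ^ 22
    + 4610304000 * x ^ 8 * y ^ 21
    + 8913254400 * x ^ 9 * y ^ 20
    + 123402470400 * x ^ 10 * y ^ 19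
    - 110954649600 * x ^ 11 * y ^ 18
    + 227749017600 * x ^ 12 * y ^ 17
    + 521194867200 * x ^ 13 * y ^ 16
    + 148912819200 * x ^ 14 * y ^ 15
    + 595651276800 * x ^ 15 * y ^ 14
    - 316439740800 * x ^ 16 * y ^ 13
    - 452213193600 * x ^ 17 * y ^ 12
    - 453125649600 * x ^ 18 * y ^ 11
    - 67982774400 * x ^ 19 * y ^ 10
    - 98766158400 * x ^ 20 * y ^ 9
    - 224248068000 * x ^ 21 * y ^ 8
    - 2406002400 * x ^ 22 * y ^ 7
    + 108612748800 * x ^ 23 * y ^ 6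
    - 26502201000 * x ^ 24 * y ^ 5
    - 10125662040 * x ^ 25 * y ^ 4
    - 8555794020 * x ^ 26 * y ^ 3
    + 158705400 * x ^ 27 * y ^ 2
    - 1279575120 * x ^ 28 * y
    - 100610610 * x ^ 29

/-- Derivative of f. -/
def fPv {R : Type*} [CommRing R] (x y : R) : R :=
  -9830400 * y ^ 29
    + 185303040 * x * y ^ 28
    + 199557120 * x ^ 2 * y ^ 27
    + 1603584000 * x ^ 3 * y ^ 26
    - 833863680 * x ^ 4 * y ^ 25
    + 9300787200 * x ^ 5 * y ^ 24
    + 35278848000 * x ^ 6 * y ^ 23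
    + 3688243200 * x ^ 7 * y ^ 22
    - 81141350400 * x ^ 8 * y ^ 21
    + 10757376000 * x ^ 9 * y ^ 20
    + 17826508800 * x ^ 10 * y ^ 19
    + 213149721600 * x ^ 11 * y ^ 18
    - 166431974400 * x ^ 12 * y ^ 17
    + 297825638400 * x ^ 13 * y ^ 16
    + 595651276800 * x ^ 14 * y ^ 15
    + 148912819200 * x ^ 15 * y ^ 14
    + 521194867200 * x ^ 16 * y ^ 13
    - 241983331200 * x ^ 17 * y ^ 12
    - 301475462400 * x ^ 18 * y ^ 11
    - 262335902400 * x ^ 19 * y ^ 10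
    - 33991387200 * x ^ 20 * y ^ 9
    - 42328353600 * x ^ 21 * y ^ 8
    - 81544752000 * x ^ 22 * y ^ 7
    - 732261600 * x ^ 23 * y ^ 6
    + 27153187200 * x ^ 24 * y ^ 5
    - 5300440200 * x ^ 25 * y ^ 4
    - 1557794160 * x ^ 26 * y ^ 3
    - 950643780 * x ^ 27 * y ^ 2
    + 11336100 * x ^ 28 * y
    - 44123280 * x ^ 29

set_option maxHeartbeats 4000000 in
lemma id_g {R : Type*} [CommRing R] (x y : R) :
    12 * (fPu x y * hP2 x y - fPv x y * hP1 x y) = 360 * gP x y ^ 2 := by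
  simp only [fPu, fPv, hP1, hP2, gP]
  ring

set_option maxHeartbeats 4000000 in
lemma id_h {R : Type*} [CommRing R] (x y : R) :
    fPu x y * gPv x y - fPv x y * gPu x y = -600 * hP x y ^ 4 := by
  simp only [fPu, fPv, gPu, gPv, hP]
  ring

set_option maxHeartbeats 4000000 in
lemma id_h1 {R : Type*} [CommRing R] (x y : R) :
    hP1 x y ^ 2 - hP x y * hP11 x y = - y ^ 2 * gP x y := by
  simp only [hP1, hP, hP11, gP]
  ring

set_option maxHeartbeats 4000000 in
lemma id_h2 {R : Type*} [CommRing R] (x y : R) :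
    hP2 x y ^ 2 - hP x y * hP22 x y = - x ^ 2 * gP x y := by
  simp only [hP2, hP, hP22, gP]
  ring

set_option maxHeartbeats 4000000 in
lemma id_x {R : Type*} [CommRing R] (x y : R) :
    (-251328 * y ^ 10 - 478720 * x * y ^ 9 + 2235024 * x ^ 2 * y ^ 8 + 107712 * x ^ 3 * y ^ 7 + 7256040 * x ^ 4 * y ^ 6 + 5245416 * x ^ 5 * y ^ 5 - 736560 * x ^ 6 * y ^ 4 - 3141336 * x ^ 7 * y ^ 3 + 3654882 * x ^ 8 * y ^ 2 + 380490 * x ^ 9 * y + 1682684 * x ^ 10) * hP1 x y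
    + (41888 * y ^ 10 - 457776 * x * y ^ 9 - 26928 * x ^ 2 * y ^ 8 - 3523080 * x ^ 3 * y ^ 7 - 3685968 * x ^ 4 * y ^ 6 + 1331352 * x ^ 5 * y ^ 5 + 4612344 * x ^ 6 * y ^ 4 - 7892478 * x ^ 7 * y ^ 3 - 1335510 * x ^ 8 * y ^ 2 - 5719318 * x ^ 9 * y - 1110951 * x ^ 10) * hP2 x y
    = 787320000 * x ^ 21 := by
  simp only [hP1, hP2]
  ring

set_option maxHeartbeats 4000000 in
lemma id_y {R : Type*} [CommRing R] (x y : R) :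
    (2374868352 * y ^ 10 - 12966513824 * x * y ^ 9 + 1417081248 * x ^ 2 * y ^ 8 - 25469029080 * x ^ 3 * y ^ 7 - 19953250152 * x ^ 4 * y ^ 6 + 5174931564 * x ^ 5 * y ^ 5 + 16151064336 * x ^ 6 * y ^ 4 - 18152502522 * x ^ 7 * y ^ 3 - 1450257930 * x ^ 8 * y ^ 2 - 3437511792 * x ^ 9 * y - 370773128 * x ^ 10) * hP1 x y
    + (3803228608 * y ^ 10 - 457574832 * x * y ^ 9 + 11693693880 * x ^ 2 * y ^ 8 + 13864385568 * x ^ 3 * y ^ 7 - 2639863116 * x ^ 4 * y ^ 6 - 23282016120 * x ^ 5 * y ^ 5 + 37215352218 * x ^ 6 * y ^ 4 + 3838115160 * x ^ 7 * y ^ 3 + 16706461068 * x ^ 8 * y ^ 2 + 4334870749 * x ^ 9 * y - 2306426958 * x ^ 10) * hP2 x y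
    = 806215680000 * y ^ 21 := by
  simp only [hP1, hP2]
  ring

lemma add_eps_pow {R : Type*} [CommRing R] (x e : R) (he : e * e = 0) (n : ℕ) :
    (x + e) ^ (n + 1) = x ^ (n + 1) + (n + 1) * x ^ n * e := by
  induction n with
  | zero => simp
  | succ n ih =>
    rw [pow_succ, ih]
    push_cast
    linear_combination ((n : R) + 1) * x ^ n * he

set_option maxHeartbeats 4000000 in
lemma fP_eps_x {R : Type*} [CommRing R] (x y e : R) (he : e * e = 0) :
    fP (x + e) y = fP x y + fPu x y * e := by
  have k := fun n => add_eps_pow x e he n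
  have k2 := k 1
  have k3 := k 2
  have k4 := k 3
  have k5 := k 4
  have k6 := k 5
  have k7 := k 6
  have k8 := k 7
  have k9 := k 8
  have k10 := k 9
  have k11 := k 10
  have k12 := k 11
  have k13 := k 12
  have k14 := k 13
  have k15 := k 14
  have k16 := k 15
  have k17 := k 16
  have k18 := k 17
  have k19 := k 18
  have k20 := k 19
  have k21 := k 20
  have k22 := k 21
  have k23 := k 22
  have k24 := k 23
  have k25 := k 24
  have k26 := k 25
  have k27 := k 26
  have k28 := k 27
  have k29 := k 28
  have k30 := k 29
  norm_num only at k2 k3 k4 k5 k6 k7 k8 k9 k10 k11 k12 k13 k14 k15 k16 k17 k18 k19 k20 k21 k22 k23 k24 k25 k26 k27 k28 k29 k30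
  simp only [fP, fPu, fPv, k2, k3, k4, k5, k6, k7, k8, k9, k10, k11, k12, k13, k14, k15, k16, k17, k18, k19, k20, k21, k22, k23, k24, k25, k26, k27, k28, k29, k30]
  ring

set_option maxHeartbeats 4000000 in
lemma fP_eps_y {R : Type*} [CommRing R] (x y e : R) (he : e * e = 0) :
    fP x (y + e) = fP x y + fPv x y * e := by
  have k := fun n => add_eps_pow y e he n
  have k2 := k 1
  have k3 := k 2
  have k4 := k 3
  have k5 := k 4
  have k6 := k 5
  have k7 := k 6
  have k8 := k 7
  have k9 := k 8
  have k10 := k 9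
  have k11 := k 10
  have k12 := k 11
  have k13 := k 12
  have k14 := k 13
  have k15 := k 14
  have k16 := k 15
  have k17 := k 16
  have k18 := k 17
  have k19 := k 18
  have k20 := k 19
  have k21 := k 20
  have k22 := k 21
  have k23 := k 22
  have k24 := k 23
  have k25 := k 24
  have k26 := k 25
  have k27 := k 26
  have k28 := k 27
  have k29 := k 28
  have k30 := k 29
  norm_num only at k2 k3 k4 k5 k6 k7 k8 k9 k10 k11 k12 k13 k14 k15 k16 k17 k18 k19 k20 k21 k22 k23 k24 k25 k26 k27 k28 k29 k30
  simp only [fP, fPu, fPv, k2, k3, k4, k5, k6, k7, k8, k9, k10, k11, k12, k13, k14, k15, k16, k17, k18, k19, k20, k21, k22, k23, k24, k25, k26, k27, k28, k29, k30]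
  ring


lemma map_F6 {S T : Type*} [CommRing S] [CommRing T] (φ : S →+* T) (s : 𝓞 KK →+* S) (x y : S) :
    φ (F6 s x y) = F6 (φ.comp s) (φ x) (φ y) := by
  simp only [F6, map_add, map_mul, map_pow, RingHom.comp_apply]

lemma map_F24 {S T : Type*} [CommRing S] [CommRing T] (φ : S →+* T) (s : 𝓞 KK →+* S) (x y : S) :
    φ (F24 s x y) = F24 (φ.comp s) (φ x) (φ y) := by
  simp only [F24, map_add, map_mul, map_pow, RingHom.comp_apply]

lemma dual_mul {A : Type*} [CommRing A] (a b : DualNumber A) (ha : a.fst = 0) (hb : b.fst = 0) :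
    a * b = 0 := by
  ext <;> simp [ha, hb]

lemma map_fPu {R S : Type*} [CommRing R] [CommRing S] (φ : R →+* S) (x y : R) :
    φ (fPu x y) = fPu (φ x) (φ y) := by
  simp only [fPu, map_add, map_sub, map_neg, map_mul, map_pow, map_ofNat]

lemma map_fPv {R S : Type*} [CommRing R] [CommRing S] (φ : R →+* S) (x y : R) :
    φ (fPv x y) = fPv (φ x) (φ y) := by
  simp only [fPv, map_add, map_sub, map_neg, map_mul, map_pow, map_ofNat]

lemma dual_zero {A : Type*} [CommRing A] (s : 𝓞 KK →+* A) (x y : DualNumber A)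
    (h6 : F6 s x.fst y.fst = 0) (h24 : F24 s x.fst y.fst = 0) : 2 * fP x y = 0 := by
  let ι : A →+* DualNumber A := TrivSqZeroExt.inlHom A A
  let π : DualNumber A →+* A := (TrivSqZeroExt.fstHom A A A : DualNumber A →ₐ[A] A)
  have hc : π.comp (ι.comp s) = s := by ext z; rfl
  rw [← F6_mul_F24 (ι.comp s)]
  apply dual_mul
  · have := map_F6 π (ι.comp s) x y
    rw [hc] at this
    exact this.trans h6
  · have := map_F24 π (ι.comp s) x y
    rw [hc] at this
    exact this.trans h24

lemma dom_cop {A : Type*} [CommRing A] [IsDomain A] (s : 𝓞 KK →+* A) (x y : A)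
    (hxy : IsCoprime x y) (h6 : F6 s x y = 0) (h24 : F24 s x y = 0)
    (H2 : (2 : A) ≠ 0) (H3 : (3 : A) ≠ 0) (H5 : (5 : A) ≠ 0) : False := by
  let ι : A →+* DualNumber A := TrivSqZeroExt.inlHom A A
  have he : (DualNumber.eps : DualNumber A) * DualNumber.eps = 0 := DualNumber.eps_mul_eps
  have hfu : fPu x y = 0 := by
    have h := dual_zero s (ι x + DualNumber.eps) (ι y) (by simpa [ι] using h6) (by simpa [ι] using h24)
    rw [fP_eps_x _ _ _ he, ← map_fP, ← map_fPu] at h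
    have hq := congrArg TrivSqZeroExt.snd h
    simp [ι, two_mul] at hq
    rw [← two_mul] at hq
    exact (mul_eq_zero.1 hq).resolve_left H2
  have hfv : fPv x y = 0 := by
    have h := dual_zero s (ι x) (ι y + DualNumber.eps) (by simpa [ι] using h6) (by simpa [ι] using h24)
    rw [fP_eps_y _ _ _ he, ← map_fP, ← map_fPv] at h
    have hq := congrArg TrivSqZeroExt.snd h
    simp [ι, two_mul] at hq
    rw [← two_mul] at hq
    exact (mul_eq_zero.1 hq).resolve_left H2
  have hg : gP x y = 0 := by
    have h := id_g x y
    rw [hfu, hfv] at h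
    have e : (2 : A) ^ 3 * 3 ^ 2 * 5 * gP x y ^ 2 = 0 := by linear_combination -h
    simpa [H2, H3, H5] using e
  have hh : hP x y = 0 := by
    have h := id_h x y
    rw [hfu, hfv] at h
    have e : (2 : A) ^ 3 * 3 * 5 ^ 2 * hP x y ^ 4 = 0 := by linear_combination h
    simpa [H2, H3, H5] using e
  have hh1 : hP1 x y = 0 := by
    have h := id_h1 x y
    rw [hh, hg] at h
    have e : hP1 x y ^ 2 = 0 := by linear_combination h
    simpa using e
  have hh2 : hP2 x y = 0 := by
    have h := id_h2 x y
    rw [hh, hg] at h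
    have e : hP2 x y ^ 2 = 0 := by linear_combination h
    simpa using e
  have hx : x = 0 := by
    have h := id_x x y
    rw [hh1, hh2] at h
    have e : (2 : A) ^ 6 * 3 ^ 9 * 5 ^ 4 * x ^ 21 = 0 := by linear_combination -h
    simpa [H2, H3, H5] using e
  have hy : y = 0 := by
    have h := id_y x y
    rw [hh1, hh2] at h
    have e : (2 : A) ^ 16 * 3 ^ 9 * 5 ^ 4 * y ^ 21 = 0 := by linear_combination -h
    simpa [H2, H3, H5] using e
  obtain ⟨a, b, hab⟩ := hxy
  rw [hx, hy] at hab
  simp at hab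

lemma prime_cop (P : Ideal (𝓞 KK)) (hP : P.IsPrime) (u v : ℤ) (huv : IsCoprime u v)
    (h6 : F6 (RingHom.id (𝓞 KK)) (u : 𝓞 KK) v ∈ P) (h24 : F24 (RingHom.id (𝓞 KK)) (u : 𝓞 KK) v ∈ P) :
    (2 : 𝓞 KK) ∈ P ∨ (3 : 𝓞 KK) ∈ P ∨ (5 : 𝓞 KK) ∈ P := by
  by_contra hn
  push Not at hn
  obtain ⟨n2, n3, n5⟩ := hn
  have key : ∀ z : 𝓞 KK, z ∉ P → Ideal.Quotient.mk P z ≠ 0 := fun z hz h =>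
    hz (Ideal.Quotient.eq_zero_iff_mem.1 h)
  refine dom_cop (Ideal.Quotient.mk P) (Ideal.Quotient.mk P u) (Ideal.Quotient.mk P v) ?_ ?_ ?_
    ?_ ?_ ?_
  · exact (huv.map (Int.castRingHom (𝓞 KK))).map (Ideal.Quotient.mk P)
  · have := map_F6 (Ideal.Quotient.mk P) (RingHom.id (𝓞 KK)) u v
    rw [RingHom.comp_id] at this
    rw [← this]
    exact Ideal.Quotient.eq_zero_iff_mem.2 h6
  · have := map_F24 (Ideal.Quotient.mk P) (RingHom.id (𝓞 KK)) u v
    rw [RingHom.comp_id] at this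
    rw [← this]
    exact Ideal.Quotient.eq_zero_iff_mem.2 h24
  · exact key _ n2
  · exact key _ n3
  · exact key _ n5


lemma p3_dvd : ev vp3 ∣ 3 := ⟨ev ⟨1215, -32, -457, 454, -170⟩, by
  rw [← ev_mul, ok_p3.1, ev_int]; simp⟩

lemma p5_dvd : ev vp5 ∣ 5 := ⟨ev ⟨-79, 32, -37, 3, -13⟩, by
  rw [← ev_mul, ok_p5.1, ev_int]; simp⟩

lemma p3_nu : ¬ IsUnit (ev vp3) := by
  intro h
  have h1 := h.map (Algebra.norm ℤ)
  rw [norm_ev] at h1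
  revert h1
  rw [Int.isUnit_iff]
  decide +kernel

lemma p5_nu : ¬ IsUnit (ev vp5) := by
  intro h
  have h1 := h.map (Algebra.norm ℤ)
  rw [norm_ev] at h1
  revert h1
  rw [Int.isUnit_iff]
  decide +kernel

lemma pow_par (p : 𝓞 KK) (i : ℕ) : ∃ (m : Bool) (w : 𝓞 KK), p ^ i = (if m then p else 1) * w ^ 2 := by
  rcases Nat.even_or_odd' i with ⟨j, h | h⟩
  · exact ⟨false, p ^ j, by rw [h]; simp [pow_mul, mul_comm, ← pow_mul]⟩
  · exact ⟨true, p ^ j, by rw [h]; simp [pow_succ]; ring⟩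

/-- Representatives of the possible square classes. -/
def clV (k : Bool × Bool × Bool) (m n : Bool) : V :=
  (Fv k).mul ((if m then vp3 else V.int 1).mul (if n then vp5 else V.int 1))

lemma class_of (a b w : 𝓞 KK) (ha : a ≠ 0) (hab : a * b = w ^ 2)
    (hc : ∀ P : Ideal (𝓞 KK), P.IsPrime → a ∈ P → b ∈ P → (3 : 𝓞 KK) ∈ P ∨ (5 : 𝓞 KK) ∈ P) :
    ∃ k m n, ∃ z : 𝓞 KK, a = ev (clV k m n) * z ^ 2 := by
  obtain ⟨i, a', ha', rfl⟩ := WfDvdMonoid.max_power_factor' ha p3_nu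
  have hne : a' ≠ 0 := right_ne_zero_of_mul ha
  obtain ⟨j, a1, ha1, rfl⟩ := WfDvdMonoid.max_power_factor' hne p5_nu
  have h3 : ¬ ev vp3 ∣ a1 := fun h => ha' (h.mul_left _)
  have hne1 : a1 ≠ 0 := right_ne_zero_of_mul hne
  have hcop : IsCoprime a1 (ev vp3 ^ i * ev vp5 ^ j * b) := by
    apply isCoprime_of_prime_dvd (fun h => hne1 h.1)
    intro z hz hz1 hz2
    have hsp : (Ideal.span {z}).IsPrime := (Ideal.span_singleton_prime hz.ne_zero).2 hz
    have key : (3 : 𝓞 KK) ∈ Ideal.span {z} ∨ (5 : 𝓞 KK) ∈ Ideal.span {z} := by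
      rcases hz.dvd_or_dvd hz2 with h | h
      · rcases hz.dvd_or_dvd h with h | h
        · exact Or.inl (Ideal.mem_span_singleton.2 ((hz.dvd_of_dvd_pow h).trans p3_dvd))
        · exact Or.inr (Ideal.mem_span_singleton.2 ((hz.dvd_of_dvd_pow h).trans p5_dvd))
      · refine hc _ hsp (Ideal.mem_span_singleton.2 ?_) (Ideal.mem_span_singleton.2 h)
        exact (hz1.mul_left _).mul_left _
    rcases key with h | h
    · have e := above3 hsp h
      apply h3
      rw [← Ideal.mem_span_singleton, ← e]
      exact Ideal.mem_span_singleton.2 hz1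
    · have e := above5 hsp h
      apply ha1
      rw [← Ideal.mem_span_singleton, ← e]
      exact Ideal.mem_span_singleton.2 hz1
  obtain ⟨d, x, hd⟩ := exists_associated_pow_of_mul_eq_pow' hcop (k := 2) (c := w)
    (by rw [← hab]; ring)
  obtain ⟨k, t, hk⟩ := unit_class x
  obtain ⟨m, w3, hm⟩ := pow_par (ev vp3) i
  obtain ⟨n, w5, hn⟩ := pow_par (ev vp5) j
  refine ⟨k, m, n, w3 * w5 * d * t, ?_⟩
  rw [hm, hn, ← hd, hk, clV, ev_mul, ev_mul]
  have e1 : ev (if m then vp3 else V.int 1) = if m then ev vp3 else 1 := by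
    split <;> simp [ev_one]
  have e2 : ev (if n then vp5 else V.int 1) = if n then ev vp5 else 1 := by
    split <;> simp [ev_one]
  rw [e1, e2]
  ring

/-- No square class is compatible with the residue modulo 8. -/
def tabC (t : V) : Prop := ∀ (k : Bool × Bool × Bool) (m n : Bool) (a b c d e : Fin 2),
  ¬ (V.sub ((clV k m n).mul ((V.mk a.val b.val c.val d.val e.val).mul
      ⟨a.val, b.val, c.val, d.val, e.val⟩)) t).dvd 4 ∨
  ∀ (a' b' c' d' e' : Fin 2),
    ¬ (V.sub ((clV k m n).mul ((V.mk (a.val + 2 * a'.val) (b.val + 2 * b'.val)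
      (c.val + 2 * c'.val) (d.val + 2 * d'.val) (e.val + 2 * e'.val)).mul
      ⟨a.val + 2 * a'.val, b.val + 2 * b'.val, c.val + 2 * c'.val, d.val + 2 * d'.val,
        e.val + 2 * e'.val⟩)) t).dvd 8

instance (t : V) : Decidable (tabC t) := by unfold tabC; infer_instance

lemma tab1 : tabC ⟨3, 1, 3, 0, 2⟩ := by decide +kernel
lemma tab2 : tabC ⟨7, 7, 3, 0, 4⟩ := by decide +kernel
lemma tab3 : tabC ⟨7, 6, 7, 4, 0⟩ := by decide +kernel
lemma tab4 : tabC ⟨7, 2, 7, 4, 0⟩ := by decide +kernel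

lemma ev_sub (x y : V) : ev (x.sub y) = ev x - ev y := by
  simp only [ev, V.sub]
  push_cast
  ring

lemma dvd_smul (y : V) (p : ℤ) : (y.smul p).dvd p := by
  simp [V.smul, V.dvd]

lemma dvd_of_ev {p : ℤ} {x : V} {r : 𝓞 KK} (h : ev x = p * r) : x.dvd p := by
  obtain ⟨y, rfl⟩ := ev_surj r
  rw [← ev_smul] at h
  rw [ev_inj h]
  exact dvd_smul y p

lemma no_class {t : V} (ht : tabC t) (k m n) (z r : 𝓞 KK)
    (h : ev (clV k m n) * z ^ 2 = ev t + 8 * r) : False := by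
  obtain ⟨⟨x0, x1, x2, x3, x4⟩, rfl⟩ := ev_surj z
  obtain ⟨a, m0, rfl⟩ := split2 x0
  obtain ⟨b, m1, rfl⟩ := split2 x1
  obtain ⟨c, m2, rfl⟩ := split2 x2
  obtain ⟨d, m3, rfl⟩ := split2 x3
  obtain ⟨e, m4, rfl⟩ := split2 x4
  have e1 : ev ⟨a.val + 2 * m0, b.val + 2 * m1, c.val + 2 * m2, d.val + 2 * m3, e.val + 2 * m4⟩ =
    ev ⟨a.val, b.val, c.val, d.val, e.val⟩ + 2 * ev ⟨m0, m1, m2, m3, m4⟩ := by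
    simp only [ev]; push_cast; ring
  rcases ht k m n a b c d e with h4 | h8
  · apply h4
    rw [e1] at h
    apply dvd_of_ev (r := 2 * r - ev (clV k m n) * (ev ⟨a.val, b.val, c.val, d.val, e.val⟩ *
      ev ⟨m0, m1, m2, m3, m4⟩ + ev ⟨m0, m1, m2, m3, m4⟩ ^ 2))
    rw [ev_sub, ev_mul, ev_mul]
    push_cast
    linear_combination h
  · obtain ⟨a', n0, rfl⟩ := split2 m0
    obtain ⟨b', n1, rfl⟩ := split2 m1
    obtain ⟨c', n2, rfl⟩ := split2 m2
    obtain ⟨d', n3, rfl⟩ := split2 m3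
    obtain ⟨e', n4, rfl⟩ := split2 m4
    apply h8 a' b' c' d' e'
    have e2 : ev ⟨a.val + 2 * (a'.val + 2 * n0), b.val + 2 * (b'.val + 2 * n1),
        c.val + 2 * (c'.val + 2 * n2), d.val + 2 * (d'.val + 2 * n3),
        e.val + 2 * (e'.val + 2 * n4)⟩ =
        ev ⟨a.val + 2 * a'.val, b.val + 2 * b'.val, c.val + 2 * c'.val, d.val + 2 * d'.val,
        e.val + 2 * e'.val⟩ + 4 * ev ⟨n0, n1, n2, n3, n4⟩ := by
      simp only [ev]; push_cast; ring
    rw [e2] at h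
    apply dvd_of_ev (r := r - ev (clV k m n) * (ev ⟨a.val + 2 * a'.val, b.val + 2 * b'.val,
      c.val + 2 * c'.val, d.val + 2 * d'.val, e.val + 2 * e'.val⟩ * ev ⟨n0, n1, n2, n3, n4⟩ +
      2 * ev ⟨n0, n1, n2, n3, n4⟩ ^ 2))
    rw [ev_sub, ev_mul, ev_mul]
    push_cast
    linear_combination h


/-- A sextic form with given coefficients. -/
noncomputable def al (A : ℕ → V) (x y : 𝓞 KK) : 𝓞 KK :=
  ev (A 0) * (y ^ 6) + ev (A 1) * (x * y ^ 5) + ev (A 2) * (x ^ 2 * y ^ 4) + ev (A 3) * (x ^ 3 * y ^ 3) + ev (A 4) * (x ^ 4 * y ^ 2) + ev (A 5) * (x ^ 5 * y) + ev (A 6) * (x ^ 6)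

lemma disc_false (u v y : ℤ) (huv : IsCoprime u v) (hy : fP u v = y ^ 2) {t s s' : V} (ht : tabC t)
    (h8 : ¬ t.dvd 8) (hs : t.mul s = (V.int 1).add (s'.smul 2)) (a r c b : 𝓞 KK)
    (ha : a = ev t + 8 * r) (hF : F6 (RingHom.id (𝓞 KK)) (u : 𝓞 KK) v = c * a)
    (w : 𝓞 KK) (hb : ∀ F : 𝓞 KK, c * a * F = 2 * (y : 𝓞 KK) ^ 2 → a * (b * F) = w ^ 2)
    (hb2 : b ∣ 16) : False := by
  have hf : F6 (RingHom.id (𝓞 KK)) (u : 𝓞 KK) v * F24 (RingHom.id (𝓞 KK)) (u : 𝓞 KK) v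
      = 2 * (y : 𝓞 KK) ^ 2 := by
    rw [F6_mul_F24]
    have := map_fP (Int.castRingHom (𝓞 KK)) u v
    simp only [eq_intCast] at this
    rw [← this, hy]
    push_cast
    ring
  have h2P : ∀ P : Ideal (𝓞 KK), P.IsPrime → a ∈ P → (2 : 𝓞 KK) ∉ P := by
    intro P hP h h2
    apply hP.ne_top
    rw [Ideal.eq_top_iff_one]
    have e := congrArg ev hs
    rw [ev_mul, ev_add, ev_one, ev_smul] at e
    have e1 : (1 : 𝓞 KK) = a * ev s - 2 * (4 * r * ev s + ev s') := by
      rw [ha]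
      push_cast at e
      linear_combination -e
    rw [e1]
    exact P.sub_mem (P.mul_mem_right _ h) (P.mul_mem_right _ h2)
  have ha0 : a ≠ 0 := by
    intro h
    apply h8
    apply dvd_of_ev (r := -r)
    push_cast
    linear_combination h - ha
  obtain ⟨k, m, n, z, hz⟩ := class_of a (b * F24 (RingHom.id (𝓞 KK)) (u : 𝓞 KK) v) w ha0
    (hb _ (by rw [← hF]; exact hf)) (by
      intro P hP h1 h2
      have h2n := h2P P hP h1
      rcases hP.mem_or_mem h2 with h | h
      · exfalso
        have h16 := P.mem_of_dvd hb2 h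
        apply h2n
        apply hP.mem_of_pow_mem 4
        norm_num
        exact h16
      · have := prime_cop P hP u v huv (by rw [hF]; exact P.mul_mem_left _ h1) h
        exact this.resolve_left h2n)
  exact no_class ht k m n z r (by rw [← hz, ha])

lemma odd_pow6 (v : ℤ) (h : v % 2 = 1) : ∃ n : ℤ, v ^ 6 = 1 + 8 * n := by
  obtain ⟨k, rfl⟩ : ∃ k, v = 2 * k + 1 := ⟨v / 2, by omega⟩
  obtain ⟨m, hm⟩ : ∃ m, k * (k + 1) = 2 * m := by
    obtain ⟨m, hm⟩ := Int.even_mul_succ_self k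
    exact ⟨m, by rw [hm]; ring⟩
  refine ⟨3 * m + 24 * m ^ 2 + 64 * m ^ 3, ?_⟩
  have : (2 * k + 1) ^ 2 = 1 + 8 * m := by linear_combination 4 * hm
  calc (2 * k + 1) ^ 6 = ((2 * k + 1) ^ 2) ^ 3 := by ring
    _ = _ := by rw [this]; ring

lemma qi_mul : ev vqi * ev ⟨-11, 5, -7, -1, -2⟩ = 2 := by
  rw [← ev_mul, ok_qi.1, ev_int]; simp

/-- Reduced coefficients. -/
def ad12 : ℕ → V
  | 0 => ⟨2178270451, -610359759, -111525493, -936133384, 312004778⟩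
  | 1 => ⟨17665206936, -5040327000, -553982680, -7327157064, 2548222352⟩
  | 2 => ⟨59752958400, -17340265280, -745594560, -23932293440, 8677187840⟩
  | 3 => ⟨107886064640, -31806233600, 582179840, -41754434560, 15765698560⟩
  | 4 => ⟨109643735040, -32800727040, 2436915200, -41041305600, 16117022720⟩
  | 5 => ⟨59458977792, -18029477888, 2258632704, -21548761088, 8788115456⟩
  | 6 => ⟨13439598592, -4126146560, 707788800, -4721737728, 1996488704⟩
  | _ => ⟨0, 0, 0, 0, 0⟩

/-- Coefficients after substitution. -/
def bd12 : ℕ → V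
  | 0 => ⟨-101452624, -11605920, -63188736, -6248632, 18493248⟩
  | 1 => ⟨-740245248, -78504320, -484226048, -65083648, 135798784⟩
  | 2 => ⟨-2229166080, -212326400, -1544232960, -268001280, 411397120⟩
  | 3 => ⟨-3538780160, -287047680, -2622914560, -568360960, 656670720⟩
  | 4 => ⟨-3114270720, -193986560, -2502164480, -661258240, 580648960⟩
  | 5 => ⟨-1434451968, -52428800, -1270874112, -402653184, 268435456⟩
  | 6 => ⟨-268435456, 0, -268435456, -100663296, 50331648⟩
  | _ => ⟨0, 0, 0, 0, 0⟩

lemma d12_0 : ev ((vqi.mul vqi).smul 8) * ev (ad12 0) = ev (bd12 0) := by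
  rw [← ev_mul]; exact congrArg ev (by decide +kernel)

lemma d12_1 : ev ((vqi.mul vqi).smul 8) * ev (ad12 1) = ev (bd12 1) := by
  rw [← ev_mul]; exact congrArg ev (by decide +kernel)

lemma d12_2 : ev ((vqi.mul vqi).smul 8) * ev (ad12 2) = ev (bd12 2) := by
  rw [← ev_mul]; exact congrArg ev (by decide +kernel)

lemma d12_3 : ev ((vqi.mul vqi).smul 8) * ev (ad12 3) = ev (bd12 3) := by
  rw [← ev_mul]; exact congrArg ev (by decide +kernel)

lemma d12_4 : ev ((vqi.mul vqi).smul 8) * ev (ad12 4) = ev (bd12 4) := by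
  rw [← ev_mul]; exact congrArg ev (by decide +kernel)

lemma d12_5 : ev ((vqi.mul vqi).smul 8) * ev (ad12 5) = ev (bd12 5) := by
  rw [← ev_mul]; exact congrArg ev (by decide +kernel)

lemma d12_6 : ev ((vqi.mul vqi).smul 8) * ev (ad12 6) = ev (bd12 6) := by
  rw [← ev_mul]; exact congrArg ev (by decide +kernel)

set_option maxHeartbeats 1000000 in
lemma F6_d12 (x y : 𝓞 KK) : F6 (RingHom.id (𝓞 KK)) (12 * y + 16 * x) y = ev ((vqi.mul vqi).smul 8) * al ad12 x y := by
  have h : F6 (RingHom.id (𝓞 KK)) (12 * y + 16 * x) y = al bd12 x y := by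
    simp only [F6, al, RingHom.id_apply, ev, c6, bd12]
    push_cast
    ring
  rw [h]
  simp only [al]
  rw [← d12_0, ← d12_1, ← d12_2, ← d12_3, ← d12_4, ← d12_5, ← d12_6]
  ring

/-- Reduced coefficients. -/
def ad2 : ℕ → V
  | 0 => ⟨62991, -9009, -36693, -52344, 7308⟩
  | 1 => ⟨2430936, -365400, -1347480, -1968264, 285552⟩
  | 2 => ⟨41371200, -7001280, -19901760, -31208640, 5015040⟩
  | 3 => ⟨415319040, -84864000, -143324160, -270658560, 53237760⟩
  | 4 => ⟨2582077440, -635248640, -474112000, -1367859200, 352337920⟩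
  | 5 => ⟨9060483072, -2556428288, -395575296, -3842244608, 1301282816⟩
  | 6 => ⟨13439598592, -4126146560, 707788800, -4721737728, 1996488704⟩
  | _ => ⟨0, 0, 0, 0, 0⟩

/-- Coefficients after substitution. -/
def bd2 : ℕ → V
  | 0 => ⟨-7344, -720, -3456, 648, 1008⟩
  | 1 => ⟨-315648, -40320, -142848, 29952, 48384⟩
  | 2 => ⟨-5345280, -768000, -2396160, 491520, 875520⟩
  | 3 => ⟨-45711360, -6881280, -21135360, 3440640, 7864320⟩
  | 4 => ⟨-204472320, -30146560, -103546880, 7208960, 36700160⟩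
  | 5 => ⟨-427819008, -52428800, -264241152, -25165824, 79691776⟩
  | 6 => ⟨-268435456, 0, -268435456, -100663296, 50331648⟩
  | _ => ⟨0, 0, 0, 0, 0⟩

lemma d2_0 : ev ((vqi.mul vqi).smul 8) * ev (ad2 0) = ev (bd2 0) := by
  rw [← ev_mul]; exact congrArg ev (by decide +kernel)

lemma d2_1 : ev ((vqi.mul vqi).smul 8) * ev (ad2 1) = ev (bd2 1) := by
  rw [← ev_mul]; exact congrArg ev (by decide +kernel)

lemma d2_2 : ev ((vqi.mul vqi).smul 8) * ev (ad2 2) = ev (bd2 2) := by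
  rw [← ev_mul]; exact congrArg ev (by decide +kernel)

lemma d2_3 : ev ((vqi.mul vqi).smul 8) * ev (ad2 3) = ev (bd2 3) := by
  rw [← ev_mul]; exact congrArg ev (by decide +kernel)

lemma d2_4 : ev ((vqi.mul vqi).smul 8) * ev (ad2 4) = ev (bd2 4) := by
  rw [← ev_mul]; exact congrArg ev (by decide +kernel)

lemma d2_5 : ev ((vqi.mul vqi).smul 8) * ev (ad2 5) = ev (bd2 5) := by
  rw [← ev_mul]; exact congrArg ev (by decide +kernel)

lemma d2_6 : ev ((vqi.mul vqi).smul 8) * ev (ad2 6) = ev (bd2 6) := by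
  rw [← ev_mul]; exact congrArg ev (by decide +kernel)

set_option maxHeartbeats 1000000 in
lemma F6_d2 (x y : 𝓞 KK) : F6 (RingHom.id (𝓞 KK)) (2 * y + 16 * x) y = ev ((vqi.mul vqi).smul 8) * al ad2 x y := by
  have h : F6 (RingHom.id (𝓞 KK)) (2 * y + 16 * x) y = al bd2 x y := by
    simp only [F6, al, RingHom.id_apply, ev, c6, bd2]
    push_cast
    ring
  rw [h]
  simp only [al]
  rw [← d2_0, ← d2_1, ← d2_2, ← d2_3, ← d2_4, ← d2_5, ← d2_6]
  ring

/-- Reduced coefficients. -/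
def ad0 : ℕ → V
  | 0 => ⟨16384, -5632, 3072, -4096, 2560⟩
  | 1 => ⟨6912, 0, -6912, -7936, 512⟩
  | 2 => ⟨10560, -5120, 8000, 1920, 1920⟩
  | 3 => ⟨-11360, 3040, 1120, 5280, -1600⟩
  | 4 => ⟨1080, -960, 2520, 1480, 280⟩
  | 5 => ⟨1392, -556, 496, -168, 240⟩
  | 6 => ⟨-209, 30, 119, 172, -24⟩
  | _ => ⟨0, 0, 0, 0, 0⟩

/-- Coefficients after substitution. -/
def bd0 : ℕ → V
  | 0 => ⟨-1024, 0, 0, 512, 0⟩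
  | 1 => ⟨4608, 1280, 2048, -512, -1024⟩
  | 2 => ⟨0, 640, 0, 0, -320⟩
  | 3 => ⟨320, 0, -320, -320, 0⟩
  | 4 => ⟨0, 160, -80, -40, -80⟩
  | 5 => ⟨-432, -100, -120, 96, 80⟩
  | 6 => ⟨-16, 0, -16, -6, 3⟩
  | _ => ⟨0, 0, 0, 0, 0⟩

lemma d0_0 : ev vqi * ev (ad0 0) = ev (bd0 0) := by
  rw [← ev_mul]; exact congrArg ev (by decide +kernel)

lemma d0_1 : ev vqi * ev (ad0 1) = ev (bd0 1) := by
  rw [← ev_mul]; exact congrArg ev (by decide +kernel)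

lemma d0_2 : ev vqi * ev (ad0 2) = ev (bd0 2) := by
  rw [← ev_mul]; exact congrArg ev (by decide +kernel)

lemma d0_3 : ev vqi * ev (ad0 3) = ev (bd0 3) := by
  rw [← ev_mul]; exact congrArg ev (by decide +kernel)

lemma d0_4 : ev vqi * ev (ad0 4) = ev (bd0 4) := by
  rw [← ev_mul]; exact congrArg ev (by decide +kernel)

lemma d0_5 : ev vqi * ev (ad0 5) = ev (bd0 5) := by
  rw [← ev_mul]; exact congrArg ev (by decide +kernel)

lemma d0_6 : ev vqi * ev (ad0 6) = ev (bd0 6) := by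
  rw [← ev_mul]; exact congrArg ev (by decide +kernel)

set_option maxHeartbeats 1000000 in
lemma F6_d0 (x y : 𝓞 KK) : F6 (RingHom.id (𝓞 KK)) x (2 * y) = ev vqi * al ad0 x y := by
  have h : F6 (RingHom.id (𝓞 KK)) x (2 * y) = al bd0 x y := by
    simp only [F6, al, RingHom.id_apply, ev, c6, bd0]
    push_cast
    ring
  rw [h]
  simp only [al]
  rw [← d0_0, ← d0_1, ← d0_2, ← d0_3, ← d0_4, ← d0_5, ← d0_6]
  ring

lemma al_d12 (t v : ℤ) (hv : v % 2 = 1) : ∃ r, al ad12 t v = ev ⟨3, 1, 3, 0, 2⟩ + 8 * r := by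
  obtain ⟨n, hn⟩ := odd_pow6 v hv
  have hn1 : (v : 𝓞 KK) ^ 6 = 1 + 8 * n := by exact_mod_cast congrArg (Int.cast : ℤ → 𝓞 KK) hn
  have e0 : ev (ad12 0) = ev ⟨3, 1, 3, 0, 2⟩ + 8 * ev ⟨272283806, -76294970, -13940687, -117016673, 39000597⟩ := by
    simp only [ev, ad12]; push_cast; ring
  have e1 : ev (ad12 1) = 8 * ev ⟨2208150867, -630040875, -69247835, -915894633, 318527794⟩ := by
    simp only [ev, ad12]; push_cast; ring
  have e2 : ev (ad12 2) = 8 * ev ⟨7469119800, -2167533160, -93199320, -2991536680, 1084648480⟩ := by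
    simp only [ev, ad12]; push_cast; ring
  have e3 : ev (ad12 3) = 8 * ev ⟨13485758080, -3975779200, 72772480, -5219304320, 1970712320⟩ := by
    simp only [ev, ad12]; push_cast; ring
  have e4 : ev (ad12 4) = 8 * ev ⟨13705466880, -4100090880, 304614400, -5130163200, 2014627840⟩ := by
    simp only [ev, ad12]; push_cast; ring
  have e5 : ev (ad12 5) = 8 * ev ⟨7432372224, -2253684736, 282329088, -2693595136, 1098514432⟩ := by
    simp only [ev, ad12]; push_cast; ring
  have e6 : ev (ad12 6) = 8 * ev ⟨1679949824, -515768320, 88473600, -590217216, 249561088⟩ := by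
    simp only [ev, ad12]; push_cast; ring
  refine ⟨ev (ad12 0) * n + ev ⟨272283806, -76294970, -13940687, -117016673, 39000597⟩ + ev ⟨2208150867, -630040875, -69247835, -915894633, 318527794⟩ * ((t : 𝓞 KK) * v ^ 5) + ev ⟨7469119800, -2167533160, -93199320, -2991536680, 1084648480⟩ * ((t : 𝓞 KK) ^ 2 * v ^ 4) + ev ⟨13485758080, -3975779200, 72772480, -5219304320, 1970712320⟩ * ((t : 𝓞 KK) ^ 3 * v ^ 3) + ev ⟨13705466880, -4100090880, 304614400, -5130163200, 2014627840⟩ * ((t : 𝓞 KK) ^ 4 * v ^ 2) + ev ⟨7432372224, -2253684736, 282329088, -2693595136, 1098514432⟩ * ((t : 𝓞 KK) ^ 5 * v) + ev ⟨1679949824, -515768320, 88473600, -590217216, 249561088⟩ * ((t : 𝓞 KK) ^ 6), ?_⟩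
  simp only [al, hn1]
  rw [e0, e1, e2, e3, e4, e5, e6]
  ring

lemma no_d12 (t v y : ℤ) (huv : IsCoprime (12 * v + 16 * t) v) (hv : v % 2 = 1)
    (hy : fP (12 * v + 16 * t) v = y ^ 2) : False := by
  obtain ⟨r, hr⟩ := al_d12 t v hv
  have e : ev ((vqi.mul vqi).smul 8) = 8 * ev vqi ^ 2 := by
    rw [ev_smul, ev_mul]; push_cast; ring
  refine disc_false _ v y huv hy tab1 (by decide) (s := ⟨1, 0, 1, 0, 0⟩) (s' := ⟨-5, -1, 4, 3, -1⟩)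
    (by decide) (al ad12 t v) r (ev ((vqi.mul vqi).smul 8)) ((2 * ev vqi) ^ 2) hr ?_ y ?_ ?_
  · rw [← F6_d12]
    push_cast
    rfl
  · intro F hF
    rw [e] at hF
    have h2 : (2 : 𝓞 KK) ≠ 0 := two_ne_zero
    apply mul_left_cancel₀ h2
    linear_combination hF
  · exact ⟨ev ⟨-11, 5, -7, -1, -2⟩ ^ 2, by linear_combination -(4 * ev vqi * ev ⟨-11, 5, -7, -1, -2⟩ + 8) * qi_mul⟩

lemma al_d2 (t v : ℤ) (hv : v % 2 = 1) : ∃ r, al ad2 t v = ev ⟨7, 7, 3, 0, 4⟩ + 8 * r := by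
  obtain ⟨n, hn⟩ := odd_pow6 v hv
  have hn1 : (v : 𝓞 KK) ^ 6 = 1 + 8 * n := by exact_mod_cast congrArg (Int.cast : ℤ → 𝓞 KK) hn
  have e0 : ev (ad2 0) = ev ⟨7, 7, 3, 0, 4⟩ + 8 * ev ⟨7873, -1127, -4587, -6543, 913⟩ := by
    simp only [ev, ad2]; push_cast; ring
  have e1 : ev (ad2 1) = 8 * ev ⟨303867, -45675, -168435, -246033, 35694⟩ := by
    simp only [ev, ad2]; push_cast; ring
  have e2 : ev (ad2 2) = 8 * ev ⟨5171400, -875160, -2487720, -3901080, 626880⟩ := by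
    simp only [ev, ad2]; push_cast; ring
  have e3 : ev (ad2 3) = 8 * ev ⟨51914880, -10608000, -17915520, -33832320, 6654720⟩ := by
    simp only [ev, ad2]; push_cast; ring
  have e4 : ev (ad2 4) = 8 * ev ⟨322759680, -79406080, -59264000, -170982400, 44042240⟩ := by
    simp only [ev, ad2]; push_cast; ring
  have e5 : ev (ad2 5) = 8 * ev ⟨1132560384, -319553536, -49446912, -480280576, 162660352⟩ := by
    simp only [ev, ad2]; push_cast; ring
  have e6 : ev (ad2 6) = 8 * ev ⟨1679949824, -515768320, 88473600, -590217216, 249561088⟩ := by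
    simp only [ev, ad2]; push_cast; ring
  refine ⟨ev (ad2 0) * n + ev ⟨7873, -1127, -4587, -6543, 913⟩ + ev ⟨303867, -45675, -168435, -246033, 35694⟩ * ((t : 𝓞 KK) * v ^ 5) + ev ⟨5171400, -875160, -2487720, -3901080, 626880⟩ * ((t : 𝓞 KK) ^ 2 * v ^ 4) + ev ⟨51914880, -10608000, -17915520, -33832320, 6654720⟩ * ((t : 𝓞 KK) ^ 3 * v ^ 3) + ev ⟨322759680, -79406080, -59264000, -170982400, 44042240⟩ * ((t : 𝓞 KK) ^ 4 * v ^ 2) + ev ⟨1132560384, -319553536, -49446912, -480280576, 162660352⟩ * ((t : 𝓞 KK) ^ 5 * v) + ev ⟨1679949824, -515768320, 88473600, -590217216, 249561088⟩ * ((t : 𝓞 KK) ^ 6), ?_⟩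
  simp only [al, hn1]
  rw [e0, e1, e2, e3, e4, e5, e6]
  ring

lemma no_d2 (t v y : ℤ) (huv : IsCoprime (2 * v + 16 * t) v) (hv : v % 2 = 1)
    (hy : fP (2 * v + 16 * t) v = y ^ 2) : False := by
  obtain ⟨r, hr⟩ := al_d2 t v hv
  have e : ev ((vqi.mul vqi).smul 8) = 8 * ev vqi ^ 2 := by
    rw [ev_smul, ev_mul]; push_cast; ring
  refine disc_false _ v y huv hy tab2 (by decide) (s := ⟨1, 0, 1, 0, 0⟩) (s' := ⟨-9, -1, 7, 2, -3⟩)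
    (by decide) (al ad2 t v) r (ev ((vqi.mul vqi).smul 8)) ((2 * ev vqi) ^ 2) hr ?_ y ?_ ?_
  · rw [← F6_d2]
    push_cast
    rfl
  · intro F hF
    rw [e] at hF
    have h2 : (2 : 𝓞 KK) ≠ 0 := two_ne_zero
    apply mul_left_cancel₀ h2
    linear_combination hF
  · exact ⟨ev ⟨-11, 5, -7, -1, -2⟩ ^ 2, by linear_combination -(4 * ev vqi * ev ⟨-11, 5, -7, -1, -2⟩ + 8) * qi_mul⟩

lemma al_d0 (u t : ℤ) (hu : u % 2 = 1) : ∃ r, al ad0 u t = ev ⟨7, 6, 7, 4, 0⟩ + 4 * t * bo1 + 8 * r := by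
  obtain ⟨n, hn⟩ := odd_pow6 u hu
  obtain ⟨k, hk⟩ : ∃ k, u = 2 * k + 1 := ⟨u / 2, by omega⟩
  have hn1 : (u : 𝓞 KK) ^ 6 = 1 + 8 * n := by exact_mod_cast congrArg (Int.cast : ℤ → 𝓞 KK) hn
  have hk1 : (u : 𝓞 KK) = 2 * k + 1 := by exact_mod_cast congrArg (Int.cast : ℤ → 𝓞 KK) hk
  have e6 : ev (ad0 6) = ev ⟨7, 6, 7, 4, 0⟩ + 8 * ev ⟨-27, 3, 14, 21, -3⟩ := by
    simp only [ev, ad0]; push_cast; ring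
  have e5 : ev (ad0 5) = 4 * bo1 + 8 * ev ⟨174, -70, 62, -21, 30⟩ := by
    simp only [ev, ad0]; push_cast; ring
  have e0 : ev (ad0 0) = 8 * ev ⟨2048, -704, 384, -512, 320⟩ := by
    simp only [ev, ad0]; push_cast; ring
  have e1 : ev (ad0 1) = 8 * ev ⟨864, 0, -864, -992, 64⟩ := by
    simp only [ev, ad0]; push_cast; ring
  have e2 : ev (ad0 2) = 8 * ev ⟨1320, -640, 1000, 240, 240⟩ := by
    simp only [ev, ad0]; push_cast; ring
  have e3 : ev (ad0 3) = 8 * ev ⟨-1420, 380, 140, 660, -200⟩ := by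
    simp only [ev, ad0]; push_cast; ring
  have e4 : ev (ad0 4) = 8 * ev ⟨135, -120, 315, 185, 35⟩ := by
    simp only [ev, ad0]; push_cast; ring
  have h5 : (u : 𝓞 KK) ^ 5 = 1 + 2 * (k * (u ^ 4 + u ^ 3 + u ^ 2 + u + 1)) := by
    linear_combination ((u : 𝓞 KK) ^ 4 + u ^ 3 + u ^ 2 + u + 1) * hk1
  refine ⟨ev (ad0 6) * n + ev ⟨-27, 3, 14, 21, -3⟩ + bo1 * (k * (u ^ 4 + u ^ 3 + u ^ 2 + u + 1)) * t + ev ⟨174, -70, 62, -21, 30⟩ * (u ^ 5 * t) + ev ⟨2048, -704, 384, -512, 320⟩ * ((t : 𝓞 KK) ^ 6) + ev ⟨864, 0, -864, -992, 64⟩ * ((u : 𝓞 KK) * (t : 𝓞 KK) ^ 5) + ev ⟨1320, -640, 1000, 240, 240⟩ * ((u : 𝓞 KK) ^ 2 * (t : 𝓞 KK) ^ 4) + ev ⟨-1420, 380, 140, 660, -200⟩ * ((u : 𝓞 KK) ^ 3 * (t : 𝓞 KK) ^ 3) + ev ⟨135, -120, 315, 185, 35⟩ * ((u : 𝓞 KK)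 ^ 4 * (t : 𝓞 KK) ^ 2), ?_⟩
  simp only [al, hn1]
  rw [e0, e1, e2, e3, e4, e5, e6]
  linear_combination 4 * bo1 * t * h5

lemma no_d0 (u t y : ℤ) (huv : IsCoprime u (2 * t)) (hu : u % 2 = 1)
    (hy : fP u (2 * t) = y ^ 2) : False := by
  obtain ⟨r, hr⟩ := al_d0 u t hu
  have hF : F6 (RingHom.id (𝓞 KK)) (u : 𝓞 KK) ((2 * t : ℤ) : 𝓞 KK) = ev vqi * al ad0 u t := by
    rw [← F6_d0]
    push_cast
    rfl
  have hb : ∀ F : 𝓞 KK, ev vqi * al ad0 u t * F = 2 * (y : 𝓞 KK) ^ 2 →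
      al ad0 u t * (2 * ev vqi * F) = (2 * (y : 𝓞 KK)) ^ 2 := by
    intro F hF
    linear_combination 2 * hF
  have hd : 2 * ev vqi ∣ 16 :=
    ⟨4 * ev ⟨-11, 5, -7, -1, -2⟩, by linear_combination -8 * qi_mul⟩
  rcases Int.even_or_odd' t with ⟨m, hm | hm⟩
  · refine disc_false _ _ y huv hy tab3 (by decide) (s := ⟨1, 1, 1, 0, 0⟩) (s' := ⟨-9, 14, 7, -9, -8⟩)
      (by decide) (al ad0 u t) (r + m * bo1) (ev vqi) (2 * ev vqi) ?_ hF _ hb hd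
    rw [hr, hm]
    push_cast
    ring
  · have e : ev ⟨7, 6, 7, 4, 0⟩ = ev ⟨7, 2, 7, 4, 0⟩ + 4 * bo1 := by
      simp only [ev]; push_cast; ring
    refine disc_false _ _ y huv hy tab4 (by decide) (s := ⟨1, 1, 1, 0, 0⟩) (s' := ⟨-9, 12, 3, -3, -6⟩)
      (by decide) (al ad0 u t) (r + (m + 1) * bo1) (ev vqi) (2 * ev vqi) ?_ hF _ hb hd
    rw [hr, hm, e]
    push_cast
    ring


lemma odd_pow30 (v : ℤ) (h : v % 2 = 1) : ∃ n : ℤ, v ^ 30 = 1 + 8 * n := by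
  obtain ⟨n, hn⟩ := odd_pow6 v h
  refine ⟨5 * n + 80 * n ^ 2 + 640 * n ^ 3 + 2560 * n ^ 4 + 4096 * n ^ 5, ?_⟩
  calc v ^ 30 = (v ^ 6) ^ 5 := by ring
    _ = _ := by rw [hn]; ring

lemma sq_four (y m : ℤ) (h : y ^ 2 = 4 * m + 3) : False := by
  rcases Int.even_or_odd' y with ⟨k, rfl | rfl⟩ <;> ring_nf at h <;> omega

lemma sq_eight (y m : ℤ) (h : y ^ 2 = 8 * m + 5) : False := by
  rcases Int.even_or_odd' y with ⟨k, rfl | rfl⟩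
  · ring_nf at h; omega
  · obtain ⟨j, hj⟩ := Int.even_mul_succ_self k
    have : (2 * k + 1) ^ 2 = 8 * j + 1 := by linear_combination 4 * hj
    omega

lemma sq_div (y m : ℤ) (h : y ^ 2 = 65536 * m) : ∃ z : ℤ, z ^ 2 = m := by
  have hd : (256 : ℤ) ∣ y := by
    rw [← Int.pow_dvd_pow_iff (n := 2) (by norm_num)]
    exact ⟨m, by rw [h]; norm_num⟩
  obtain ⟨z, rfl⟩ := hd
  exact ⟨z, by linarith⟩

set_option maxHeartbeats 4000000 in
lemma no_c1 (t v y : ℤ) (hv : v % 2 = 1) (hy : fP (1 * v + 2 * t) v = y ^ 2) : False := by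
  obtain ⟨n, hn⟩ := odd_pow30 v hv
  obtain ⟨w, h⟩ : ∃ w, fP (1 * v + 2 * t) v = 1 * (3 * v ^ 30 + 4 * w) := by
    refine ⟨5091249442 * v ^ 30 - 25563825015 * t * v ^ 29 - 3536829003345 * t ^ 2 * v ^ 28
      - 67858138462160 * t ^ 3 * v ^ 27 - 724817295260820 * t ^ 4 * v ^ 26 - 5287772425216752 * t ^ 5 * v ^ 25
      - 28773380517238800 * t ^ 6 * v ^ 24 - 122987906565811200 * t ^ 7 * v ^ 23 - 428618448193435200 * t ^ 8 * v ^ 22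
      - 1257758282657299200 * t ^ 9 * v ^ 21 - 3208746004519691520 * t ^ 10 * v ^ 20 - 7352576071956172800 * t ^ 11 * v ^ 19
      - 15567886934515737600 * t ^ 12 * v ^ 18 - 30927771148702003200 * t ^ 13 * v ^ 17 - 57487404891876249600 * t ^ 14 * v ^ 16
      - 98370854686115758080 * t ^ 15 * v ^ 15 - 151923681534892032000 * t ^ 16 * v ^ 14 - 208263863924681932800 * t ^ 17 * v ^ 13
      - 250462540026470400000 * t ^ 18 * v ^ 12 - 262224602250529996800 * t ^ 19 * v ^ 11 - 237758990097678336000 * t ^ 20 * v ^ 10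
      - 185900897775884697600 * t ^ 21 * v ^ 9 - 124744960632029184000 * t ^ 22 * v ^ 8 - 71330789788640870400 * t ^ 23 * v ^ 7
      - 34353729699840000000 * t ^ 24 * v ^ 6 - 13671208758842228736 * t ^ 25 * v ^ 5 - 4361018809767690240 * t ^ 26 * v ^ 4
      - 1063279443386040320 * t ^ 27 * v ^ 3 - 183392480589250560 * t ^ 28 * v ^ 2 - 19425853880401920 * t ^ 29 * v
      - 900248499126272 * t ^ 30, ?_⟩
    simp only [fP]
    ring
  rw [h, hn] at hy
  have hz := hy.symm
  rw [one_mul] at hz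
  exact sq_four _ (6 * n + w) (by rw [hz]; ring)

set_option maxHeartbeats 4000000 in
lemma no_c0 (t v y : ℤ) (hv : v % 2 = 1) (hy : fP (0 * v + 8 * t) v = y ^ 2) : False := by
  obtain ⟨n, hn⟩ := odd_pow30 v hv
  obtain ⟨w, h⟩ : ∃ w, fP (0 * v + 8 * t) v = 65536 * (3 * v ^ 30 + 4 * w) := by
    refine ⟨-2 * v ^ 30 + 195 * t * v ^ 29 + 1740 * t ^ 2 * v ^ 28
      + 116000 * t ^ 3 * v ^ 27 - 501120 * t ^ 4 * v ^ 26 + 46503936 * t ^ 5 * v ^ 25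
      + 1469952000 * t ^ 6 * v ^ 24 + 1282867200 * t ^ 7 * v ^ 23 - 236047564800 * t ^ 8 * v ^ 22
      + 262275072000 * t ^ 9 * v ^ 21 + 3650869002240 * t ^ 10 * v ^ 20 + 367604740915200 * t ^ 11 * v ^ 19
      - 2423841305395200 * t ^ 12 * v ^ 18 + 36740331365990400 * t ^ 13 * v ^ 17 + 624585633221836800 * t ^ 14 * v ^ 16
      + 1332449350873251840 * t ^ 15 * v ^ 15 + 39973480526197555200 * t ^ 16 * v ^ 14 - 159893922104790220800 * t ^ 17 * v ^ 13
      - 1726436335405970227200 * t ^ 18 * v ^ 12 - 13110971594177721139200 * t ^ 19 * v ^ 11 - 14949570188254516346880 * t ^ 20 * v ^ 10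
      - 165477393663339056332800 * t ^ 21 * v ^ 9 - 2869100896259527409664000 * t ^ 22 * v ^ 8 - 235558076349837370982400 * t ^ 23 * v ^ 7
      + 81524722503894214429900800 * t ^ 24 * v ^ 6 - 152774787261565422670970880 * t ^ 25 * v ^ 5 - 449003596703739828806615040 * t ^ 26 * v ^ 4
      - 2922713752487307795056558080 * t ^ 27 * v ^ 3 + 418228270987957696148275200 * t ^ 28 * v ^ 2 - 26045787323284069908071055360 * t ^ 29 * v
      - 15837339082835651847784497152 * t ^ 30, ?_⟩
    simp only [fP]
    ring
  rw [h, hn] at hy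
  obtain ⟨z, hz⟩ := sq_div _ _ hy.symm
  exact sq_four _ (6 * n + w) (by rw [hz]; ring)

set_option maxHeartbeats 4000000 in
lemma no_c6 (t v y : ℤ) (hv : v % 2 = 1) (hy : fP (6 * v + 8 * t) v = y ^ 2) : False := by
  obtain ⟨n, hn⟩ := odd_pow30 v hv
  obtain ⟨w, h⟩ : ∃ w, fP (6 * v + 8 * t) v = 65536 * (3 * v ^ 30 + 4 * w) := by
    refine ⟨-10426965370943676096753848 * v ^ 30 - 402687385781409950146159485 * t * v ^ 29 - 7516289247761270300581759020 * t ^ 2 * v ^ 28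
      - 90298343526916723711130988640 * t ^ 3 * v ^ 27 - 784489611946952265589284117120 * t ^ 4 * v ^ 26 - 5249873009880106958645018247168 * t ^ 5 * v ^ 25
      - 28147459959440345408857282252800 * t ^ 6 * v ^ 24 - 124160756747653875887424892108800 * t ^ 7 * v ^ 23 - 459165498022961722146876633907200 * t ^ 8 * v ^ 22
      - 1443424726910701171158913567948800 * t ^ 9 * v ^ 21 - 3897049641594530419675024400056320 * t ^ 10 * v ^ 20 - 9106488738145870842438826013491200 * t ^ 11 * v ^ 19
      - 18523826883913048004776940902809600 * t ^ 12 * v ^ 18 - 32935802711055958835847328746700800 * t ^ 13 * v ^ 17 - 51329408912463653838687179479449600 * t ^ 14 * v ^ 16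
      - 70227095619163612408878987969822720 * t ^ 15 * v ^ 15 - 84387442032026853542585104859136000 * t ^ 16 * v ^ 14 - 89003187435930277922971061531443200 * t ^ 17 * v ^ 13
      - 82247177564883322153395812302848000 * t ^ 18 * v ^ 12 - 66394510015886799777394418987827200 * t ^ 19 * v ^ 11 - 46617942050793922718472716943360000 * t ^ 20 * v ^ 10
      - 28300508707985085444316260099686400 * t ^ 21 * v ^ 9 - 14736504016511458607706503380992000 * t ^ 22 * v ^ 8 - 6512732032798178551978692024729600 * t ^ 23 * v ^ 7
      - 2408658617629867592748594364416000 * t ^ 24 * v ^ 6 - 731317829011186671323477729869824 * t ^ 25 * v ^ 5 - 177448464521497918256336590602240 * t ^ 26 * v ^ 4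
      - 33068738947836179591965054074880 * t ^ 27 * v ^ 3 - 4441276552841789124309166325760 * t ^ 28 * v ^ 2 - 382385916687086236483222241280 * t ^ 29 * v
      - 15837339082835651847784497152 * t ^ 30, ?_⟩
    simp only [fP]
    ring
  rw [h, hn] at hy
  obtain ⟨z, hz⟩ := sq_div _ _ hy.symm
  exact sq_four _ (6 * n + w) (by rw [hz]; ring)

set_option maxHeartbeats 4000000 in
lemma no_c4 (t v y : ℤ) (hv : v % 2 = 1) (hy : fP (4 * v + 16 * t) v = y ^ 2) : False := by
  obtain ⟨n, hn⟩ := odd_pow30 v hv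
  obtain ⟨w, h⟩ : ∃ w, fP (4 * v + 16 * t) v = 65536 * (5 * v ^ 30 + 8 * w) := by
    refine ⟨-45351750180591283985 * v ^ 30 - 5166250089960877265625 * t * v ^ 29 - 284449796535642349125000 * t ^ 2 * v ^ 28
      - 10081009899071612078000000 * t ^ 3 * v ^ 27 - 258385755121302379824000000 * t ^ 4 * v ^ 26 - 5101909148443704148684800000 * t ^ 5 * v ^ 25
      - 80720434379088269597491200000 * t ^ 6 * v ^ 24 - 1050897104545981200924672000000 * t ^ 7 * v ^ 23 - 11472588555878608449778483200000 * t ^ 8 * v ^ 22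
      - 106487895223491379374273331200000 * t ^ 9 * v ^ 21 - 849111746889820966559919636480000 * t ^ 10 * v ^ 20 - 5861657230369026846126810071040000 * t ^ 11 * v ^ 19
      - 35234175611349447957626832814080000 * t ^ 12 * v ^ 18 - 185178510924661303871929571082240000 * t ^ 13 * v ^ 17 - 853295246416908868681467533721600000 * t ^ 14 * v ^ 16
      - 3452721021772176353882262485336064000 * t ^ 15 * v ^ 15 - 12273151735912180699319429379391488000 * t ^ 16 * v ^ 14 - 38298402320908395619174730497523712000 * t ^ 17 * v ^ 13
      - 104721912387227553898624753959174144000 * t ^ 18 * v ^ 12 - 250146747814786743512792862547771392000 * t ^ 19 * v ^ 11 - 519655962243944119466452837859957145600 * t ^ 20 * v ^ 10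
      - 933142682665278484614950422067124633600 * t ^ 21 * v ^ 9 - 1436654019894340421231573051725420953600 * t ^ 22 * v ^ 8 - 1876038444717385458919061953193390899200 * t ^ 23 * v ^ 7
      - 2048202032864120843415346680487634534400 * t ^ 24 * v ^ 6 - 1833467130157516235469786795289488654336 * t ^ 25 * v ^ 5 - 1309400934186529320989904018719291473920 * t ^ 26 * v ^ 4
      - 716599490261191772331840433819159101440 * t ^ 27 * v ^ 3 - 281797678162406066236091898138093158400 * t ^ 28 * v ^ 2 - 70761162874918928375568043066880163840 * t ^ 29 * v
      - 8502606677055219953634548165455642624 * t ^ 30, ?_⟩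
    simp only [fP]
    ring
  rw [h, hn] at hy
  obtain ⟨z, hz⟩ := sq_div _ _ hy.symm
  exact sq_eight _ (5 * n + w) (by rw [hz]; ring)

set_option maxHeartbeats 4000000 in
lemma no_c10 (t v y : ℤ) (hv : v % 2 = 1) (hy : fP (10 * v + 16 * t) v = y ^ 2) : False := by
  obtain ⟨n, hn⟩ := odd_pow30 v hv
  obtain ⟨w, h⟩ : ∃ w, fP (10 * v + 16 * t) v = 65536 * (5 * v ^ 30 + 8 * w) := by
    refine ⟨-15394885374392932842270590670395 * v ^ 30 - 722376804014617247434979482566705 * t * v ^ 29 - 16380247514873066178129565049462520 * t ^ 2 * v ^ 28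
      - 239034917694335151952123645583062400 * t ^ 3 * v ^ 27 - 2522185436305911578909924205774812160 * t ^ 4 * v ^ 26 - 20497072003112833825419004023698817024 * t ^ 5 * v ^ 25
      - 133439016421023059198443458335293440000 * t ^ 6 * v ^ 24 - 714627347179814225348551013767525171200 * t ^ 7 * v ^ 23 - 3208280459716359226592194116687652454400 * t ^ 8 * v ^ 22
      - 12242433664678793064111287914463232000000 * t ^ 9 * v ^ 21 - 40119093794474962438247918961008176005120 * t ^ 10 * v ^ 20 - 113785995639755535025909426884755796787200 * t ^ 11 * v ^ 19
      - 280921183499081512070955989070750783897600 * t ^ 12 * v ^ 18 - 606241255234130606885469671971196869017600 * t ^ 13 * v ^ 17 - 1146809360065591698567918201387541227110400 * t ^ 14 * v ^ 16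
      - 1904675920910326594689760663571057281597440 * t ^ 15 * v ^ 15 - 2778764370911893858909479753895066887782400 * t ^ 16 * v ^ 14 - 3559007102330099342225814839389114387660800 * t ^ 17 * v ^ 13
      - 3994985320963145706096255545987532482150400 * t ^ 18 * v ^ 12 - 3918796863595356464981519370878716792012800 * t ^ 19 * v ^ 11 - 3344989049450984956237453470792093731389440 * t ^ 20 * v ^ 10
      - 2469997976614809564484135015465062550732800 * t ^ 21 * v ^ 9 - 1565487224417898666488827015473792024576000 * t ^ 22 * v ^ 8 - 842798392193939829708706778127252691353600 * t ^ 23 * v ^ 7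
      - 380071282788587242895912971285942606233600 * t ^ 24 * v ^ 6 - 140874743986820193852493081806275220602880 * t ^ 25 * v ^ 5 - 41787288190321067598868316470554321223680 * t ^ 26 * v ^ 4
      - 9535916628736813525607727639324388229120 * t ^ 27 * v ^ 3 - 1571445717250136695421632742549146828800 * t ^ 28 * v ^ 2 - 166415487991790152853956709928256143360 * t ^ 29 * v
      - 8502606677055219953634548165455642624 * t ^ 30, ?_⟩
    simp only [fP]
    ring
  rw [h, hn] at hy
  obtain ⟨z, hz⟩ := sq_div _ _ hy.symm
  exact sq_eight _ (5 * n + w) (by rw [hz]; ring)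

lemma fP_hom (d x y : ℤ) : fP (d * x) (d * y) = (d ^ 15) ^ 2 * fP x y := by
  simp only [fP]
  ring

lemma res16 : ∀ a b : Fin 16, (b.val : ℤ) % 2 = 1 → ((a.val : ℤ) - 1 * b.val) % 2 = 0 ∨
    ((a.val : ℤ) - 0 * b.val) % 8 = 0 ∨ ((a.val : ℤ) - 6 * b.val) % 8 = 0 ∨
    ((a.val : ℤ) - 4 * b.val) % 16 = 0 ∨ ((a.val : ℤ) - 10 * b.val) % 16 = 0 ∨
    ((a.val : ℤ) - 12 * b.val) % 16 = 0 ∨ ((a.val : ℤ) - 2 * b.val) % 16 = 0 := by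
  decide +kernel

lemma fP_odd (u v y : ℤ) (huv : IsCoprime u v) (hv : v % 2 = 1) (hy : fP u v = y ^ 2) : False := by
  have key : (∃ t, u = 1 * v + 2 * t) ∨ (∃ t, u = 0 * v + 8 * t) ∨ (∃ t, u = 6 * v + 8 * t) ∨
      (∃ t, u = 4 * v + 16 * t) ∨ (∃ t, u = 10 * v + 16 * t) ∨ (∃ t, u = 12 * v + 16 * t) ∨
      (∃ t, u = 2 * v + 16 * t) := by
    have h : (u - 1 * v) % 2 = 0 ∨ (u - 0 * v) % 8 = 0 ∨ (u - 6 * v) % 8 = 0 ∨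
        (u - 4 * v) % 16 = 0 ∨ (u - 10 * v) % 16 = 0 ∨ (u - 12 * v) % 16 = 0 ∨
        (u - 2 * v) % 16 = 0 := by
      have h := res16 ⟨(u % 16).toNat, by omega⟩ ⟨(v % 16).toNat, by omega⟩
      have e1 : (((u % 16).toNat : ℕ) : ℤ) = u % 16 := by omega
      have e2 : (((v % 16).toNat : ℕ) : ℤ) = v % 16 := by omega
      rw [e1, e2] at h
      rcases h (by omega) with h | h | h | h | h | h | h
      · exact Or.inl (by omega)
      · exact Or.inr (Or.inl (by omega))
      · exact Or.inr (Or.inr (Or.inl (by omega)))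
      · exact Or.inr (Or.inr (Or.inr (Or.inl (by omega))))
      · exact Or.inr (Or.inr (Or.inr (Or.inr (Or.inl (by omega)))))
      · exact Or.inr (Or.inr (Or.inr (Or.inr (Or.inr (Or.inl (by omega))))))
      · exact Or.inr (Or.inr (Or.inr (Or.inr (Or.inr (Or.inr (by omega))))))
    rcases h with h | h | h | h | h | h | h
    · exact Or.inl ⟨(u - 1 * v) / 2, by omega⟩
    · exact Or.inr (Or.inl ⟨(u - 0 * v) / 8, by omega⟩)
    · exact Or.inr (Or.inr (Or.inl ⟨(u - 6 * v) / 8, by omega⟩))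
    · exact Or.inr (Or.inr (Or.inr (Or.inl ⟨(u - 4 * v) / 16, by omega⟩)))
    · exact Or.inr (Or.inr (Or.inr (Or.inr (Or.inl ⟨(u - 10 * v) / 16, by omega⟩))))
    · exact Or.inr (Or.inr (Or.inr (Or.inr (Or.inr (Or.inl ⟨(u - 12 * v) / 16, by omega⟩)))))
    · exact Or.inr (Or.inr (Or.inr (Or.inr (Or.inr (Or.inr ⟨(u - 2 * v) / 16, by omega⟩)))))
  rcases key with ⟨t, rfl⟩ | ⟨t, rfl⟩ | ⟨t, rfl⟩ | ⟨t, rfl⟩ | ⟨t, rfl⟩ | ⟨t, rfl⟩ | ⟨t, rfl⟩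
  · exact no_c1 t v y hv hy
  · exact no_c0 t v y hv hy
  · exact no_c6 t v y hv hy
  · exact no_c4 t v y hv hy
  · exact no_c10 t v y hv hy
  · exact no_d12 t v y huv hv hy
  · exact no_d2 t v y huv hv hy

lemma fP_cop (u v y : ℤ) (huv : IsCoprime u v) (hy : fP u v = y ^ 2) : False := by
  rcases Int.emod_two_eq_zero_or_one v with hv | hv
  · obtain ⟨t, rfl⟩ := Int.dvd_of_emod_eq_zero hv
    refine no_d0 u t y huv ?_ hy
    rcases Int.emod_two_eq_zero_or_one u with hu | hu
    · exfalso
      obtain ⟨s, rfl⟩ := Int.dvd_of_emod_eq_zero hu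
      obtain ⟨a, b, hab⟩ := huv
      have : 2 * (a * s + b * t) = 1 := by linear_combination hab
      omega
    · exact hu
  · exact fP_odd u v y huv hv hy

lemma fP_main (u v y : ℤ) (hne : (u, v) ≠ (0, 0)) (hy : y ^ 2 = fP u v) : False := by
  have hg : 0 < Int.gcd u v := by
    rw [Int.gcd_pos_iff]
    by_contra hn
    push Not at hn
    exact hne (by rw [hn.1, hn.2])
  obtain ⟨d, u', v', hd, hcop, rfl, rfl⟩ : ∃ (d u' v' : ℤ), d ≠ 0 ∧ IsCoprime u' v' ∧
      u = d * u' ∧ v = d * v' := by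
    obtain ⟨u', v', h1, h2, h3⟩ := Int.exists_gcd_one hg
    exact ⟨Int.gcd u v, u', v', by exact_mod_cast hg.ne', Int.isCoprime_iff_gcd_eq_one.2 h1,
      by rw [mul_comm]; exact h2, by rw [mul_comm]; exact h3⟩
  rw [fP_hom] at hy
  have hdv : d ^ 15 ∣ y := by
    rw [← Int.pow_dvd_pow_iff (n := 2) (by norm_num)]
    exact ⟨_, hy⟩
  obtain ⟨z, rfl⟩ := hdv
  rw [mul_pow] at hy
  exact fP_cop u' v' z hcop (mul_left_cancel₀ (pow_ne_zero 2 (pow_ne_zero 15 hd)) hy).symm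

/-- The form `f` is homogeneous of degree 30 with integer coefficients, and the
genus-14 hyperelliptic curve `C_23 : y² = f(u,v)` has no rational points. -/
theorem rational_points_C23 :
    fC23.IsHomogeneous 30 ∧
    (∀ m : Fin 2 →₀ ℕ, ∃ z : ℤ, coeff m fC23 = (z : ℚ)) ∧
    ¬ ∃ u v y : ℤ, (u, v) ≠ (0, 0) ∧
        (y : ℚ) ^ 2 = eval ![(u : ℚ), (v : ℚ)] fC23 := by
  refine ⟨fC23_hom, fC23_int, ?_⟩
  rintro ⟨u, v, y, hne, hy⟩
  rw [fC23_eval] at hy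
  exact fP_main u v y hne (by exact_mod_cast hy)
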